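/- Let n ≥ 3, 2 ≤ i ≤ n−1, and let Φ_i : 𝒦ⁿ → 𝒦ⁿ be a C^∞₊ regular, translation invariant, even Minkowski valuation of degree i which commutes with SO(n). Then there exists ε > 0 such that: if K ∈ 𝒦ⁿ has a C² support function satisfying ‖h_{γK} − h_{𝔹ⁿ}‖_{C²(𝕊^{n−1})} < ε for some γ > 0, and Φ_i²K = αK for some α > 0, then K is a Euclidean ball. -/

import Mathlib

open scoped InnerProductSpace Pointwise
open MeasureTheory Metric Filter Topology

noncomputable section

/-- Euclidean space `ℝⁿ`. -/
abbrev En (n : ℕ) := EuclideanSpace ℝ (Fin n)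

namespace MinkIter

variable {n : ℕ}

/-- The unit sphere `𝕊^{n-1}` as a subtype. -/
abbrev Sph (n : ℕ) := Metric.sphere (0 : En n) 1

/-- Spherical Lebesgue measure on `𝕊^{n-1}`. -/
def sphVol (n : ℕ) : Measure (Sph n) := (volume : Measure (En n)).toSphere

/-- A fixed pole `ē ∈ 𝕊^{n-1}`. -/
def pole (n : ℕ) : En n :=
  if h : 0 < n then EuclideanSpace.single (⟨0, h⟩ : Fin n) 1 else 0

/-- The support function of a convex body, as a function on all of `ℝⁿ`. -/
def supp (K : ConvexBody (En n)) (x : En n) : ℝ :=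
  sSup ((fun y => ⟪x, y⟫_ℝ) '' (K : Set (En n)))

/-- The Euclidean unit ball `𝔹ⁿ` as a convex body. -/
def ballB (n : ℕ) : ConvexBody (En n) :=
  ⟨closedBall 0 1, convex_closedBall 0 1, isCompact_closedBall 0 1, ⟨0, by simp⟩⟩

/-- The dilate `c • K` of a convex body. -/
def scale (c : ℝ) (K : ConvexBody (En n)) : ConvexBody (En n) :=
  ⟨c • (K : Set (En n)), K.convex.smul c, K.isCompact.smul c, K.nonempty.smul_set⟩

/-- The translate `K + x` of a convex body. -/
def translate (K : ConvexBody (En n)) (x : En n) : ConvexBody (En n) :=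
  ⟨(fun y => x + y) '' (K : Set (En n)), K.convex.translate x,
    K.isCompact.image (continuous_add_left x), K.nonempty.image _⟩

/-- A linear isometry of `ℝⁿ` is a rotation (element of `SO(n)`) if it preserves
orientation. -/
def IsRotation (ρ : En n ≃ₗᵢ[ℝ] En n) : Prop :=
  0 < LinearMap.det (ρ.toLinearEquiv.toLinearMap)

/-- The image `ρ K` of a convex body under a linear isometry. -/
def rotate (ρ : En n ≃ₗᵢ[ℝ] En n) (K : ConvexBody (En n)) : ConvexBody (En n) :=
  ⟨ρ '' (K : Set (En n)), K.convex.linear_image ρ.toLinearEquiv.toLinearMap,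
    K.isCompact.image ρ.continuous, K.nonempty.image _⟩

/-- `Φ` is a Minkowski valuation: `ΦK + ΦL = Φ(K ∪ L) + Φ(K ∩ L)` whenever `K ∪ L`
is convex (Minkowski addition on the left). -/
def IsMinkowskiValuation (Φ : ConvexBody (En n) → ConvexBody (En n)) : Prop :=
  ∀ (K L : ConvexBody (En n)) (hu : Convex ℝ ((K : Set (En n)) ∪ (L : Set (En n))))
    (hi : ((K : Set (En n)) ∩ (L : Set (En n))).Nonempty),
    Φ K + Φ L =
      Φ ⟨(K : Set (En n)) ∪ (L : Set (En n)), hu, K.isCompact.union L.isCompact,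
          K.nonempty.inl⟩ +
      Φ ⟨(K : Set (En n)) ∩ (L : Set (En n)), K.convex.inter L.convex,
          K.isCompact.inter_right L.isCompact.isClosed, hi⟩

/-- `Φ` is translation invariant. -/
def TranslationInvariant (Φ : ConvexBody (En n) → ConvexBody (En n)) : Prop :=
  ∀ (K : ConvexBody (En n)) (x : En n), Φ (translate K x) = Φ K

/-- `Φ` is (positively) homogeneous of degree `i`. -/
def HasDegree (i : ℕ) (Φ : ConvexBody (En n) → ConvexBody (En n)) : Prop :=
  ∀ (K : ConvexBody (En n)) (c : ℝ), 0 ≤ c → Φ (scale c K) = scale (c ^ i) (Φ K)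

/-- `Φ` commutes with `SO(n)`. -/
def RotationEquivariant (Φ : ConvexBody (En n) → ConvexBody (En n)) : Prop :=
  ∀ ρ : En n ≃ₗᵢ[ℝ] En n, IsRotation ρ → ∀ K, Φ (rotate ρ K) = rotate ρ (Φ K)

/-- `Φ` is even: `Φ(-K) = ΦK`. -/
def IsEven (Φ : ConvexBody (En n) → ConvexBody (En n)) : Prop :=
  ∀ K, Φ (scale (-1) K) = Φ K

/-- `Φ` is monotone w.r.t. set inclusion. -/
def MonotoneVal (Φ : ConvexBody (En n) → ConvexBody (En n)) : Prop :=
  ∀ K L : ConvexBody (En n), (K : Set (En n)) ⊆ (L : Set (En n)) →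
    (Φ K : Set (En n)) ⊆ (Φ L : Set (En n))

/-- `Φ` is non-trivial: `ΦK ≠ {o}` for some `K`. -/
def NontrivialVal (Φ : ConvexBody (En n) → ConvexBody (En n)) : Prop :=
  ∃ K : ConvexBody (En n), (Φ K : Set (En n)) ≠ {0}

/-- The mixed volume `V(K₁,…,Kₙ)`, via polarization of the volume. -/
def mixedVol (Ks : Fin n → ConvexBody (En n)) : ℝ :=
  ((n.factorial : ℝ))⁻¹ *
    ∑ S : Finset (Fin n), (-1 : ℝ) ^ (n - S.card) *
      (volume ((∑ k ∈ S, Ks k : ConvexBody (En n)) : Set (En n))).toReal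

/-- `κ_m`, the volume of the `m`-dimensional unit ball. -/
def kappa (m : ℕ) : ℝ := (volume (closedBall (0 : En m) 1)).toReal

/-- `ω_m`, the surface area of the `m`-dimensional unit ball. -/
def omegaS (m : ℕ) : ℝ := m * kappa m

/-- The `j`-th intrinsic volume `V_j(K) = binom(n,j) V(K[j],𝔹ⁿ[n-j]) / κ_{n-j}`. -/
def intrinsicVol (j : ℕ) (K : ConvexBody (En n)) : ℝ :=
  (n.choose j : ℝ) / kappa (n - j) *
    mixedVol (fun k : Fin n => if (k : ℕ) < j then K else ballB n)

/-- `μ` is the area measure of order `i` of `K`: for every convex body `L`,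
`∫ h_L dμ = n V(L, K[i], 𝔹ⁿ[n-1-i])`. -/
def IsAreaMeasure (i : ℕ) (K : ConvexBody (En n)) (μ : Measure (Sph n)) : Prop :=
  ∀ L : ConvexBody (En n),
    (∫ v : Sph n, supp L (v : En n) ∂μ) =
      n * mixedVol (fun k : Fin n =>
        if (k : ℕ) = 0 then L else if (k : ℕ) ≤ i then K else ballB n)

/-- `Φ` is generated by the zonal function with profile `g : [-1,1] → ℝ`, i.e.
`h_{ΦK} = S_i(K,·) ∗ g` where `∗` is the spherical convolution. -/
def GeneratedBy (i : ℕ) (Φ : ConvexBody (En n) → ConvexBody (En n)) (g : ℝ → ℝ) : Prop :=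
  ∀ (K : ConvexBody (En n)) (μ : Measure (Sph n)), IsAreaMeasure i K μ →
    ∀ u : En n, ‖u‖ = 1 →
      supp (Φ K) u = ∫ v : Sph n, g ⟪u, (v : En n)⟫_ℝ ∂μ

/-- `L` is a body of revolution: invariant under all rotations fixing the pole. -/
def IsZonalBody (L : ConvexBody (En n)) : Prop :=
  ∀ ρ : En n ≃ₗᵢ[ℝ] En n, IsRotation ρ → ρ (pole n) = pole n → rotate ρ L = L

/-- The quadratic form of the Hessian of `F` at `u` in direction `w`. -/
def hessQ (F : En n → ℝ) (u w : En n) : ℝ := iteratedFDeriv ℝ 2 F u ![w, w]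

/-- `(j,l)` entry of the Hessian of `F` at `u`. -/
def hessE (F : En n → ℝ) (u : En n) (j l : Fin n) : ℝ :=
  iteratedFDeriv ℝ 2 F u ![EuclideanSpace.single j 1, EuclideanSpace.single l 1]

/-- A convex body is of class `C^k₊` if its support function is of class `C^k`
away from the origin and the restriction of its Hessian to `u^⊥` is positive
definite for every unit vector `u`. -/
def IsCkPlus (k : ℕ∞) (L : ConvexBody (En n)) : Prop :=
  ContDiffOn ℝ k (supp L) {0}ᶜ ∧
    ∀ u : En n, ‖u‖ = 1 → ∀ w : En n, w ≠ 0 → ⟪u, w⟫_ℝ = 0 → 0 < hessQ (supp L) u w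

/-- `Φ` is a `C^∞₊` regular Minkowski valuation of degree `i`: it is generated by
the support function of a body of revolution of class `C^∞₊`. -/
def CInfRegular (i : ℕ) (Φ : ConvexBody (En n) → ConvexBody (En n)) : Prop :=
  ∃ (L : ConvexBody (En n)) (g : ℝ → ℝ), IsZonalBody L ∧ IsCkPlus ⊤ L ∧
    (∀ u : En n, ‖u‖ = 1 → supp L u = g ⟪u, pole n⟫_ℝ) ∧ GeneratedBy i Φ g

/-- The `C²(𝕊^{n-1})` distance of two functions. -/
def C2dist (F G : En n → ℝ) : ℝ :=
  ⨆ u : Sph n, (|F (u : En n) - G (u : En n)| +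
    ‖fderiv ℝ F (u : En n) - fderiv ℝ G (u : En n)‖ +
    ‖iteratedFDeriv ℝ 2 F (u : En n) - iteratedFDeriv ℝ 2 G (u : En n)‖)

/-- The Legendre polynomial of dimension `d` and degree `k` (Rodrigues formula). -/
def legendreP (d k : ℕ) (t : ℝ) : ℝ :=
  (-1 : ℝ) ^ k *
    (Real.Gamma (((d : ℝ) - 1) / 2) / (2 ^ k * Real.Gamma (((d : ℝ) - 1) / 2 + k))) *
    (1 - t ^ 2) ^ (-(((d : ℝ) - 3) / 2)) *
    iteratedDeriv k (fun s : ℝ => (1 - s ^ 2) ^ ((((d : ℝ) - 3) / 2) + (k : ℝ))) t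

/-- The multiplier `a_k^d[h]` of a zonal function with profile `h : [-1,1] → ℝ`. -/
def multInt (d k : ℕ) (h : ℝ → ℝ) : ℝ :=
  omegaS (d - 1) *
    ∫ t in (-1 : ℝ)..1, legendreP d k t * h t * (1 - t ^ 2) ^ (((d : ℝ) - 3) / 2)

/-- The multiplier `a_k^n[f] = ∫_{𝕊^{n-1}} f(u) P_k^n(ē·u) du` of a zonal function
`f` on the sphere. -/
def multSph (k : ℕ) (f : En n → ℝ) : ℝ :=
  ∫ u : Sph n, f (u : En n) * legendreP n k ⟪pole n, (u : En n)⟫_ℝ ∂(sphVol n)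

/-- The projection `π₀ f` of `f` onto the constants (its mean value). -/
def proj0 (f : En n → ℝ) : ℝ :=
  (omegaS n)⁻¹ * ∫ u : Sph n, f (u : En n) ∂(sphVol n)

/-- The `L²(𝕊^{n-1})` norm. -/
def sphL2 (f : En n → ℝ) : ℝ :=
  Real.sqrt (∫ u : Sph n, (f (u : En n)) ^ 2 ∂(sphVol n))

/-- The sup norm on the sphere. -/
def supSph (f : En n → ℝ) : ℝ := ⨆ u : Sph n, |f (u : En n)|

/-- `M ∈ UBounds α f` iff `M` witnesses `‖f‖_{𝒰_α} ≤ M`: `‖f‖_∞ ≤ M` and for every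
`k ≥ 1` there is a polynomial of degree at most `k` with `‖f - p_k‖_{L²} ≤ M k^{-α}`. -/
def UBounds (α : ℝ) (f : En n → ℝ) : Set ℝ :=
  {M | (∀ u : En n, ‖u‖ = 1 → |f u| ≤ M) ∧
    ∀ k : ℕ, 0 < k → ∃ p : MvPolynomial (Fin n) ℝ, p.totalDegree ≤ k ∧
      sphL2 (fun x => f x - MvPolynomial.eval (fun j => x j) p) ≤ M * (k : ℝ) ^ (-α)}

/-- `f ∈ 𝒰_α`. -/
def MemU (α : ℝ) (f : En n → ℝ) : Prop := (UBounds α f).Nonempty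

/-- The norm `‖f‖_{𝒰_α}`. -/
def UNorm (α : ℝ) (f : En n → ℝ) : ℝ := sInf (UBounds α f)

/-- The convolution transform `T_g f` with zonal kernel of profile `g`, extended
1-homogeneously to `ℝⁿ`: `(T_g f)(u) = ∫_{𝕊^{n-1}} g(u·v) f(v) dv` for unit `u`. -/
def Tg (g : ℝ → ℝ) (f : En n → ℝ) (x : En n) : ℝ :=
  ‖x‖ * ∫ v : Sph n, g ⟪‖x‖⁻¹ • x, (v : En n)⟫_ℝ * f (v : En n) ∂(sphVol n)

/-- The 0-homogeneous extension of a function on the sphere. -/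
def zeroExt (f : En n → ℝ) (x : En n) : ℝ := f (‖x‖⁻¹ • x)

/-- The spherical Laplacian `Δ_𝕊 f`, i.e. the Euclidean Laplacian of the
0-homogeneous extension. -/
def sphLap (f : En n → ℝ) (u : En n) : ℝ := ∑ j : Fin n, hessE (zeroExt f) u j j

/-- The operator `□_n f = f + Δ_𝕊 f /(n-1)`. -/
def boxN (f : En n → ℝ) (u : En n) : ℝ := f u + ((n : ℝ) - 1)⁻¹ * sphLap f u

/-- The mixed discriminant of `m` symmetric `m × m` matrices, via polarization of
the determinant. -/
def mixedDisc {m : ℕ} (A : Fin m → Matrix (Fin m) (Fin m) ℝ) : ℝ :=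
  ((m.factorial : ℝ))⁻¹ *
    ∑ S : Finset (Fin m), (-1 : ℝ) ^ (m - S.card) * (∑ k ∈ S, A k).det

/-- The rank one matrix `u ⊗ u`. -/
def outer (u : En n) : Matrix (Fin n) (Fin n) ℝ := Matrix.of fun j l => u j * u l

/-- The matrix of the orthogonal projection onto `u^⊥`. -/
def projMat (u : En n) : Matrix (Fin n) (Fin n) ℝ := 1 - outer u

/-- The Hessian matrix of `F` at `u`. -/
def hessMat (F : En n → ℝ) (u : En n) : Matrix (Fin n) (Fin n) ℝ :=
  Matrix.of fun j l => hessE F u j l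

/-- The mixed discriminant `D_{n-1}(B₁|_{u^⊥},…,B_{n-1}|_{u^⊥})` of the restrictions
to `u^⊥` of matrices annihilating `u`, computed via the identity
`D_{n-1}(B₁|_{u^⊥},…) = n · D_n(u ⊗ u, B₁,…,B_{n-1})`. -/
def restrDisc (u : En n) (B : Fin (n - 1) → Matrix (Fin n) (Fin n) ℝ) : ℝ :=
  n * mixedDisc (fun k : Fin n =>
    if h : (k : ℕ) = 0 then outer u else B ⟨(k : ℕ) - 1, by have := k.isLt; omega⟩)

/-- Total variation distance between two Borel measures on the sphere. -/
def dTV (μ ν : Measure (Sph n)) : ℝ :=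
  ⨆ A : {A : Set (Sph n) // MeasurableSet A}, |(μ A).toReal - (ν A).toReal|

/-- Lévy–Prokhorov distance between two Borel measures on the sphere. -/
def dLP (μ ν : Measure (Sph n)) : ℝ :=
  sInf {ε : ℝ | 0 < ε ∧ ∀ A : Set (Sph n), MeasurableSet A →
    μ A ≤ ν (Metric.thickening ε A) + ENNReal.ofReal ε ∧
    ν A ≤ μ (Metric.thickening ε A) + ENNReal.ofReal ε}

/-- Two convex bodies are homothetic: one is a translate of a positive dilate of
the other. -/
def Homothetic (K L : ConvexBody (En n)) : Prop :=
  ∃ (c : ℝ) (x : En n), 0 < c ∧ (L : Set (En n)) = x +ᵥ c • (K : Set (En n))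

/-- The dimension of a convex body (dimension of its affine hull). -/
def bodyDim (K : ConvexBody (En n)) : ℕ :=
  Module.finrank ℝ (vectorSpan ℝ (K : Set (En n)))

/-- `K` is a Euclidean ball. -/
def IsBall (K : ConvexBody (En n)) : Prop :=
  ∃ (c : En n) (r : ℝ), 0 < r ∧ (K : Set (En n)) = closedBall c r

/-- The mean width `w(K) = (2/ω_n) ∫_{𝕊^{n-1}} h_K`. -/
def meanWidth (K : ConvexBody (En n)) : ℝ :=
  2 / omegaS n * ∫ u : Sph n, supp K (u : En n) ∂(sphVol n)

/-- `N(n,k)`, the dimension of the space of spherical harmonics of dimension `n`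
and degree `k`. -/
def Nnk (n k : ℕ) : ℝ :=
  (((n : ℝ) + 2 * k - 2) / ((n : ℝ) + k - 2)) * (Nat.choose (n + k - 2) (n - 2) : ℝ)

/-! ### Second derivatives -/

section SecondOrder

variable {E : Type*} [NormedAddCommGroup E] [NormedSpace ℝ E]

/-- The second derivative of a real function as a bilinear map. -/
def D2 (F : E → ℝ) (x : E) : E →L[ℝ] E →L[ℝ] ℝ := fderiv ℝ (fderiv ℝ F) x

theorem D2_of_hasFDerivAt {F : E → ℝ} {F' : E → E →L[ℝ] ℝ} {F'' : E →L[ℝ] E →L[ℝ] ℝ} {x : E}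
    (h : ∀ᶠ y in 𝓝 x, HasFDerivAt F (F' y) y) (h' : HasFDerivAt F' F'' x) : D2 F x = F'' := by
  have : fderiv ℝ F =ᶠ[𝓝 x] F' := h.mono fun y hy => hy.fderiv
  rw [D2, this.fderiv_eq, h'.fderiv]

theorem _root_.ContDiffAt.eventually_hasFDerivAt {F : E → ℝ} {x : E} (h : ContDiffAt ℝ 2 F x) :
    ∀ᶠ y in 𝓝 x, HasFDerivAt F (fderiv ℝ F y) y := by
  have := h.eventually (by simp)
  exact this.mono fun y hy => (hy.differentiableAt (by simp)).hasFDerivAt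

theorem _root_.ContDiffAt.hasFDerivAt_fderiv {F : E → ℝ} {x : E} (h : ContDiffAt ℝ 2 F x) :
    HasFDerivAt (fderiv ℝ F) (D2 F x) x := by
  have : ContDiffAt ℝ 1 (fderiv ℝ F) x := h.fderiv_right (by norm_num)
  exact (this.differentiableAt (by simp)).hasFDerivAt

theorem D2_add {F G : E → ℝ} {x : E} (hF : ContDiffAt ℝ 2 F x) (hG : ContDiffAt ℝ 2 G x) :
    D2 (fun y => F y + G y) x = D2 F x + D2 G x := by
  refine D2_of_hasFDerivAt (F' := fun y => fderiv ℝ F y + fderiv ℝ G y) ?_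
    (hF.hasFDerivAt_fderiv.add hG.hasFDerivAt_fderiv)
  filter_upwards [hF.eventually_hasFDerivAt, hG.eventually_hasFDerivAt] with y h1 h2
  exact h1.add h2

theorem D2_const_mul {F : E → ℝ} {x : E} (c : ℝ) (hF : ContDiffAt ℝ 2 F x) :
    D2 (fun y => c * F y) x = c • D2 F x := by
  refine D2_of_hasFDerivAt (F' := fun y => c • fderiv ℝ F y) ?_
    (hF.hasFDerivAt_fderiv.const_smul c)
  filter_upwards [hF.eventually_hasFDerivAt] with y h1
  exact h1.const_mul c

theorem D2_sub {F G : E → ℝ} {x : E} (hF : ContDiffAt ℝ 2 F x) (hG : ContDiffAt ℝ 2 G x) :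
    D2 (fun y => F y - G y) x = D2 F x - D2 G x := by
  refine D2_of_hasFDerivAt (F' := fun y => fderiv ℝ F y - fderiv ℝ G y) ?_
    (hF.hasFDerivAt_fderiv.sub hG.hasFDerivAt_fderiv)
  filter_upwards [hF.eventually_hasFDerivAt, hG.eventually_hasFDerivAt] with y h1 h2
  exact h1.sub h2

theorem D2_clm (l : E →L[ℝ] ℝ) (x : E) : D2 l x = 0 := by
  refine D2_of_hasFDerivAt (F' := fun _ => l) (Eventually.of_forall fun y => l.hasFDerivAt)
    (hasFDerivAt_const _ _)

theorem D2_symm {F : E → ℝ} {x : E} (hF : ContDiffAt ℝ 2 F x) (v w : E) :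
    D2 F x v w = D2 F x w v :=
  hF.isSymmSndFDerivAt (by simp) v w

theorem D2_apply_eq_iteratedFDeriv (F : E → ℝ) (x v w : E) :
    D2 F x v w = iteratedFDeriv ℝ 2 F x ![v, w] := by
  simp [D2, iteratedFDeriv_two_apply]

/-- Second derivative along a curve at a critical point. -/
theorem deriv_deriv_line {F : E → ℝ} {x : E} (hF : ContDiffAt ℝ 2 F x) (w : E) :
    (∀ᶠ t : ℝ in 𝓝 0, HasDerivAt (fun t : ℝ => F (x + t • w)) (fderiv ℝ F (x + t • w) w) t) ∧
    HasDerivAt (fun t : ℝ => fderiv ℝ F (x + t • w) w) (D2 F x w w) 0 := by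
  have hl : ∀ t : ℝ, HasDerivAt (fun t : ℝ => x + t • w) w t := fun t => by
    simpa using ((hasDerivAt_id t).smul_const w).const_add x
  have hc : Tendsto (fun t : ℝ => x + t • w) (𝓝 0) (𝓝 x) := by
    have := (hl 0).continuousAt.tendsto
    simpa using this
  constructor
  · filter_upwards [hc.eventually hF.eventually_hasFDerivAt] with t ht
    exact ht.comp_hasDerivAt t (hl t)
  · have h0 : HasFDerivAt (fderiv ℝ F) (D2 F x) (x + (0 : ℝ) • w) := by
      simpa using hF.hasFDerivAt_fderiv
    have := h0.comp_hasDerivAt (0 : ℝ) (hl 0)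
    exact ((ContinuousLinearMap.apply ℝ ℝ w).hasFDerivAt).comp_hasDerivAt (0 : ℝ) this

theorem D2_nonneg_of_isLocalMin {F : E → ℝ} {x : E} (hF : ContDiffAt ℝ 2 F x)
    (hmin : IsLocalMin F x) (w : E) : 0 ≤ D2 F x w w := by
  by_contra! hneg
  obtain ⟨h1, h2⟩ := deriv_deriv_line hF w
  set f : ℝ → ℝ := fun t => F (x + t • w)
  have hc : Tendsto (fun t : ℝ => x + t • w) (𝓝 0) (𝓝 x) := by
    have : Continuous (fun t : ℝ => x + t • w) := by fun_prop
    simpa using this.tendsto 0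
  have hfmin : IsLocalMin f 0 := by
    have : ∀ᶠ t in 𝓝 (0 : ℝ), F x ≤ F (x + t • w) := hc.eventually hmin
    simpa [IsLocalMin, IsMinFilter, f] using this
  have hd : deriv f =ᶠ[𝓝 0] fun t => fderiv ℝ F (x + t • w) w := h1.mono fun t ht => ht.deriv
  have hdd : deriv (deriv f) 0 = D2 F x w w := by rw [hd.deriv_eq, h2.deriv]
  have hmax : IsLocalMax f 0 := by
    refine isLocalMax_of_deriv_deriv_neg (by rw [hdd]; exact hneg) hfmin.deriv_eq_zero ?_
    exact h1.self_of_nhds.continuousAt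
  have hconst : f =ᶠ[𝓝 0] fun _ => f 0 := by
    filter_upwards [hfmin, hmax] with t h3 h4
    exact le_antisymm h4 h3
  have : deriv f =ᶠ[𝓝 0] fun _ => 0 := by
    have := hconst.deriv
    simpa using this
  rw [this.deriv_eq] at hdd
  simp at hdd
  linarith

theorem D2_nonneg_of_touch {F G : E → ℝ} {x : E} (hF : ContDiffAt ℝ 2 F x)
    (hG : ContDiffAt ℝ 2 G x) (h : ∀ᶠ y in 𝓝 x, G y ≤ F y) (he : F x = G x) (w : E) :
    D2 G x w w ≤ D2 F x w w := by
  have := D2_nonneg_of_isLocalMin (hF.sub hG) (x := x) ?_ w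
  · have h2 := D2_sub hF hG
    change 0 ≤ D2 (fun y => F y - G y) x w w at this
    rw [h2] at this
    simpa using this
  · filter_upwards [h] with y hy
    simp [he, hy]

theorem D2_nonneg_of_le_clm {F : E → ℝ} {x : E} (hF : ContDiffAt ℝ 2 F x) (l : E →L[ℝ] ℝ)
    (h : ∀ᶠ y in 𝓝 x, l y ≤ F y) (he : F x = l x) (w : E) : 0 ≤ D2 F x w w := by
  have := D2_nonneg_of_touch hF (l.contDiff.contDiffAt) h he w
  simpa [D2_clm] using this

end SecondOrder

/-! ### Positively homogeneous functions of class `C²` -/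

section Homogeneous

variable {E : Type*} [NormedAddCommGroup E] [InnerProductSpace ℝ E]

/-- `F` is positively homogeneous of degree one and of class `C²` off the origin. -/
structure IsC2H (F : E → ℝ) : Prop where
  contDiffOn : ContDiffOn ℝ 2 F {0}ᶜ
  map_smul : ∀ c : ℝ, 0 ≤ c → ∀ x, F (c • x) = c * F x

namespace IsC2H

variable {F G : E → ℝ}

theorem contDiffAt (hF : IsC2H F) {x : E} (hx : x ≠ 0) : ContDiffAt ℝ 2 F x :=
  hF.contDiffOn.contDiffAt (isOpen_compl_singleton.mem_nhds hx)

theorem map_zero (hF : IsC2H F) : F 0 = 0 := by simpa using hF.map_smul 0 le_rfl 0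

theorem add (hF : IsC2H F) (hG : IsC2H G) : IsC2H (fun x => F x + G x) :=
  ⟨hF.contDiffOn.add hG.contDiffOn, fun c hc x => by rw [hF.map_smul c hc, hG.map_smul c hc]; ring⟩

theorem sub (hF : IsC2H F) (hG : IsC2H G) : IsC2H (fun x => F x - G x) :=
  ⟨hF.contDiffOn.sub hG.contDiffOn, fun c hc x => by rw [hF.map_smul c hc, hG.map_smul c hc]; ring⟩

theorem const_mul (hF : IsC2H F) (a : ℝ) : IsC2H (fun x => a * F x) :=
  ⟨contDiffOn_const.mul hF.contDiffOn, fun c hc x => by rw [hF.map_smul c hc]; ring⟩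

theorem clm (l : E →L[ℝ] ℝ) : IsC2H (fun x => l x) :=
  ⟨l.contDiff.contDiffOn, fun c _ x => by simp⟩

theorem norm : IsC2H (fun x : E => ‖x‖) :=
  ⟨contDiffOn_id.norm ℝ fun x hx => hx, fun c hc x => by rw [norm_smul, Real.norm_of_nonneg hc]⟩

theorem hasFDerivAt (hF : IsC2H F) {x : E} (hx : x ≠ 0) : HasFDerivAt F (fderiv ℝ F x) x :=
  (hF.contDiffAt hx).eventually_hasFDerivAt.self_of_nhds

theorem hasFDerivAt_fderiv (hF : IsC2H F) {x : E} (hx : x ≠ 0) :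
    HasFDerivAt (fderiv ℝ F) (D2 F x) x :=
  (hF.contDiffAt hx).hasFDerivAt_fderiv

theorem continuousOn (hF : IsC2H F) : ContinuousOn F {0}ᶜ := hF.contDiffOn.continuousOn

theorem fderiv_smul (hF : IsC2H F) {c : ℝ} (hc : 0 < c) (x : E) :
    fderiv ℝ F (c • x) = fderiv ℝ F x := by
  have h1 : F = c • fun y => F (c⁻¹ • y) := by
    ext y
    rw [Pi.smul_apply, smul_eq_mul, ← hF.map_smul c hc.le, smul_inv_smul₀ hc.ne']
  conv_lhs => rw [h1]
  rw [fderiv_const_smul_field, Pi.smul_apply, fderiv_comp_smul, smul_smul, mul_inv_cancel₀ hc.ne', one_smul,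
    inv_smul_smul₀ hc.ne']

theorem D2_smul (hF : IsC2H F) {c : ℝ} (hc : 0 < c) (x : E) :
    D2 F (c • x) = c⁻¹ • D2 F x := by
  have h1 : fderiv ℝ F = fun y => fderiv ℝ F (c⁻¹ • y) := by
    ext1 y
    rw [hF.fderiv_smul (inv_pos.2 hc)]
  unfold D2
  conv_lhs => rw [h1]
  rw [fderiv_comp_smul, inv_smul_smul₀ hc.ne']

theorem fderiv_self (hF : IsC2H F) {x : E} (hx : x ≠ 0) : fderiv ℝ F x x = F x := by
  have h1 : HasDerivAt (fun t : ℝ => t • x) x 1 := by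
    simpa using (hasDerivAt_id (1 : ℝ)).smul_const x
  have h2 : HasFDerivAt F (fderiv ℝ F x) ((1 : ℝ) • x) := by simpa using hF.hasFDerivAt hx
  have h3 := h2.comp_hasDerivAt (1 : ℝ) h1
  have h4 : HasDerivAt (fun t : ℝ => t * F x) (F x) 1 := by
    simpa using (hasDerivAt_id (1 : ℝ)).mul_const (F x)
  refine h3.unique (h4.congr_of_eventuallyEq ?_)
  filter_upwards [lt_mem_nhds (zero_lt_one' ℝ)] with t ht
  exact hF.map_smul t ht.le x

theorem D2_self (hF : IsC2H F) {x : E} (hx : x ≠ 0) : D2 F x x = 0 := by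
  have h1 : HasDerivAt (fun t : ℝ => t • x) x 1 := by
    simpa using (hasDerivAt_id (1 : ℝ)).smul_const x
  have h2 : HasFDerivAt (fderiv ℝ F) (D2 F x) ((1 : ℝ) • x) := by
    simpa using hF.hasFDerivAt_fderiv hx
  have h3 := h2.comp_hasDerivAt (1 : ℝ) h1
  refine h3.unique ((hasDerivAt_const (1 : ℝ) (fderiv ℝ F x)).congr_of_eventuallyEq ?_)
  filter_upwards [lt_mem_nhds (zero_lt_one' ℝ)] with t ht
  exact hF.fderiv_smul ht x

theorem D2_symm (hF : IsC2H F) {x : E} (hx : x ≠ 0) (v w : E) : D2 F x v w = D2 F x w v :=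
  MinkIter.D2_symm (hF.contDiffAt hx) v w

theorem D2_self_left (hF : IsC2H F) {x : E} (hx : x ≠ 0) (w : E) : D2 F x x w = 0 := by
  rw [hF.D2_self hx]; rfl

theorem D2_self_right (hF : IsC2H F) {x : E} (hx : x ≠ 0) (w : E) : D2 F x w x = 0 := by
  rw [hF.D2_symm hx, hF.D2_self_left hx]

theorem continuousAt_fderiv (hF : IsC2H F) {x : E} (hx : x ≠ 0) : ContinuousAt (fderiv ℝ F) x :=
  (hF.hasFDerivAt_fderiv hx).continuousAt

theorem continuousAt_D2 (hF : IsC2H F) {x : E} (hx : x ≠ 0) : ContinuousAt (D2 F) x := by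
  have h1 : ContDiffAt ℝ 1 (fderiv ℝ F) x := (hF.contDiffAt hx).fderiv_right (by norm_num)
  have h2 : ContDiffAt ℝ 0 (fderiv ℝ (fderiv ℝ F)) x := h1.fderiv_right (by norm_num)
  exact h2.continuousAt

theorem continuousOn_fderiv (hF : IsC2H F) : ContinuousOn (fderiv ℝ F) {0}ᶜ :=
  fun _ hx => (hF.continuousAt_fderiv hx).continuousWithinAt

theorem continuousOn_D2 (hF : IsC2H F) : ContinuousOn (D2 F) {0}ᶜ :=
  fun _ hx => (hF.continuousAt_D2 hx).continuousWithinAt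

theorem D2_add (hF : IsC2H F) (hG : IsC2H G) {x : E} (hx : x ≠ 0) :
    D2 (fun y => F y + G y) x = D2 F x + D2 G x :=
  MinkIter.D2_add (hF.contDiffAt hx) (hG.contDiffAt hx)

theorem D2_sub (hF : IsC2H F) (hG : IsC2H G) {x : E} (hx : x ≠ 0) :
    D2 (fun y => F y - G y) x = D2 F x - D2 G x :=
  MinkIter.D2_sub (hF.contDiffAt hx) (hG.contDiffAt hx)

theorem D2_const_mul (hF : IsC2H F) (a : ℝ) {x : E} (hx : x ≠ 0) :
    D2 (fun y => a * F y) x = a • D2 F x :=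
  MinkIter.D2_const_mul a (hF.contDiffAt hx)

end IsC2H

theorem hasFDerivAt_norm_of_ne_zero {x : E} (hx : x ≠ 0) :
    HasFDerivAt (fun y : E => ‖y‖) (‖x‖⁻¹ • innerSL ℝ x) x := by
  have h := ((hasStrictFDerivAt_norm_sq x).hasFDerivAt).sqrt (by simpa using hx)
  have h2 : (fun y : E => √(‖y‖ ^ 2)) = fun y => ‖y‖ := by
    ext y; exact Real.sqrt_sq (norm_nonneg y)
  rw [h2] at h
  convert h using 1
  rw [Real.sqrt_sq (norm_nonneg x)]
  ext w
  simp
  ring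

theorem D2_norm {x : E} (hx : x ≠ 0) (v w : E) :
    D2 (fun y : E => ‖y‖) x v w = ‖x‖⁻¹ * (⟪v, w⟫_ℝ - ‖x‖⁻¹ ^ 2 * ⟪x, v⟫_ℝ * ⟪x, w⟫_ℝ) := by
  have hx' : ‖x‖ ≠ 0 := norm_ne_zero_iff.2 hx
  have h1 : HasFDerivAt (fun y : E => ‖y‖⁻¹) (-(‖x‖ ^ 2)⁻¹ • (‖x‖⁻¹ • innerSL ℝ x)) x :=
    (hasDerivAt_inv hx').comp_hasFDerivAt x (hasFDerivAt_norm_of_ne_zero hx)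
  have h2 : HasFDerivAt (fun y : E => innerSL ℝ y) (innerSL ℝ : E →L[ℝ] E →L[ℝ] ℝ) x :=
    (innerSL ℝ : E →L[ℝ] E →L[ℝ] ℝ).hasFDerivAt
  have h3 := h1.smul h2
  rw [D2_of_hasFDerivAt (F' := fun y => ‖y‖⁻¹ • innerSL ℝ y) _ h3]
  · simp
    field_simp
    rfl
  · filter_upwards [isOpen_compl_singleton.mem_nhds hx] with y hy
    exact hasFDerivAt_norm_of_ne_zero hy

theorem D2_norm_unit {u : E} (hu : ‖u‖ = 1) (v w : E) :
    D2 (fun y : E => ‖y‖) u v w = ⟪v, w⟫_ℝ - ⟪u, v⟫_ℝ * ⟪u, w⟫_ℝ := by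
  rw [D2_norm (by rintro rfl; simp at hu)]
  simp [hu]

end Homogeneous

/-! ### Gradient, Hessian operator and Laplacian -/

section Operators

/-- The vector representing a linear functional. -/
def vecOf : (En n →L[ℝ] ℝ) →L[ℝ] En n :=
  ∑ j : Fin n, (ContinuousLinearMap.apply ℝ ℝ (EuclideanSpace.single j (1 : ℝ) : En n)).smulRight
    (EuclideanSpace.single j (1 : ℝ))

theorem inner_vecOf (l : En n →L[ℝ] ℝ) (w : En n) : ⟪vecOf l, w⟫_ℝ = l w := by
  have hw : w = ∑ j : Fin n, w j • (EuclideanSpace.single j (1 : ℝ) : En n) := by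
    have := (EuclideanSpace.basisFun (Fin n) ℝ).sum_repr w
    simpa using this.symm
  conv_rhs => rw [hw]
  simp only [vecOf, sum_apply, ContinuousLinearMap.smulRight_apply, sum_inner,
    map_sum, map_smul, real_inner_smul_left, ContinuousLinearMap.apply_apply, smul_eq_mul]
  refine Finset.sum_congr rfl fun j _ => ?_
  rw [EuclideanSpace.inner_single_left]
  simp [mul_comm]

theorem norm_vecOf (l : En n →L[ℝ] ℝ) : ‖vecOf l‖ = ‖l‖ := by
  have : l = innerSL ℝ (vecOf l) := by
    ext w
    exact (inner_vecOf l w).symm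
  conv_rhs => rw [this]
  rw [innerSL_apply_norm]

/-- The gradient. -/
def grd (F : En n → ℝ) (x : En n) : En n := vecOf (fderiv ℝ F x)

/-- The Hessian as an operator. -/
def hessOp (F : En n → ℝ) (x : En n) : En n →L[ℝ] En n := vecOf.comp (D2 F x)

/-- The Laplacian. -/
def lap (F : En n → ℝ) (x : En n) : ℝ :=
  ∑ j : Fin n, D2 F x (EuclideanSpace.single j 1) (EuclideanSpace.single j 1)

theorem inner_grd (F : En n → ℝ) (x w : En n) : ⟪grd F x, w⟫_ℝ = fderiv ℝ F x w :=
  inner_vecOf _ _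

theorem inner_hessOp (F : En n → ℝ) (x v w : En n) : ⟪hessOp F x v, w⟫_ℝ = D2 F x v w :=
  inner_vecOf _ _

theorem norm_hessOp_le (F : En n → ℝ) (x : En n) : ‖hessOp F x‖ ≤ ‖D2 F x‖ := by
  refine ContinuousLinearMap.opNorm_le_bound _ (by positivity) fun v => ?_
  rw [hessOp, ContinuousLinearMap.comp_apply, norm_vecOf]
  exact (D2 F x).le_opNorm v

theorem trace_hessOp (F : En n → ℝ) (x : En n) :
    LinearMap.trace ℝ (En n) (hessOp F x : En n →ₗ[ℝ] En n) = lap F x := by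
  rw [LinearMap.trace_eq_sum_inner _ (EuclideanSpace.basisFun (Fin n) ℝ), lap]
  refine Finset.sum_congr rfl fun j _ => ?_
  rw [real_inner_comm]
  simpa using inner_hessOp F x _ _

theorem lap_eq_sum {ι : Type*} [Fintype ι] (b : OrthonormalBasis ι ℝ (En n)) (F : En n → ℝ)
    (x : En n) : lap F x = ∑ j, D2 F x (b j) (b j) := by
  rw [← trace_hessOp, LinearMap.trace_eq_sum_inner _ b]
  refine Finset.sum_congr rfl fun j _ => ?_
  rw [real_inner_comm]
  simpa using inner_hessOp F x _ _

variable {F G : En n → ℝ}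

namespace IsC2H

theorem hasFDerivAt_grd (hF : IsC2H F) {x : En n} (hx : x ≠ 0) :
    HasFDerivAt (grd F) (hessOp F x) x :=
  vecOf.hasFDerivAt.comp x (hF.hasFDerivAt_fderiv hx)

theorem grd_smul (hF : IsC2H F) {c : ℝ} (hc : 0 < c) (x : En n) : grd F (c • x) = grd F x := by
  rw [grd, hF.fderiv_smul hc, grd]

theorem hessOp_smul (hF : IsC2H F) {c : ℝ} (hc : 0 < c) (x : En n) :
    hessOp F (c • x) = c⁻¹ • hessOp F x := by
  rw [hessOp, hF.D2_smul hc, ContinuousLinearMap.comp_smul, hessOp]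

theorem hessOp_self (hF : IsC2H F) {x : En n} (hx : x ≠ 0) : hessOp F x x = 0 := by
  rw [hessOp, ContinuousLinearMap.comp_apply, hF.D2_self hx, ContinuousLinearMap.map_zero]

theorem inner_grd_self (hF : IsC2H F) {x : En n} (hx : x ≠ 0) : ⟪grd F x, x⟫_ℝ = F x := by
  rw [inner_grd, hF.fderiv_self hx]

theorem inner_hessOp_self (hF : IsC2H F) {x : En n} (hx : x ≠ 0) (v : En n) :
    ⟪hessOp F x v, x⟫_ℝ = 0 := by
  rw [inner_hessOp, hF.D2_self_right hx]

theorem continuousOn_hessOp (hF : IsC2H F) : ContinuousOn (hessOp F) {0}ᶜ :=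
  (continuous_const.clm_comp continuous_id : Continuous fun L => (vecOf (n := n)).comp L)
    |>.comp_continuousOn hF.continuousOn_D2

theorem hessOp_add (hF : IsC2H F) (hG : IsC2H G) {x : En n} (hx : x ≠ 0) :
    hessOp (fun y => F y + G y) x = hessOp F x + hessOp G x := by
  rw [hessOp, hF.D2_add hG hx, ContinuousLinearMap.comp_add]; rfl

theorem hessOp_sub (hF : IsC2H F) (hG : IsC2H G) {x : En n} (hx : x ≠ 0) :
    hessOp (fun y => F y - G y) x = hessOp F x - hessOp G x := by
  rw [hessOp, hF.D2_sub hG hx, ContinuousLinearMap.comp_sub]; rfl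

theorem lap_sub (hF : IsC2H F) (hG : IsC2H G) {x : En n} (hx : x ≠ 0) :
    lap (fun y => F y - G y) x = lap F x - lap G x := by
  simp [lap, hF.D2_sub hG hx, Finset.sum_sub_distrib]

theorem lap_const_mul (hF : IsC2H F) (a : ℝ) {x : En n} (hx : x ≠ 0) :
    lap (fun y => a * F y) x = a * lap F x := by
  simp [lap, hF.D2_const_mul a hx, Finset.mul_sum]

theorem continuousOn_lap (hF : IsC2H F) : ContinuousOn (lap F) {0}ᶜ :=
  continuousOn_finsetSum _ fun _ _ =>
    (hF.continuousOn_D2.clm_apply continuousOn_const).clm_apply continuousOn_const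

theorem lap_smul (hF : IsC2H F) {c : ℝ} (hc : 0 < c) (x : En n) :
    lap F (c • x) = c⁻¹ * lap F x := by
  simp [lap, hF.D2_smul hc, Finset.mul_sum]

end IsC2H

theorem lap_norm {u : En n} (hu : ‖u‖ = 1) : lap (fun y => ‖y‖) u = (n : ℝ) - 1 := by
  have h : ∑ j : Fin n, u j ^ 2 = 1 := by
    have := EuclideanSpace.norm_sq_eq u
    simpa [hu] using this.symm
  simp only [lap, D2_norm_unit hu, EuclideanSpace.inner_single_right]
  simp [← sq, h]

theorem sphere_ne_zero (u : Sph n) : (u : En n) ≠ 0 := by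
  have := u.2
  intro h
  simp [h] at this

theorem ne_zero_of_norm_eq_one {u : En n} (hu : ‖u‖ = 1) : u ≠ 0 := by
  rintro rfl; simp at hu

theorem norm_sph (u : Sph n) : ‖(u : En n)‖ = 1 := by simp

theorem continuous_restrict_sphere {α : Type*} [TopologicalSpace α] {f : En n → α}
    (hf : ContinuousOn f {0}ᶜ) : Continuous fun u : Sph n => f u :=
  hf.comp_continuous continuous_subtype_val fun u => sphere_ne_zero u

theorem exists_bound_sphere {α : Type*} [NormedAddCommGroup α] {f : En n → α}
    (hf : ContinuousOn f {0}ᶜ) : ∃ C, 0 ≤ C ∧ ∀ u : En n, ‖u‖ = 1 → ‖f u‖ ≤ C := by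
  obtain ⟨C, hC⟩ := (isCompact_sphere (0 : En n) 1).exists_bound_of_continuousOn
    (hf.mono fun x hx => ne_zero_of_norm_eq_one (by simpa using hx))
  exact ⟨max C 0, le_max_right _ _, fun u hu => (hC u (by simpa using hu)).trans (le_max_left _ _)⟩

end Operators

/-! ### Support functions -/

section Support

variable {K L : ConvexBody (En n)}

theorem bddAbove_supp (K : ConvexBody (En n)) (x : En n) :
    BddAbove ((fun y => ⟪x, y⟫_ℝ) '' (K : Set (En n))) :=
  (K.isCompact.image (by fun_prop)).bddAbove

theorem inner_le_supp (K : ConvexBody (En n)) (x : En n) {y : En n} (hy : y ∈ K) :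
    ⟪x, y⟫_ℝ ≤ supp K x :=
  le_csSup (bddAbove_supp K x) ⟨y, hy, rfl⟩

theorem exists_inner_eq_supp (K : ConvexBody (En n)) (x : En n) :
    ∃ y ∈ K, ⟪x, y⟫_ℝ = supp K x :=
  (K.isCompact.image (by fun_prop : Continuous fun y => ⟪x, y⟫_ℝ)).sSup_mem (K.nonempty.image _)

theorem supp_le {x : En n} {c : ℝ} (h : ∀ y ∈ K, ⟪x, y⟫_ℝ ≤ c) : supp K x ≤ c := by
  obtain ⟨y, hy, he⟩ := exists_inner_eq_supp K x
  exact he ▸ h y hy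

theorem supp_eq_of {x y : En n} (hy : y ∈ K) (h : ∀ z ∈ K, ⟪x, z⟫_ℝ ≤ ⟪x, y⟫_ℝ) :
    supp K x = ⟪x, y⟫_ℝ :=
  le_antisymm (supp_le h) (inner_le_supp K x hy)

theorem supp_smul (K : ConvexBody (En n)) {c : ℝ} (hc : 0 ≤ c) (x : En n) :
    supp K (c • x) = c * supp K x := by
  obtain ⟨y, hy, he⟩ := exists_inner_eq_supp K x
  rw [supp_eq_of hy, real_inner_smul_left, he]
  intro z hz
  rw [real_inner_smul_left, real_inner_smul_left, he]
  exact mul_le_mul_of_nonneg_left (inner_le_supp K x hz) hc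

theorem supp_zero_right (K : ConvexBody (En n)) : supp K 0 = 0 := by
  simpa using supp_smul K le_rfl 0

theorem supp_add_le (K : ConvexBody (En n)) (x y : En n) :
    supp K (x + y) ≤ supp K x + supp K y := by
  refine supp_le fun z hz => ?_
  rw [inner_add_left]
  exact add_le_add (inner_le_supp K x hz) (inner_le_supp K y hz)

theorem mem_of_forall_inner_le_supp {y : En n} (h : ∀ x, ⟪x, y⟫_ℝ ≤ supp K x) : y ∈ K := by
  by_contra hy
  obtain ⟨f, u, hu, hfy⟩ := geometric_hahn_banach_closed_point K.convex K.isClosed hy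
  have h1 := h (vecOf f)
  rw [inner_vecOf] at h1
  obtain ⟨z, hz, he⟩ := exists_inner_eq_supp K (vecOf f)
  rw [inner_vecOf] at he
  have := hu z hz
  linarith

theorem subset_of_supp_le (h : ∀ x, supp K x ≤ supp L x) : (K : Set (En n)) ⊆ L :=
  fun _ hy => mem_of_forall_inner_le_supp fun x => (inner_le_supp K x hy).trans (h x)

theorem forall_of_unit_of_smul {F G : En n → ℝ}
    (hF : ∀ c : ℝ, 0 ≤ c → ∀ x, F (c • x) = c * F x)
    (hG : ∀ c : ℝ, 0 ≤ c → ∀ x, G (c • x) = c * G x)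
    (h : ∀ u, ‖u‖ = 1 → F u ≤ G u) (x : En n) : F x ≤ G x := by
  rcases eq_or_ne x 0 with rfl | hx
  · have h1 := hF 0 le_rfl 0
    have h2 := hG 0 le_rfl 0
    simp at h1 h2
    rw [h1, h2]
  · have hx' := norm_ne_zero_iff.2 hx
    have e : x = ‖x‖ • ((‖x‖⁻¹ : ℝ) • x) := by rw [smul_inv_smul₀ hx']
    rw [e, hF _ (norm_nonneg x), hG _ (norm_nonneg x)]
    refine mul_le_mul_of_nonneg_left (h _ ?_) (norm_nonneg x)
    rw [norm_smul, norm_inv, norm_norm, inv_mul_cancel₀ hx']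

theorem body_ext (h : ∀ u, ‖u‖ = 1 → supp K u = supp L u) : K = L := by
  have h1 := forall_of_unit_of_smul (fun c hc x => supp_smul K hc x)
    (fun c hc x => supp_smul L hc x) fun u hu => (h u hu).le
  have h2 := forall_of_unit_of_smul (fun c hc x => supp_smul L hc x)
    (fun c hc x => supp_smul K hc x) fun u hu => (h u hu).ge
  exact SetLike.coe_injective (Set.Subset.antisymm (subset_of_supp_le h1) (subset_of_supp_le h2))

theorem supp_scale {c : ℝ} (hc : 0 ≤ c) (K : ConvexBody (En n)) (x : En n) :
    supp (scale c K) x = c * supp K x := by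
  obtain ⟨y, hy, he⟩ := exists_inner_eq_supp K x
  rw [supp_eq_of (K := scale c K) (y := c • y) ⟨y, hy, rfl⟩, real_inner_smul_right, he]
  rintro _ ⟨z, hz, rfl⟩
  simp only [real_inner_smul_right, he]
  exact mul_le_mul_of_nonneg_left (inner_le_supp K x hz) hc

theorem supp_scale_neg (K : ConvexBody (En n)) (x : En n) :
    supp (scale (-1) K) x = supp K (-x) := by
  obtain ⟨y, hy, he⟩ := exists_inner_eq_supp K (-x)
  rw [supp_eq_of (K := scale (-1) K) (y := (-1 : ℝ) • y) ⟨y, hy, rfl⟩, ← he]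
  · simp
  rintro _ ⟨z, hz, rfl⟩
  have := inner_le_supp K (-x) hz
  rw [← he] at this
  simpa using this

theorem supp_add (K L : ConvexBody (En n)) (x : En n) : supp (K + L) x = supp K x + supp L x := by
  obtain ⟨y, hy, he⟩ := exists_inner_eq_supp K x
  obtain ⟨z, hz, he'⟩ := exists_inner_eq_supp L x
  rw [supp_eq_of (K := K + L) (y := y + z) (Set.add_mem_add hy hz), inner_add_right, he, he']
  rintro _ ⟨a, ha, b, hb, rfl⟩
  rw [inner_add_right, inner_add_right, he, he']
  exact add_le_add (inner_le_supp K x ha) (inner_le_supp L x hb)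

theorem supp_zero (x : En n) : supp (0 : ConvexBody (En n)) x = 0 := by
  have : (0 : En n) ∈ (0 : ConvexBody (En n)) := by
    change (0 : En n) ∈ ((0 : ConvexBody (En n)) : Set (En n))
    simp
  rw [supp_eq_of this]
  · simp
  · intro z hz
    change z ∈ ((0 : ConvexBody (En n)) : Set (En n)) at hz
    simp at hz
    simp [hz]

theorem supp_sum {ι : Type*} (S : Finset ι) (Ks : ι → ConvexBody (En n)) (x : En n) :
    supp (∑ k ∈ S, Ks k) x = ∑ k ∈ S, supp (Ks k) x := by
  classical
  induction S using Finset.induction_on with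
  | empty => simp [supp_zero]
  | insert a S ha ih => rw [Finset.sum_insert ha, Finset.sum_insert ha, supp_add, ih]

theorem supp_ballB (x : En n) : supp (ballB n) x = ‖x‖ := by
  rcases eq_or_ne x 0 with rfl | hx
  · simp [supp_zero_right]
  have hx' := norm_ne_zero_iff.2 hx
  have hm : (‖x‖⁻¹ • x) ∈ ballB n := by
    change (‖x‖⁻¹ • x) ∈ closedBall (0 : En n) 1
    rw [mem_closedBall_zero_iff, norm_smul, norm_inv, norm_norm, inv_mul_cancel₀ hx']
  have e : ⟪x, ‖x‖⁻¹ • x⟫_ℝ = ‖x‖ := by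
    rw [real_inner_smul_right, real_inner_self_eq_norm_sq]
    field_simp
  rw [supp_eq_of hm, e]
  intro z hz
  rw [e]
  have hz' : ‖z‖ ≤ 1 := mem_closedBall_zero_iff.1 hz
  have := real_inner_le_norm x z
  nlinarith [norm_nonneg x]

theorem supp_translate (K : ConvexBody (En n)) (v x : En n) :
    supp (translate K v) x = ⟪x, v⟫_ℝ + supp K x := by
  obtain ⟨y, hy, he⟩ := exists_inner_eq_supp K x
  rw [supp_eq_of (K := translate K v) (y := v + y) ⟨y, hy, rfl⟩, inner_add_right, he]
  rintro _ ⟨z, hz, rfl⟩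
  simp only [inner_add_right, he]
  exact add_le_add le_rfl (inner_le_supp K x hz)

theorem supp_neg_le (K : ConvexBody (En n)) (x : En n) : -supp K (-x) ≤ supp K x := by
  have := supp_add_le K x (-x)
  rw [add_neg_cancel, supp_zero_right] at this
  linarith

theorem continuous_supp (K : ConvexBody (En n)) : Continuous (supp K) := by
  obtain ⟨R, hR0, hR⟩ := K.isCompact.isBounded.exists_pos_norm_le
  have : LipschitzWith (Real.toNNReal R) (supp K) := by
    refine LipschitzWith.of_le_add_mul _ fun x y => ?_
    refine supp_le fun z hz => ?_
    have h1 := inner_le_supp K y hz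
    have h2 := real_inner_le_norm (x - y) z
    rw [inner_sub_left] at h2
    have h3 := hR z hz
    rw [Real.coe_toNNReal _ hR0.le, dist_eq_norm]
    nlinarith [norm_nonneg (x - y)]
  exact this.continuous

theorem isC2H_supp (h : ContDiffOn ℝ 2 (supp K) {0}ᶜ) : IsC2H (supp K) :=
  ⟨h, fun _ hc x => supp_smul K hc x⟩

theorem isC2H_supp_ball : IsC2H (supp (ballB n)) := by
  have : supp (ballB n) = fun x => ‖x‖ := funext supp_ballB
  rw [this]
  exact IsC2H.norm

/-- A differentiable sublinear function dominates its differentials. -/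
theorem IsC2H.fderiv_le {F : En n → ℝ} (hF : IsC2H F) (hs : ∀ x y, F (x + y) ≤ F x + F y)
    {y : En n} (hy : y ≠ 0) (x : En n) : fderiv ℝ F y x ≤ F x := by
  have h1 : HasDerivAt (fun t : ℝ => y + t • x) x 0 := by
    simpa using ((hasDerivAt_id (0 : ℝ)).smul_const x).const_add y
  have h2 : HasFDerivAt F (fderiv ℝ F y) (y + (0 : ℝ) • x) := by simpa using hF.hasFDerivAt hy
  have h3 := h2.comp_hasDerivAt (0 : ℝ) h1
  refine le_of_tendsto (h3.tendsto_slope_zero_right) ?_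
  filter_upwards [self_mem_nhdsWithin] with t ht
  have ht' : (0 : ℝ) < t := ht
  have := hs y (t • x)
  rw [hF.map_smul t ht'.le] at this
  simp only [Function.comp_apply, zero_add, zero_smul, add_zero, smul_eq_mul]
  rw [inv_mul_le_iff₀ ht']
  linarith

theorem IsC2H.D2_nonneg {F : En n → ℝ} (hF : IsC2H F) (hs : ∀ x y, F (x + y) ≤ F x + F y)
    {y : En n} (hy : y ≠ 0) (w : En n) : 0 ≤ D2 F y w w :=
  D2_nonneg_of_le_clm (hF.contDiffAt hy) (fderiv ℝ F y)
    (Eventually.of_forall fun x => hF.fderiv_le hs hy x) (hF.fderiv_self hy).symm w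

theorem grd_supp_mem (hK : IsC2H (supp K)) {x : En n} (hx : x ≠ 0) : grd (supp K) x ∈ K :=
  mem_of_forall_inner_le_supp fun y => by
    rw [real_inner_comm, inner_grd]
    exact hK.fderiv_le (supp_add_le K) hx y

/-- A sublinear function which is `C²` off the origin is a support function. -/
theorem exists_body (hn : 0 < n) {F : En n → ℝ} (hF : IsC2H F)
    (hs : ∀ x y, F (x + y) ≤ F x + F y) : ∃ K : ConvexBody (En n), supp K = F := by
  have : NeZero n := ⟨hn.ne'⟩
  set A : Set (En n) := {z | ∀ x, ⟪x, z⟫_ℝ ≤ F x}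
  have hg : ∀ y, y ≠ 0 → grd F y ∈ A := fun y hy x => by
    rw [real_inner_comm, inner_grd]
    exact hF.fderiv_le hs hy x
  obtain ⟨C, hC0, hC⟩ := exists_bound_sphere hF.continuousOn
  have hb : ∀ z ∈ A, ‖z‖ ≤ C := by
    intro z hz
    have h1 := forall_of_unit_of_smul (G := fun x => C * ‖x‖) hF.map_smul
      (fun c hc x => by rw [norm_smul, Real.norm_of_nonneg hc]; ring)
      (fun u hu => by rw [hu, mul_one]; exact (le_abs_self _).trans (hC u hu)) z
    have h2 := (hz z).trans h1
    rw [real_inner_self_eq_norm_sq] at h2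
    by_contra! h3
    nlinarith [norm_nonneg z]
  have hclosed : IsClosed A := by
    have : A = ⋂ x, {z | ⟪x, z⟫_ℝ ≤ F x} := by ext z; simp [A]
    rw [this]
    exact isClosed_iInter fun x => isClosed_le (by fun_prop) continuous_const
  have hconv : Convex ℝ A := by
    intro z hz w hw a b ha hb hab x
    rw [inner_add_right, real_inner_smul_right, real_inner_smul_right]
    have h1 := mul_le_mul_of_nonneg_left (hz x) ha
    have h2 := mul_le_mul_of_nonneg_left (hw x) hb
    have : F x = a * F x + b * F x := by rw [← add_mul, hab, one_mul]
    linarith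
  have he : (EuclideanSpace.single (0 : Fin n) (1 : ℝ) : En n) ≠ 0 := by
    apply ne_zero_of_norm_eq_one; simp
  refine ⟨⟨A, hconv, isCompact_of_isClosed_isBounded hclosed
    ((isBounded_closedBall (x := (0 : En n)) (r := C)).subset fun z hz => by simpa using hb z hz),
    ⟨_, hg _ he⟩⟩, ?_⟩
  ext x
  rcases eq_or_ne x 0 with rfl | hx
  · rw [supp_zero_right, hF.map_zero]
  refine le_antisymm (supp_le fun z hz => hz x) ?_
  have := inner_le_supp ⟨A, hconv, isCompact_of_isClosed_isBounded hclosed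
    ((isBounded_closedBall (x := (0 : En n)) (r := C)).subset fun z hz => by simpa using hb z hz),
    ⟨_, hg _ he⟩⟩ x (hg x hx)
  rwa [real_inner_comm, hF.inner_grd_self hx] at this

end Support

/-! ### Polarization -/

section Polarization

open Finset

/-- The alternating sum of a multilinear form along the translates of a cube does not depend on
the base point. -/
theorem MultilinearMap.alternating_sum_eq {ι V : Type*} [Fintype ι] [DecidableEq ι]
    [AddCommGroup V] [Module ℝ V] (f : MultilinearMap ℝ (fun _ : ι => V) ℝ)
    (y : ι → ι → V) (c c' : ι → V) :
    ∑ S : Finset ι, (-1 : ℝ) ^ S.card * f (fun i => c i + ∑ k ∈ S, y k i) =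
      ∑ S : Finset ι, (-1 : ℝ) ^ S.card * f (fun i => c' i + ∑ k ∈ S, y k i) := by
  have key : ∀ c : ι → V, ∑ S : Finset ι, (-1 : ℝ) ^ S.card * f (fun i => c i + ∑ k ∈ S, y k i) =
      ∑ r : ι → Option ι, (∑ S : Finset ι, (-1 : ℝ) ^ S.card *
        ∏ i, (if ∀ k ∈ r i, k ∈ S then (1 : ℝ) else 0)) *
        f (fun i => (r i).elim (c i) (fun k => y k i)) := by
    intro c
    have h1 : ∀ S : Finset ι, f (fun i => c i + ∑ k ∈ S, y k i) =
        ∑ r : ι → Option ι, (∏ i, (if ∀ k ∈ r i, k ∈ S then (1 : ℝ) else 0)) *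
          f (fun i => (r i).elim (c i) (fun k => y k i)) := by
      intro S
      have h2 : (fun i => c i + ∑ k ∈ S, y k i) = fun i => ∑ o : Option ι,
          (if ∀ k ∈ o, k ∈ S then (1 : ℝ) else 0) • (o.elim (c i) (fun k => y k i)) := by
        ext1 i
        rw [Fintype.sum_option]
        simp [Finset.sum_ite_mem]
      rw [h2, f.map_sum]
      refine Finset.sum_congr rfl fun r _ => ?_
      rw [f.map_smul_univ, smul_eq_mul]
    simp only [h1, Finset.mul_sum, Finset.sum_mul]
    rw [Finset.sum_comm]
    simp only [mul_assoc]
  rw [key c, key c']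
  refine Finset.sum_congr rfl fun r _ => ?_
  by_cases hr : ∀ k : ι, ∃ i, r i = some k
  · have hsome : ∀ i, ∃ k, r i = some k := by
      choose g hg using hr
      have hinj : Function.Injective g := fun a b hab => by
        have := hg a; rw [hab, hg b] at this; simpa using this.symm
      intro i
      obtain ⟨k, hk⟩ := (Finite.injective_iff_surjective.1 hinj) i
      exact ⟨k, hk ▸ hg k⟩
    congr 2
    ext1 i
    obtain ⟨k, hk⟩ := hsome i
    simp [hk]
  · push Not at hr
    obtain ⟨k, hk⟩ := hr
    have h0 : ∑ S : Finset ι, (-1 : ℝ) ^ S.card *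
        ∏ i, (if ∀ k ∈ r i, k ∈ S then (1 : ℝ) else 0) = 0 := by
      have hu : (univ : Finset (Finset ι)) = (insert k (univ.erase k)).powerset := by
        rw [Finset.insert_erase (mem_univ k), Finset.powerset_univ]
      rw [hu, Finset.sum_powerset_insert (notMem_erase k univ), ← Finset.sum_add_distrib]
      refine Finset.sum_eq_zero fun S hS => ?_
      have hkS : k ∉ S := fun h => by
        have := mem_powerset.1 hS h
        simp at this
      rw [card_insert_of_notMem hkS]
      have : ∀ i, (∀ j ∈ r i, j ∈ insert k S) ↔ ∀ j ∈ r i, j ∈ S := by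
        intro i
        refine forall₂_congr fun j hj => ?_
        rw [mem_insert, or_iff_right]
        rintro rfl
        exact hk i (by simpa using hj)
      simp only [this]
      ring
    rw [h0, zero_mul, zero_mul]

theorem alternating_sum_card_pow (T : Finset (Fin n)) :
    ∑ S ∈ T.powerset, (-1 : ℝ) ^ (T.card - S.card) * (S.card : ℝ) ^ T.card = T.card.factorial := by
  have h := congrFun (fwdDiff_iter_eq_factorial (R := ℝ) (n := T.card)) 0
  rw [fwdDiff_iter_eq_sum_shift] at h
  rw [Finset.sum_powerset_apply_card
    (fun k => (-1 : ℝ) ^ (T.card - k) * (k : ℝ) ^ T.card)]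
  convert h using 1
  · refine Finset.sum_congr rfl fun k _ => ?_
    simp
    ring
  · simp

/-- Each element contributes equally to a sum over a powerset weighted by cardinality. -/
theorem sum_powerset_card_filter (T A : Finset (Fin n)) (hA : A ⊆ T) (w : ℕ → ℝ) :
    (T.card : ℝ) * ∑ S ∈ T.powerset, w S.card * ((S ∩ A).card : ℝ) =
      (A.card : ℝ) * ∑ S ∈ T.powerset, w S.card * (S.card : ℝ) := by
  have h1 : ∀ B ⊆ T, ∑ S ∈ T.powerset, w S.card * ((S ∩ B).card : ℝ) =
      ∑ k ∈ B, ∑ S ∈ T.powerset, if k ∈ S then w S.card else 0 := by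
    intro B hB
    rw [Finset.sum_comm]
    refine Finset.sum_congr rfl fun S _ => ?_
    rw [Finset.sum_ite, Finset.sum_const_zero, add_zero, Finset.sum_const, nsmul_eq_mul, mul_comm]
    congr 3
    ext; simp [and_comm]
  have h2 : ∀ k ∈ T, ∀ j ∈ T, (∑ S ∈ T.powerset, if k ∈ S then w S.card else 0) =
      ∑ S ∈ T.powerset, if j ∈ S then w S.card else 0 := by
    intro k hk j hj
    refine Finset.sum_bij' (fun S _ => S.map (Equiv.swap k j).toEmbedding)
      (fun S _ => S.map (Equiv.swap k j).toEmbedding) ?_ ?_ ?_ ?_ ?_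
    · intro S hS
      rw [mem_powerset] at hS ⊢
      intro x hx
      obtain ⟨y, hy, rfl⟩ := Finset.mem_map.1 hx
      have := hS hy
      simp only [Equiv.coe_toEmbedding, Equiv.swap_apply_def]
      split_ifs <;> assumption
    · intro S hS
      rw [mem_powerset] at hS ⊢
      intro x hx
      obtain ⟨y, hy, rfl⟩ := Finset.mem_map.1 hx
      have := hS hy
      simp only [Equiv.coe_toEmbedding, Equiv.swap_apply_def]
      split_ifs <;> assumption
    · intro S _; ext x; simp [Finset.mem_map_equiv]
    · intro S _; ext x; simp [Finset.mem_map_equiv]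
    · intro S _
      simp [Finset.mem_map_equiv]
  rcases T.eq_empty_or_nonempty with rfl | ⟨k, hk⟩
  · simp [Finset.subset_empty.1 hA]
  have h3 : ∀ B ⊆ T, ∑ S ∈ T.powerset, w S.card * ((S ∩ B).card : ℝ) =
      B.card * ∑ S ∈ T.powerset, if k ∈ S then w S.card else 0 := by
    intro B hB
    rw [h1 B hB, Finset.sum_congr rfl fun j hj => h2 j (hB hj) k hk, Finset.sum_const, nsmul_eq_mul]
  have h4 : ∑ S ∈ T.powerset, w S.card * (S.card : ℝ) =
      ∑ S ∈ T.powerset, w S.card * ((S ∩ T).card : ℝ) :=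
    Finset.sum_congr rfl fun S hS => by rw [Finset.inter_eq_left.2 (mem_powerset.1 hS)]
  rw [h4, h3 A hA, h3 T subset_rfl]
  ring

end Polarization

/-! ### Determinants on hyperplanes -/

section Determinants

/-- The rank one operator `w ↦ ⟪u, w⟫ v`. -/
def rk (u v : En n) : En n →L[ℝ] En n := (innerSL ℝ u).smulRight v

@[simp] theorem rk_apply (u v w : En n) : rk u v w = ⟪u, w⟫_ℝ • v := rfl

/-- `X` annihilates `u` and has range in `u^⊥`. -/
def Perp (u : En n) (X : En n →L[ℝ] En n) : Prop := X u = 0 ∧ ∀ w, ⟪u, X w⟫_ℝ = 0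

theorem Perp.add {u : En n} {X Y : En n →L[ℝ] En n} (hX : Perp u X) (hY : Perp u Y) :
    Perp u (X + Y) :=
  ⟨by simp [hX.1, hY.1], fun w => by simp [inner_add_right, hX.2, hY.2]⟩

theorem Perp.smul {u : En n} {X : En n →L[ℝ] En n} (hX : Perp u X) (c : ℝ) : Perp u (c • X) :=
  ⟨by simp [hX.1], fun w => by simp [inner_smul_right, hX.2]⟩

theorem Perp.zero (u : En n) : Perp u 0 := ⟨rfl, fun w => by simp⟩

theorem Perp.sum {u : En n} {ι : Type*} (S : Finset ι) {X : ι → En n →L[ℝ] En n}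
    (hX : ∀ k ∈ S, Perp u (X k)) : Perp u (∑ k ∈ S, X k) := by
  classical
  induction S using Finset.induction_on with
  | empty => exact Perp.zero u
  | insert a S ha ih =>
    rw [Finset.sum_insert ha]
    exact (hX a (by simp)).add (ih fun k hk => hX k (by simp [hk]))

theorem perp_hessOp {F : En n → ℝ} (hF : IsC2H F) {u : En n} (hu : u ≠ 0) :
    Perp u (hessOp F u) :=
  ⟨hF.hessOp_self hu, fun w => by rw [real_inner_comm, hF.inner_hessOp_self hu]⟩

theorem det_mul (A B : En n →L[ℝ] En n) : (A * B).det = A.det * B.det :=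
  LinearMap.det_comp (A : En n →ₗ[ℝ] En n) (B : En n →ₗ[ℝ] En n)

theorem det_smul (c : ℝ) (A : En n →L[ℝ] En n) : (c • A).det = c ^ n * A.det := by
  have := LinearMap.det_smul c (A : En n →ₗ[ℝ] En n)
  rw [finrank_euclideanSpace_fin] at this
  exact this

theorem det_one : (1 : En n →L[ℝ] En n).det = 1 := LinearMap.det_id

theorem det_one_add_rk (u v : En n) : (1 + rk u v).det = 1 + ⟪u, v⟫_ℝ := by
  have := LinearMap.transvection.det (innerSL ℝ u : En n →L[ℝ] ℝ).toLinearMap v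
  rw [ContinuousLinearMap.det]
  exact this

theorem det_add_rk {u : En n} (hu : ‖u‖ = 1) {X : En n →L[ℝ] En n} (hX : Perp u X) (v : En n) :
    (X + rk u v).det = ⟪u, v⟫_ℝ * (X + rk u u).det := by
  have h1 : X + rk u v = (1 + rk u (v - u)) * (X + rk u u) := by
    ext1 w
    have huu : ⟪u, u⟫_ℝ = 1 := by rw [real_inner_self_eq_norm_sq, hu]; norm_num
    simp only [add_apply, rk_apply, mul_apply_eq_comp,
      one_apply_eq_self, inner_add_right, hX.2, inner_smul_right, huu]
    module
  rw [h1, det_mul, det_one_add_rk, inner_sub_right, real_inner_self_eq_norm_sq, hu]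
  ring

theorem det_eq_zero_of_apply {u : En n} (hu : u ≠ 0) {X : En n →L[ℝ] En n} (hX : X u = 0) :
    X.det = 0 := by
  rw [ContinuousLinearMap.det, LinearMap.det_eq_zero_iff_ker_ne_bot]
  intro h
  have : u ∈ LinearMap.ker (X : En n →ₗ[ℝ] En n) := hX
  rw [h] at this
  exact hu (by simpa using this)

theorem det_rk_add_smul {u : En n} (hu : ‖u‖ = 1) {X : En n →L[ℝ] En n} (hX : Perp u X)
    (hn : 0 < n) {c : ℝ} (hc : c ≠ 0) : (rk u u + c • X).det = c ^ (n - 1) * (rk u u + X).det := by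
  have huu : ⟪u, u⟫_ℝ = 1 := by rw [real_inner_self_eq_norm_sq, hu]; norm_num
  have h1 : rk u u + c • X = (c • (1 + rk u ((c⁻¹ - 1) • u))) * (rk u u + X) := by
    ext1 w
    simp only [add_apply, rk_apply, mul_apply_eq_comp,
      one_apply_eq_self, inner_add_right, hX.2, inner_smul_right, huu,
      smul_apply]
    match_scalars
    · field_simp; ring
    · ring
  rw [h1, det_mul, det_smul, det_one_add_rk, inner_smul_right, huu]
  obtain ⟨m, rfl⟩ : ∃ m, n = m + 1 := ⟨n - 1, by omega⟩
  rw [pow_succ, Nat.add_sub_cancel]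
  field_simp
  ring_nf

theorem det_eq_basis_det (A : En n →L[ℝ] En n) :
    A.det = (EuclideanSpace.basisFun (Fin n) ℝ).toBasis.det
      fun i => A (EuclideanSpace.basisFun (Fin n) ℝ i) := by
  have := Module.Basis.det_comp (EuclideanSpace.basisFun (Fin n) ℝ).toBasis (A : En n →ₗ[ℝ] En n)
    (EuclideanSpace.basisFun (Fin n) ℝ).toBasis
  rw [Module.Basis.det_self, mul_one] at this
  rw [ContinuousLinearMap.det, ← this]
  congr 1

theorem contDiff_det : ContDiff ℝ 1 fun A : En n →L[ℝ] En n => A.det := by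
  have h : (fun A : En n →L[ℝ] En n => A.det) = fun A => ∑ σ : Equiv.Perm (Fin n),
      Equiv.Perm.sign σ • ∏ i, (A (EuclideanSpace.basisFun (Fin n) ℝ i)) (σ i) := by
    ext A
    rw [det_eq_basis_det, Module.Basis.det_apply, Matrix.det_apply]
    rfl
  rw [h]
  refine ContDiff.sum fun σ _ => ?_
  refine ContDiff.const_smul _ (contDiff_prod fun i _ => ?_)
  exact (((EuclideanSpace.proj (σ i) : En n →L[ℝ] ℝ).comp
    (ContinuousLinearMap.apply ℝ (En n) (EuclideanSpace.basisFun (Fin n) ℝ i))).contDiff)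

/-- The trace as a continuous linear functional on operators. -/
def trL : (En n →L[ℝ] En n) →L[ℝ] ℝ :=
  ∑ j : Fin n, (EuclideanSpace.proj j : En n →L[ℝ] ℝ).comp
    (ContinuousLinearMap.apply ℝ (En n) (EuclideanSpace.single j (1 : ℝ) : En n))

theorem trL_hessOp (F : En n → ℝ) (x : En n) : trL (hessOp F x) = lap F x := by
  simp only [trL, sum_apply, ContinuousLinearMap.comp_apply, ContinuousLinearMap.apply_apply, lap]
  refine Finset.sum_congr rfl fun j _ => ?_
  rw [← inner_hessOp, EuclideanSpace.inner_single_right]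
  simp

theorem hasFDerivAt_det_one :
    HasFDerivAt (fun A : En n →L[ℝ] En n => (1 + A).det) (trL (n := n)) 0 := by
  have h0 : HasFDerivAt (fun A : En n →L[ℝ] En n => (1 + A).det)
      (fderiv ℝ (fun A : En n →L[ℝ] En n => (1 + A).det) 0) 0 := by
    apply DifferentiableAt.hasFDerivAt
    exact ((contDiff_det.differentiable (by simp)).comp
      (differentiable_id.const_add 1)).differentiableAt
  convert h0 using 1
  ext1 A
  have h1 : HasDerivAt (fun t : ℝ => t • A) A 0 := by
    simpa using (hasDerivAt_id (0 : ℝ)).smul_const A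
  have h0' := h0
  rw [← zero_smul ℝ A] at h0'
  have h2 := h0'.comp_hasDerivAt (0 : ℝ) h1
  rw [zero_smul] at h2
  set M : Matrix (Fin n) (Fin n) ℝ := LinearMap.toMatrix
    (EuclideanSpace.basisFun (Fin n) ℝ).toBasis (EuclideanSpace.basisFun (Fin n) ℝ).toBasis
    (A : En n →ₗ[ℝ] En n) with hM
  have h3 : ∀ t : ℝ, (1 + t • A).det = (1 + t • M).det := by
    intro t
    rw [ContinuousLinearMap.det, ← LinearMap.det_toMatrix
      (EuclideanSpace.basisFun (Fin n) ℝ).toBasis]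
    congr 1
    rw [hM]
    have : ((1 + t • A : En n →L[ℝ] En n) : En n →ₗ[ℝ] En n) =
      LinearMap.id + t • (A : En n →ₗ[ℝ] En n) := rfl
    rw [this, map_add, map_smul, LinearMap.toMatrix_id]
  set q := ((1 + (Polynomial.X : Polynomial ℝ) • M.map Polynomial.C).det).divX.divX with hq
  have h4 : HasDerivAt (fun t : ℝ => (1 + t • M).det) M.trace 0 := by
    have h5 : (fun t : ℝ => (1 + t • M).det) =
        fun t => 1 + M.trace * t + q.eval t * t ^ 2 := by
      ext t
      rw [Matrix.det_one_add_smul]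
    rw [h5]
    have := (((hasDerivAt_id (0 : ℝ)).const_mul M.trace).const_add 1).add
      ((q.hasDerivAt (0 : ℝ)).mul (hasDerivAt_pow 2 (0 : ℝ)))
    exact this.congr_deriv (by simp)
  have h6 : HasDerivAt ((fun A : En n →L[ℝ] En n => (1 + A).det) ∘ fun t : ℝ => t • A)
      M.trace 0 := by
    convert h4 using 1
    ext t
    exact h3 t
  rw [h2.unique h6, Matrix.trace, trL]
  simp only [sum_apply, ContinuousLinearMap.comp_apply, ContinuousLinearMap.apply_apply, hM,
    Matrix.diag, LinearMap.toMatrix_apply]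
  simp

end Determinants

section

set_option maxSynthPendingDepth 3

/-! ### Alternating sums of determinants -/

section AlternatingDet

theorem alternating_det {u : En n} (hu : u ≠ 0) (z : Fin n) {X : Fin n → En n →L[ℝ] En n}
    (hX : ∀ k, Perp u (X k)) {B : En n →L[ℝ] En n} (hB : Perp u B) :
    ∑ S ∈ (Finset.univ.erase z).powerset, (-1 : ℝ) ^ S.card * (rk u u + (B + ∑ k ∈ S, X k)).det =
      ∑ S ∈ (Finset.univ.erase z).powerset, (-1 : ℝ) ^ S.card * (rk u u + ∑ k ∈ S, X k).det := by
  classical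
  set b := (EuclideanSpace.basisFun (Fin n) ℝ) with hb
  set Y : Fin n → En n →L[ℝ] En n := fun k => if k = z then rk u u else X k with hY
  have key : ∀ B : En n →L[ℝ] En n, Perp u B →
      ∑ S ∈ (Finset.univ.erase z).powerset, (-1 : ℝ) ^ S.card *
        (rk u u + (B + ∑ k ∈ S, X k)).det =
      - ∑ S : Finset (Fin n), (-1 : ℝ) ^ S.card *
        b.toBasis.det.toMultilinearMap (fun i => B (b i) + ∑ k ∈ S, Y k (b i)) := by
    intro B hB
    have h1 : ∀ S : Finset (Fin n),
        b.toBasis.det.toMultilinearMap (fun i => B (b i) + ∑ k ∈ S, Y k (b i)) =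
        (B + ∑ k ∈ S, Y k).det := by
      intro S
      rw [det_eq_basis_det]
      simp [sum_apply, hb]
    simp only [h1]
    have hz : z ∉ Finset.univ.erase z := by simp
    rw [← Finset.powerset_univ, ← Finset.insert_erase (Finset.mem_univ z),
      Finset.sum_powerset_insert hz, Finset.erase_insert hz, ← Finset.sum_add_distrib,
      ← Finset.sum_neg_distrib]
    refine Finset.sum_congr rfl fun S hS => ?_
    have hzS : z ∉ S := fun h => hz (Finset.mem_powerset.1 hS h)
    have h2 : ∑ k ∈ S, Y k = ∑ k ∈ S, X k := Finset.sum_congr rfl fun k hk => by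
      exact if_neg fun h : k = z => hzS (by rw [← h]; exact hk)
    have h3 : (B + ∑ k ∈ S, X k).det = 0 :=
      det_eq_zero_of_apply hu (hB.add (Perp.sum S fun k _ => hX k)).1
    have h4 : Y z = rk u u := if_pos rfl
    rw [Finset.sum_insert hzS, Finset.card_insert_of_notMem hzS, h2, h3, h4, pow_succ,
      add_left_comm B]
    ring
  have h0 := key 0 (Perp.zero u)
  simp only [zero_add] at h0
  rw [key B hB, h0]
  congr 1
  have := MultilinearMap.alternating_sum_eq b.toBasis.det.toMultilinearMap
    (fun k i => Y k (b i)) (fun i => B (b i)) (fun _ => 0)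
  rw [this]
  simp

theorem det_rk_add_proj {u : En n} (hu : ‖u‖ = 1) (hn : 2 ≤ n) {E : En n →L[ℝ] En n}
    (hE : Perp u E) {a b : ℝ} (h : a = 0 → b = 0) :
    (rk u u + (a • (1 - rk u u) + b • E)).det = a ^ (n - 1) * (1 + (b / a) • E).det := by
  have hP : Perp u (1 - rk u u) :=
    ⟨by simp [hu], fun w => by simp [inner_sub_right, inner_smul_right, hu]⟩
  by_cases ha : a = 0
  · rw [h ha, ha, zero_pow (by omega), zero_mul]
    simp only [zero_smul, add_zero]
    have h1 := det_rk_add_smul hu (Perp.zero u) (by omega) (c := 2) two_ne_zero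
    rw [smul_zero, add_zero] at h1
    have h2 : (2 : ℝ) ≤ 2 ^ (n - 1) := by
      calc (2 : ℝ) = 2 ^ 1 := by norm_num
        _ ≤ 2 ^ (n - 1) := pow_le_pow_right₀ (by norm_num) (by omega)
    nlinarith
  · have h1 : rk u u + (a • (1 - rk u u) + b • E) =
        (rk u u + a • (1 - rk u u)) * (1 + (b / a) • E) := by
      ext1 w
      simp only [add_apply, rk_apply, mul_apply_eq_comp, one_apply_eq_self, sub_apply,
        smul_apply, inner_add_right, inner_smul_right, hE.2]
      match_scalars <;> field_simp <;> ring
    rw [h1, det_mul, det_rk_add_smul hu hP (by omega) ha, add_sub_cancel, det_one, mul_one]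

/-- The normalised mixed discriminant of `i` copies of `1 + E` and `n - 1 - i` copies of `1`. -/
def phi (z : Fin n) (i : ℕ) (E : En n →L[ℝ] En n) : ℝ :=
  ((n - 1).factorial : ℝ)⁻¹ * ∑ S ∈ (Finset.univ.erase z).powerset,
    (-1 : ℝ) ^ (n - 1 - S.card) * (S.card : ℝ) ^ (n - 1) *
      (1 + (((S.filter fun k : Fin n => (k : ℕ) ≤ i).card : ℝ) / S.card) • E).det

theorem card_erase_univ (z : Fin n) : (Finset.univ.erase z).card = n - 1 := by
  rw [Finset.card_erase_of_mem (Finset.mem_univ z), Finset.card_univ, Fintype.card_fin]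

theorem phi_zero (z : Fin n) (i : ℕ) : phi z i 0 = 1 := by
  have h := alternating_sum_card_pow (Finset.univ.erase z)
  rw [card_erase_univ] at h
  simp only [phi, smul_zero, add_zero, det_one, mul_one]
  rw [h]
  exact inv_mul_cancel₀ (by positivity)

theorem continuous_phi (z : Fin n) (i : ℕ) : Continuous (phi z i) := by
  refine continuous_const.mul (continuous_finsetSum _ fun S _ => continuous_const.mul ?_)
  exact contDiff_det.continuous.comp (by fun_prop)

theorem hasFDerivAt_phi (hn : 2 ≤ n) {i : ℕ} (hi : i ≤ n - 1) :
    HasFDerivAt (phi (⟨0, by omega⟩ : Fin n) i) (((i : ℝ) / (n - 1 : ℕ)) • trL (n := n)) 0 := by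
  set z : Fin n := ⟨0, by omega⟩ with hz
  have h1 : ∀ c : ℝ, HasFDerivAt (fun E : En n →L[ℝ] En n => (1 + c • E).det) (c • trL) 0 := by
    intro c
    have h0 := hasFDerivAt_det_one (n := n)
    rw [← smul_zero c] at h0
    have := h0.comp (0 : En n →L[ℝ] En n) ((hasFDerivAt_id (𝕜 := ℝ) (0 : En n →L[ℝ] En n)).const_smul c)
    refine this.congr_fderiv ?_
    ext A
    simp
  have h2 : HasFDerivAt (phi z i) (((n - 1).factorial : ℝ)⁻¹ •
      ∑ S ∈ (Finset.univ.erase z).powerset, ((-1 : ℝ) ^ (n - 1 - S.card) * (S.card : ℝ) ^ (n - 1)) •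
      ((((S.filter fun k : Fin n => (k : ℕ) ≤ i).card : ℝ) / S.card) • trL (n := n))) 0 := by
    refine HasFDerivAt.const_mul (HasFDerivAt.fun_sum fun S _ => ?_) _
    exact (h1 _).const_mul _
  refine h2.congr_fderiv ?_
  simp only [smul_smul, ← Finset.sum_smul]
  congr 1
  set A : Finset (Fin n) := (Finset.univ.erase z).filter fun k => (k : ℕ) ≤ i with hA
  have hAc : A.card = i := by
    have : A = (Finset.Icc 1 i).attachFin fun k hk => by rw [Finset.mem_Icc] at hk; omega := by
      ext k
      simp only [hA, Finset.mem_filter, Finset.mem_erase, Finset.mem_univ, and_true,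
        Finset.mem_attachFin, Finset.mem_Icc, hz, Fin.ext_iff, ne_eq]
      omega
    rw [this, Finset.card_attachFin, Nat.card_Icc]; omega
  have h3 := sum_powerset_card_filter (Finset.univ.erase z) A (Finset.filter_subset _ _)
    fun s => (-1 : ℝ) ^ (n - 1 - s) * (s : ℝ) ^ (n - 2)
  have h4 := alternating_sum_card_pow (Finset.univ.erase z)
  rw [card_erase_univ] at h3 h4
  rw [hAc] at h3
  have h5 : ∑ S ∈ (Finset.univ.erase z).powerset,
      (-1 : ℝ) ^ (n - 1 - S.card) * (S.card : ℝ) ^ (n - 2) * (S.card : ℝ) = (n - 1).factorial := by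
    rw [← h4]
    refine Finset.sum_congr rfl fun S _ => ?_
    rw [mul_assoc, ← pow_succ, show n - 2 + 1 = n - 1 by omega]
  have h6 : ∑ S ∈ (Finset.univ.erase z).powerset,
      (-1 : ℝ) ^ (n - 1 - S.card) * (S.card : ℝ) ^ (n - 2) * ((S ∩ A).card : ℝ) =
      ∑ S ∈ (Finset.univ.erase z).powerset,
      (-1 : ℝ) ^ (n - 1 - S.card) * (S.card : ℝ) ^ (n - 1) *
        (((S.filter fun k : Fin n => (k : ℕ) ≤ i).card : ℝ) / S.card) := by
    refine Finset.sum_congr rfl fun S hS => ?_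
    have : S ∩ A = S.filter fun k : Fin n => (k : ℕ) ≤ i := by
      ext k
      have : k ∈ S → k ∈ Finset.univ.erase z := fun h => Finset.mem_powerset.1 hS h
      simp only [hA, Finset.mem_inter, Finset.mem_filter] at this ⊢
      tauto
    rw [this]
    by_cases h0 : S.card = 0
    · simp [Finset.card_eq_zero.1 h0]
    · have : (S.card : ℝ) ≠ 0 := by exact_mod_cast h0
      rw [show n - 1 = n - 2 + 1 by omega, pow_succ]
      field_simp
  rw [h5, h6] at h3
  have hn1 : ((n - 1 : ℕ) : ℝ) ≠ 0 := by
    have : n - 1 ≠ 0 := by omega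
    exact_mod_cast this
  rw [← mul_right_inj' hn1, mul_left_comm, h3]
  have : ((n - 1).factorial : ℝ) ≠ 0 := by positivity
  field_simp

end AlternatingDet

/-! ### Integration in polar coordinates -/

section Polar

theorem nontrivial_En (hn : 0 < n) : Nontrivial (En n) := by
  have : Nonempty (Fin n) := ⟨⟨0, hn⟩⟩
  infer_instance

/-- Polar coordinates for a product of a radial and an angular function. -/
theorem integral_polar (hn : 0 < n) (ψ : ℝ → ℝ) (a : En n → ℝ) :
    ∫ x : En n, ψ ‖x‖ * a (‖x‖⁻¹ • x) =
      (∫ r in Set.Ioi (0 : ℝ), r ^ (n - 1) * ψ r) * ∫ v : Sph n, a v ∂(sphVol n) := by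
  have := nontrivial_En hn
  have h1 : ∫ x : En n, ψ ‖x‖ * a (‖x‖⁻¹ • x) =
      ∫ x : ({(0 : En n)}ᶜ : Set (En n)), ψ ‖x.1‖ * a (‖x.1‖⁻¹ • x.1)
        ∂((volume : Measure (En n)).comap (↑)) := by
    rw [integral_subtype_comap (measurableSet_singleton _).compl
      fun x : En n => ψ ‖x‖ * a (‖x‖⁻¹ • x), restrict_compl_singleton]
  have h2 := (volume : Measure (En n)).measurePreserving_homeomorphUnitSphereProd.integral_comp
    (Homeomorph.measurableEmbedding _) fun p : Sph n × Set.Ioi (0 : ℝ) => a p.1 * ψ p.2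
  rw [h1]
  have h3 : ∀ x : ({(0 : En n)}ᶜ : Set (En n)), ψ ‖x.1‖ * a (‖x.1‖⁻¹ • x.1) =
      a (homeomorphUnitSphereProd (En n) x).1 * ψ (homeomorphUnitSphereProd (En n) x).2 := by
    intro x
    rw [homeomorphUnitSphereProd_apply_fst_coe, homeomorphUnitSphereProd_apply_snd_coe, mul_comm]
  simp only [h3]
  rw [h2]
  have h4 := integral_prod_mul (μ := (volume : Measure (En n)).toSphere)
    (ν := Measure.volumeIoiPow (Module.finrank ℝ (En n) - 1)) (fun v : Sph n => a v)
    fun r : Set.Ioi (0 : ℝ) => ψ r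
  rw [h4, mul_comm, sphVol]
  congr 1
  simp only [Measure.volumeIoiPow, ENNReal.ofReal]
  rw [integral_withDensity_eq_integral_smul, integral_subtype_comap measurableSet_Ioi
    fun r : ℝ => Real.toNNReal (r ^ (Module.finrank ℝ (En n) - 1)) • ψ r]
  · rw [finrank_euclideanSpace_fin]
    refine setIntegral_congr_fun measurableSet_Ioi fun r hr => ?_
    rw [NNReal.smul_def, Real.coe_toNNReal _ (pow_nonneg (le_of_lt hr) _), smul_eq_mul]
  · exact (measurable_subtype_coe.pow_const _).real_toNNReal

instance : IsFiniteMeasure (sphVol n) := by unfold sphVol; infer_instance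

instance : (sphVol n).IsOpenPosMeasure := by unfold sphVol; infer_instance

theorem integrable_sph {f : Sph n → ℝ} (hf : Continuous f) : Integrable f (sphVol n) :=
  hf.integrable_of_hasCompactSupport (HasCompactSupport.of_compactSpace f)

set_option maxHeartbeats 1000000 in
/-- Green's formula on the sphere, for 1-homogeneous functions. -/
theorem integral_mul_lap_comm (hn : 0 < n) {F G : En n → ℝ} (hF : IsC2H F) (hG : IsC2H G) :
    ∫ v : Sph n, F v * lap G v ∂(sphVol n) = ∫ v : Sph n, G v * lap F v ∂(sphVol n) := by
  have := nontrivial_En hn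
  let b : ContDiffBump (2 : ℝ) := ⟨1 / 2, 1, by norm_num, by norm_num⟩
  set χ : En n → ℝ := fun x => b (‖x‖ ^ 2) with hχ
  have hχd : ∀ x, HasFDerivAt χ (deriv b (‖x‖ ^ 2) • (2 • innerSL ℝ x)) x := fun x =>
    ((b.contDiff (n := 1)).differentiable (by simp) _).hasDerivAt.comp_hasFDerivAt x
      (hasStrictFDerivAt_norm_sq x).hasFDerivAt
  have hχc : Continuous χ := b.continuous.comp (by fun_prop)
  have hb0 : ∀ t : ℝ, t ∉ Set.Icc (1 : ℝ) 3 → b t = 0 := by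
    intro t ht
    apply b.zero_of_le_dist
    rw [Real.dist_eq]
    by_contra! h
    rw [abs_lt] at h
    have : b.rOut = 1 := rfl
    rw [this] at h
    exact ht ⟨by linarith [h.1], by linarith [h.2]⟩
  have hts : tsupport χ ⊆ {x | 1 ≤ ‖x‖ ∧ ‖x‖ ≤ 2} := by
    refine closure_minimal (fun x hx => ?_)
      ((isClosed_le continuous_const continuous_norm).inter
        (isClosed_le continuous_norm continuous_const))
    have : ‖x‖ ^ 2 ∈ Set.Icc (1 : ℝ) 3 := by
      by_contra h; exact hx (hb0 _ h)
    have h0 := norm_nonneg x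
    exact ⟨by nlinarith [this.1], by nlinarith [this.2]⟩
  have hts0 : ∀ x ∈ tsupport χ, x ≠ 0 := by
    rintro x hx rfl
    have := (hts hx).1
    simp at this; linarith
  have hcs : HasCompactSupport χ := by
    refine HasCompactSupport.intro (isCompact_closedBall (0 : En n) 2) fun x hx => ?_
    by_contra h
    exact hx (by simpa using (hts (subset_closure h)).2)
  set e : Fin n → En n := fun j => EuclideanSpace.single j 1 with he
  -- integrability of continuous functions times something supported in the annulus
  have hintg : ∀ (p : En n → ℝ) (q : En n → ℝ), ContinuousOn p {0}ᶜ → Continuous q →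
      (∀ x, x ∉ tsupport χ → q x = 0) → Integrable fun x => p x * q x := by
    intro p q hp hq hq0
    refine Continuous.integrable_of_hasCompactSupport ?_ ?_
    · rw [continuous_iff_continuousAt]
      intro x
      by_cases hx : x = 0
      · have : (fun x => p x * q x) =ᶠ[𝓝 x] fun _ => 0 := by
          have h0 : (tsupport χ)ᶜ ∈ 𝓝 x :=
            (isClosed_tsupport χ).isOpen_compl.mem_nhds fun h => hts0 x h hx
          filter_upwards [h0] with y hy
          rw [hq0 y hy, mul_zero]
        exact continuousAt_const.congr this.symm
      · exact (hp.continuousAt (isOpen_compl_singleton.mem_nhds hx)).mul hq.continuousAt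
    · exact HasCompactSupport.intro hcs.isCompact fun x hx => by rw [hq0 x hx, mul_zero]
  have hd0 : ∀ x, x ∉ tsupport χ → ∀ w, (deriv b (‖x‖ ^ 2) • (2 • innerSL ℝ x)) w = 0 := by
    intro x hx w
    rw [← (hχd x).fderiv, fderiv_of_notMem_tsupport ℝ hx]; rfl
  have hdb : Continuous (deriv b) := (b.contDiff (n := 1)).continuous_deriv le_rfl
  set W : Fin n → En n → ℝ := fun j x => F x * fderiv ℝ G x (e j) - G x * fderiv ℝ F x (e j) with hW
  set W' : Fin n → En n → En n →L[ℝ] ℝ := fun j x =>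
    (F x • (D2 G x).flip (e j) + fderiv ℝ G x (e j) • fderiv ℝ F x) -
      (G x • (D2 F x).flip (e j) + fderiv ℝ F x (e j) • fderiv ℝ G x) with hW'
  have hWd : ∀ j x, x ≠ 0 → HasFDerivAt (W j) (W' j x) x := by
    intro j x hx
    have h1 : ∀ {F : En n → ℝ}, IsC2H F →
        HasFDerivAt (fun y => fderiv ℝ F y (e j)) ((D2 F x).flip (e j)) x := fun hF =>
      (hF.hasFDerivAt_fderiv hx).clm_apply (hasFDerivAt_const (e j) x) |>.congr_fderiv (by simp)
    exact ((hF.hasFDerivAt hx).mul (h1 hG)).sub ((hG.hasFDerivAt hx).mul (h1 hF))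
  have hWW : ∀ j x, W' j x (e j) = F x * D2 G x (e j) (e j) - G x * D2 F x (e j) (e j) := by
    intro j x
    simp [hW']
    ring
  have hc1 : ∀ {F : En n → ℝ}, IsC2H F → ∀ j, ContinuousOn (fun x => fderiv ℝ F x (e j)) {0}ᶜ :=
    fun hF j => hF.continuousOn_fderiv.clm_apply continuousOn_const
  have hc2 : ∀ {F : En n → ℝ}, IsC2H F → ∀ j, ContinuousOn (fun x => D2 F x (e j) (e j)) {0}ᶜ :=
    fun hF j => (hF.continuousOn_D2.clm_apply continuousOn_const).clm_apply continuousOn_const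
  have hcW : ∀ j, ContinuousOn (W j) {0}ᶜ := fun j =>
    (hF.continuousOn.mul (hc1 hG j)).sub (hG.continuousOn.mul (hc1 hF j))
  have hcW' : ∀ j, ContinuousOn (fun x => W' j x (e j)) {0}ᶜ := fun j => by
    simp only [hWW]
    exact (hF.continuousOn.mul (hc2 hG j)).sub (hG.continuousOn.mul (hc2 hF j))
  have hq2 : ∀ j, Continuous fun x : En n => (deriv b (‖x‖ ^ 2) • (2 • innerSL ℝ x)) (e j) :=
    fun j => by
      have : Continuous fun x : En n => deriv b (‖x‖ ^ 2) := hdb.comp (by fun_prop)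
      fun_prop
  have hχ0 : ∀ x, x ∉ tsupport χ → χ x = 0 := fun x hx => image_eq_zero_of_notMem_tsupport hx
  have hibp : ∀ j, ∫ x, χ x * W' j x (e j) =
      - ∫ x, (deriv b (‖x‖ ^ 2) • (2 • innerSL ℝ x)) (e j) * W j x := by
    intro j
    have := integral_bilinear_hasFDerivAt_right_eq_neg_left_of_integrable
      (μ := (volume : Measure (En n))) (f := χ)
      (f' := fun x => deriv b (‖x‖ ^ 2) • (2 • innerSL ℝ x)) (g := W j) (g' := W' j) (v := e j)
      (B := ContinuousLinearMap.mul ℝ ℝ) ?_ ?_ ?_ (fun x _ => hχd x)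
      (fun x hx => hWd j x (hts0 x hx))
    · simpa only [ContinuousLinearMap.mul_apply'] using this
    · simp only [ContinuousLinearMap.mul_apply', mul_comm]
      simpa only [mul_comm] using hintg _ _ (hcW j) (hq2 j) fun x hx => hd0 x hx _
    · simp only [ContinuousLinearMap.mul_apply']
      simpa only [mul_comm] using hintg _ _ (hcW' j) hχc hχ0
    · simp only [ContinuousLinearMap.mul_apply']
      simpa only [mul_comm] using hintg _ _ (hcW j) hχc hχ0
  have hsum : ∫ x, χ x * (F x * lap G x - G x * lap F x) = 0 := by
    have h1 : ∀ x, χ x * (F x * lap G x - G x * lap F x) = ∑ j, χ x * W' j x (e j) := by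
      intro x
      rw [lap, lap, Finset.mul_sum, Finset.mul_sum, ← Finset.sum_sub_distrib, Finset.mul_sum]
      exact Finset.sum_congr rfl fun j _ => by rw [hWW]
    simp only [h1]
    rw [integral_finsetSum _ fun j _ => by
      simpa only [mul_comm] using hintg _ _ (hcW' j) hχc hχ0]
    simp only [hibp]
    rw [Finset.sum_neg_distrib, neg_eq_zero, ← integral_finsetSum _ fun j _ => by
      simpa only [mul_comm] using hintg _ _ (hcW j) (hq2 j) fun x hx => hd0 x hx _]
    rw [← integral_zero (En n) ℝ]
    congr 1
    ext x
    by_cases hx : x = 0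
    · simp [hx]
    have h2 : ∀ {F : En n → ℝ}, IsC2H F → ∑ j, x j * fderiv ℝ F x (e j) = F x := by
      intro F hF
      have h3 := congrArg (fderiv ℝ F x) ((EuclideanSpace.basisFun (Fin n) ℝ).sum_repr x)
      rw [hF.fderiv_self hx, map_sum] at h3
      rw [← h3]
      exact Finset.sum_congr rfl fun j _ => by simp [he]
    have h3 : ∀ j, (deriv b (‖x‖ ^ 2) • (2 • innerSL ℝ x)) (e j) * W j x =
        2 * deriv b (‖x‖ ^ 2) * (F x * (x j * fderiv ℝ G x (e j)) -
          G x * (x j * fderiv ℝ F x (e j))) := by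
      intro j
      simp [hW, he, EuclideanSpace.inner_single_right]
      ring
    rw [Finset.sum_congr rfl fun j _ => h3 j, ← Finset.mul_sum, Finset.sum_sub_distrib,
      ← Finset.mul_sum, ← Finset.mul_sum, h2 hF, h2 hG]
    ring
  have hpol := integral_polar hn (fun r => b (r ^ 2)) fun x => F x * lap G x - G x * lap F x
  have hhom : ∀ x, (fun r => b (r ^ 2)) ‖x‖ * (F (‖x‖⁻¹ • x) * lap G (‖x‖⁻¹ • x) -
      G (‖x‖⁻¹ • x) * lap F (‖x‖⁻¹ • x)) = χ x * (F x * lap G x - G x * lap F x) := by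
    intro x
    by_cases hx : x = 0
    · simp [hx, hF.map_zero, hG.map_zero]
    · have hx' : 0 < ‖x‖⁻¹ := by positivity
      rw [hF.map_smul _ hx'.le, hG.map_smul _ hx'.le, hG.lap_smul hx', hF.lap_smul hx', inv_inv]
      simp only [hχ]
      field_simp
  simp only [hhom, hsum] at hpol
  have hpos : 0 < ∫ r in Set.Ioi (0 : ℝ), r ^ (n - 1) * b (r ^ 2) := by
    have hcont : Continuous fun r : ℝ => r ^ (n - 1) * b (r ^ 2) := by
      have : Continuous fun r : ℝ => b (r ^ 2) := b.continuous.comp (by fun_prop)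
      exact (continuous_pow _).mul this
    have hcs' : HasCompactSupport fun r : ℝ => r ^ (n - 1) * b (r ^ 2) := by
      refine HasCompactSupport.intro (isCompact_Icc (a := (-2 : ℝ)) (b := 2)) fun r hr => ?_
      rw [hb0, mul_zero]
      intro h
      exact hr ⟨by nlinarith [h.2], by nlinarith [h.2]⟩
    rw [setIntegral_pos_iff_support_of_nonneg_ae]
    · have : Set.Ioo (1 : ℝ) (5 / 4) ⊆
          (Function.support fun r : ℝ => r ^ (n - 1) * b (r ^ 2)) ∩ Set.Ioi 0 := by
        intro r hr
        refine ⟨mul_ne_zero (pow_ne_zero _ (by linarith [hr.1])) (b.pos_of_mem_ball ?_).ne', ?_⟩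
        · rw [Metric.mem_ball, Real.dist_eq, abs_lt]
          have : b.rOut = 1 := rfl
          rw [this]
          constructor <;> nlinarith [hr.1, hr.2]
        · exact lt_trans one_pos hr.1
      refine lt_of_lt_of_le ?_ (measure_mono this)
      rw [Real.volume_Ioo]
      norm_num
    · filter_upwards [ae_restrict_mem measurableSet_Ioi] with r hr
      exact mul_nonneg (pow_nonneg (le_of_lt hr) _) b.nonneg
    · exact (hcont.integrable_of_hasCompactSupport hcs').integrableOn
  have h0 := (mul_eq_zero.1 hpol.symm).resolve_left hpos.ne'
  rw [integral_sub, sub_eq_zero] at h0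
  · exact h0
  · exact integrable_sph (continuous_restrict_sphere (hF.continuousOn.mul hG.continuousOn_lap))
  · exact integrable_sph (continuous_restrict_sphere (hG.continuousOn.mul hF.continuousOn_lap))

end Polar

theorem D2_eq_zero_of_line {F : En n → ℝ} {x w : En n} (hF : ContDiffAt ℝ 2 F x)
    (h : ∀ᶠ t : ℝ in 𝓝 0, F (x + t • w) = 0) : D2 F x w w = 0 := by
  obtain ⟨h1, h2⟩ := deriv_deriv_line hF w
  have h3 : (fun t : ℝ => fderiv ℝ F (x + t • w) w) =ᶠ[𝓝 0] fun _ => 0 := by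
    filter_upwards [h1, h.eventually_nhds] with t ht ht'
    exact ht.unique ((hasDerivAt_const t (0 : ℝ)).congr_of_eventuallyEq ht')
  exact h2.unique ((hasDerivAt_const (0 : ℝ) (0 : ℝ)).congr_of_eventuallyEq h3)

theorem det_nonneg_of_inner_nonneg {A : En n →L[ℝ] En n} (hA : ∀ w, 0 ≤ ⟪A w, w⟫_ℝ) :
    0 ≤ A.det := by
  set f : ℝ → ℝ := fun t => (A + t • 1).det with hf
  have hc : Continuous f := contDiff_det.continuous.comp (by fun_prop)
  have hne : ∀ t, 0 < t → f t ≠ 0 := by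
    intro t ht h0
    change (A + t • (1 : En n →L[ℝ] En n)).det = 0 at h0
    rw [ContinuousLinearMap.det, LinearMap.det_eq_zero_iff_ker_ne_bot] at h0
    obtain ⟨w, hw, hw0⟩ := Submodule.exists_mem_ne_zero_of_ne_bot h0
    have h1 : A w + t • w = 0 := by simpa using hw
    have h2 : ⟪A w, w⟫_ℝ + t * ⟪w, w⟫_ℝ = 0 := by
      rw [← real_inner_smul_left, ← inner_add_left, h1, inner_zero_left]
    have h3 : 0 < ⟪w, w⟫_ℝ := real_inner_self_pos.2 hw0
    have := hA w
    have := mul_pos ht h3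
    linarith
  -- scaling gives the sign for one value of the parameter
  have hpos : ∃ t > 0, 0 < f t := by
    have h1 : Tendsto (fun s : ℝ => (1 + s • A).det) (𝓝[>] 0) (𝓝 1) := by
      have : Continuous fun s : ℝ => (1 + s • A).det := contDiff_det.continuous.comp (by fun_prop)
      have h2 := this.tendsto 0
      simp only [zero_smul, add_zero, det_one] at h2
      exact h2.mono_left nhdsWithin_le_nhds
    obtain ⟨s, hs, hs'⟩ := ((h1.eventually (lt_mem_nhds one_pos)).and self_mem_nhdsWithin).exists
    have hs0 : (0 : ℝ) < s := hs'
    refine ⟨s⁻¹, inv_pos.2 hs0, ?_⟩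
    have : A + s⁻¹ • (1 : En n →L[ℝ] En n) = s⁻¹ • (1 + s • A) := by
      rw [smul_add, smul_smul, inv_mul_cancel₀ hs0.ne', one_smul, add_comm]
    simp only [hf]
    rw [this, det_smul]
    positivity
  obtain ⟨t, ht, hft⟩ := hpos
  have hall : ∀ s, 0 < s → 0 < f s := by
    intro s hs
    by_contra! hle
    have hpre := (convex_Ioi (0 : ℝ)).isPreconnected
    obtain ⟨r, hr, hr0⟩ := hpre.intermediate_value (Set.mem_Ioi.2 hs) (Set.mem_Ioi.2 ht)
      hc.continuousOn ⟨hle, hft.le⟩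
    exact hne r hr hr0
  have h0 : f 0 = A.det := by simp [hf]
  rw [← h0]
  refine ge_of_tendsto (x := 𝓝[>] (0 : ℝ)) ((hc.tendsto 0).mono_left nhdsWithin_le_nhds) ?_
  filter_upwards [self_mem_nhdsWithin] with s hs
  exact (hall s hs).le

section Shell

variable {N M : ConvexBody (En n)}

/-- The map parametrizing the shell `(N + M) \ N`. -/
def shellMap (N M : ConvexBody (En n)) (x : En n) : En n :=
  grd (supp N) x + ‖x‖ • grd (supp M) x

theorem inner_shellMap_le (hN : IsC2H (supp N)) (hM : IsC2H (supp M)) {x : En n} (hx : x ≠ 0)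
    (w : En n) : ⟪w, shellMap N M x⟫_ℝ ≤ supp N w + ‖x‖ * supp M w := by
  rw [shellMap, inner_add_right, real_inner_smul_right]
  exact add_le_add (inner_le_supp N w (grd_supp_mem hN hx))
    (mul_le_mul_of_nonneg_left (inner_le_supp M w (grd_supp_mem hM hx)) (norm_nonneg _))

theorem inner_shellMap_self (hN : IsC2H (supp N)) (hM : IsC2H (supp M)) {x : En n} (hx : x ≠ 0) :
    ⟪x, shellMap N M x⟫_ℝ = supp N x + ‖x‖ * supp M x := by
  rw [real_inner_comm, shellMap, inner_add_left, real_inner_smul_left, hN.inner_grd_self hx,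
    hM.inner_grd_self hx]

theorem shellMap_injOn (hN : IsC2H (supp N)) (hM : IsC2H (supp M))
    (hpos : ∀ x, x ≠ 0 → 0 < supp M x)
    (hpd : ∀ u, u ≠ 0 → ∀ w, w ≠ 0 → ⟪u, w⟫_ℝ = 0 → 0 < D2 (supp M) u w w) :
    Set.InjOn (shellMap N M) (closedBall 0 1 \ {0}) := by
  rintro x ⟨-, hx⟩ y ⟨-, hy⟩ hxy
  have hx : x ≠ 0 := hx
  have hy : y ≠ 0 := hy
  have hr0 : 0 < ‖x‖ := norm_pos_iff.2 hx
  have hle : ∀ a b : En n, a ≠ 0 → b ≠ 0 → shellMap N M a = shellMap N M b → ‖b‖ ≤ ‖a‖ := by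
    intro a b ha hb hab
    have h1 := inner_shellMap_self hN hM hb
    have h2 := inner_shellMap_le hN hM ha b
    rw [hab, h1] at h2
    exact le_of_mul_le_mul_right (by linarith) (hpos b hb)
  have hrs : ‖x‖ = ‖y‖ := le_antisymm (hle y x hy hx hxy.symm) (hle x y hx hy hxy)
  by_contra hne
  set p := shellMap N M x with hp
  set G : En n → ℝ := fun w => (supp N w + ‖x‖ * supp M w) - innerSL ℝ p w with hG
  have hGC : IsC2H G := (hN.add (hM.const_mul ‖x‖)).sub (IsC2H.clm (innerSL ℝ p))
  have hG0 : ∀ w, 0 ≤ G w := by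
    intro w
    have := inner_shellMap_le hN hM hx w
    simp only [hG, innerSL_apply_apply]
    rw [real_inner_comm] at this
    linarith
  have hGs : ∀ a b, G (a + b) ≤ G a + G b := by
    intro a b
    have h1 := supp_add_le N a b
    have h2 := mul_le_mul_of_nonneg_left (supp_add_le M a b) hr0.le
    simp only [hG, map_add]
    linarith
  have hGx : G x = 0 := by
    have := inner_shellMap_self hN hM hx
    simp only [hG, innerSL_apply_apply]
    rw [real_inner_comm] at this
    linarith
  have hGy : G y = 0 := by
    have := inner_shellMap_self hN hM hy
    simp only [hG, innerSL_apply_apply, hxy]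
    rw [real_inner_comm, ← hrs] at this
    linarith
  set w := y - x with hw
  have hw0 : w ≠ 0 := sub_ne_zero.2 (Ne.symm hne)
  set m := (1 / 2 : ℝ) • (x + y) with hm
  have hm0 : m ≠ 0 := by
    intro h0
    have hyx : y = -x := by
      have : x + y = 0 := (smul_eq_zero.1 h0).resolve_left (by norm_num)
      exact (neg_eq_of_add_eq_zero_right this).symm
    have h1 := supp_neg_le N x
    have h2 := mul_pos hr0 (hpos x hx)
    have h3 := mul_pos hr0 (hpos y hy)
    rw [hyx] at hGy h3
    simp only [hG, map_neg] at hGx hGy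
    linarith
  have hline : ∀ᶠ t : ℝ in 𝓝 0, G (m + t • w) = 0 := by
    filter_upwards [Ioo_mem_nhds (show (-1 / 2 : ℝ) < 0 by norm_num) (show (0 : ℝ) < 1 / 2 by norm_num)]
      with t ht
    have h1 : m + t • w = (1 / 2 - t) • x + (1 / 2 + t) • y := by
      rw [hm, hw]; module
    refine le_antisymm ?_ (hG0 _)
    rw [h1]
    refine (hGs _ _).trans ?_
    rw [hGC.map_smul _ (by linarith [ht.2]), hGC.map_smul _ (by linarith [ht.1]), hGx, hGy]
    simp
  have hz := D2_eq_zero_of_line (hGC.contDiffAt hm0) hline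
  have hmw : ⟪m, w⟫_ℝ = 0 := by
    rw [hm, hw, real_inner_smul_left, inner_add_left, inner_sub_right, inner_sub_right,
      real_inner_comm x y, real_inner_self_eq_norm_sq, real_inner_self_eq_norm_sq, hrs]
    ring
  have h2 := mul_pos hr0 (hpd m hm0 w hw0 hmw)
  have h3 := hN.D2_nonneg (supp_add_le N) hm0 w
  have h4 : D2 G m w w = D2 (supp N) m w w + ‖x‖ * D2 (supp M) m w w := by
    have e1 := (hN.add (hM.const_mul ‖x‖)).D2_sub (IsC2H.clm (innerSL ℝ p)) hm0
    have e2 := hN.D2_add (hM.const_mul ‖x‖) hm0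
    have e3 := hM.D2_const_mul ‖x‖ hm0
    have e4 := D2_clm (innerSL ℝ p) m
    change D2 (fun w => (supp N w + ‖x‖ * supp M w) - innerSL ℝ p w) m w w = _
    rw [e1, e2, e3, e4]
    simp
  linarith

theorem shellMap_image (hn : 0 < n) (hN : IsC2H (supp N)) (hM : IsC2H (supp M))
    (hpos : ∀ x, x ≠ 0 → 0 < supp M x) :
    shellMap N M '' (closedBall 0 1 \ {0}) = ((N + M : ConvexBody (En n)) : Set (En n)) \ N := by
  have := nontrivial_En hn
  apply Set.Subset.antisymm
  · rintro _ ⟨x, ⟨hx1, hx⟩, rfl⟩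
    have hx : x ≠ 0 := hx
    have hx1 : ‖x‖ ≤ 1 := by simpa using hx1
    refine ⟨mem_of_forall_inner_le_supp fun w => ?_, fun h => ?_⟩
    · refine (inner_shellMap_le hN hM hx w).trans ?_
      rw [supp_add]
      rcases eq_or_ne w 0 with rfl | hw
      · simp [supp_zero_right]
      · have := mul_le_mul_of_nonneg_right hx1 (hpos w hw).le
        linarith
    · have h1 := inner_le_supp N x h
      rw [inner_shellMap_self hN hM hx] at h1
      have := mul_pos (norm_pos_iff.2 hx) (hpos x hx)
      linarith
  · rintro p ⟨hp, hpN⟩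
    have hpp : ∀ u : Sph n, 0 < supp M (u : En n) := fun u => hpos _ (sphere_ne_zero u)
    set q : Sph n → ℝ := fun u => (⟪(u : En n), p⟫_ℝ - supp N u) / supp M u with hq
    have hqc : Continuous q :=
      ((continuous_subtype_val.inner continuous_const).sub
        ((continuous_supp N).comp continuous_subtype_val)).div₀
        ((continuous_supp M).comp continuous_subtype_val) fun u => (hpp u).ne'
    have hne : Nonempty (Sph n) := (NormedSpace.sphere_nonempty.2 zero_le_one).to_subtype
    obtain ⟨u, -, hu⟩ := isCompact_univ.exists_isMaxOn Set.univ_nonempty hqc.continuousOn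
    have hu : ∀ v, q v ≤ q u := fun v => hu (Set.mem_univ v)
    have hu0 := sphere_ne_zero u
    have hge : ∀ w, ⟪w, p⟫_ℝ ≤ supp N w + q u * supp M w := by
      refine forall_of_unit_of_smul (F := fun w => ⟪w, p⟫_ℝ)
        (G := fun w => supp N w + q u * supp M w) (fun c hc x => real_inner_smul_left _ _ _)
        (fun c hc x => by rw [supp_smul N hc, supp_smul M hc]; ring) fun w hw => ?_
      have h1 : (⟪w, p⟫_ℝ - supp N w) / supp M w ≤ q u := hu ⟨w, by simpa using hw⟩
      rw [div_le_iff₀ (hpos w (ne_zero_of_norm_eq_one hw))] at h1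
      linarith
    have he : ⟪(u : En n), p⟫_ℝ = supp N u + q u * supp M u := by
      simp only [hq]
      rw [div_mul_cancel₀ _ (hpp u).ne']
      ring
    have hr0 : 0 < q u := by
      by_contra! hle
      refine hpN (mem_of_forall_inner_le_supp fun w => (hge w).trans ?_)
      rcases eq_or_ne w 0 with rfl | hw
      · simp [supp_zero_right]
      · have := mul_nonneg (neg_nonneg.2 hle) (hpos w hw).le
        linarith
    have hr1 : q u ≤ 1 := by
      have h1 := inner_le_supp _ (u : En n) hp
      rw [supp_add, he] at h1
      exact le_of_mul_le_mul_right (by linarith) (hpp u)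
    have hx0 : q u • (u : En n) ≠ 0 := smul_ne_zero hr0.ne' hu0
    refine ⟨q u • (u : En n), ⟨?_, hx0⟩, ?_⟩
    · simpa [norm_smul, abs_of_pos hr0] using hr1
    · rw [shellMap, hN.grd_smul hr0, hM.grd_smul hr0, norm_smul, norm_sph, mul_one,
        Real.norm_of_nonneg hr0.le]
      have hGC : IsC2H fun w => (supp N w + q u * supp M w) - innerSL ℝ p w :=
        (hN.add (hM.const_mul (q u))).sub (IsC2H.clm (innerSL ℝ p))
      have hmin : IsLocalMin (fun w => (supp N w + q u * supp M w) - innerSL ℝ p w) (u : En n) := by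
        refine Eventually.of_forall fun w => ?_
        have h1 := hge w
        rw [real_inner_comm] at h1 he
        simp only [innerSL_apply_apply]
        linarith
      have hd := ((hN.hasFDerivAt hu0).fun_add ((hM.hasFDerivAt hu0).const_mul (q u))).fun_sub
        (innerSL ℝ p).hasFDerivAt
      have h0 := hmin.hasFDerivAt_eq_zero hd
      refine ext_inner_right ℝ fun v => ?_
      rw [inner_add_left, real_inner_smul_left, inner_grd, inner_grd]
      have := congrArg (fun l => l v) h0
      simp at this
      linarith

theorem hasFDerivAt_shellMap (hN : IsC2H (supp N)) (hM : IsC2H (supp M)) {x : En n} (hx : x ≠ 0) :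
    HasFDerivAt (shellMap N M)
      ((‖x‖⁻¹ • hessOp (supp N) (‖x‖⁻¹ • x) + hessOp (supp M) (‖x‖⁻¹ • x)) +
        rk (‖x‖⁻¹ • x) (grd (supp M) (‖x‖⁻¹ • x))) x := by
  have hx' : 0 < ‖x‖ := norm_pos_iff.2 hx
  have h := (hN.hasFDerivAt_grd hx).add
    ((hasFDerivAt_norm_of_ne_zero hx).smul (hM.hasFDerivAt_grd hx))
  refine h.congr_fderiv ?_
  rw [hN.hessOp_smul (inv_pos.2 hx'), hM.hessOp_smul (inv_pos.2 hx'), hM.grd_smul (inv_pos.2 hx'),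
    inv_inv, smul_smul, inv_mul_cancel₀ hx'.ne', one_smul]
  ext1 w
  simp [rk_apply, real_inner_smul_left, add_assoc]

/-- The density of the shell volume in the parametrization `shellMap`. -/
def shellDens (N M : ConvexBody (En n)) (x : En n) : ℝ :=
  supp M (‖x‖⁻¹ • x) * (rk (‖x‖⁻¹ • x) (‖x‖⁻¹ • x) +
    (hessOp (supp M) (‖x‖⁻¹ • x) + ‖x‖⁻¹ • hessOp (supp N) (‖x‖⁻¹ • x))).det

theorem volume_shell (hn : 0 < n) (hN : IsC2H (supp N)) (hM : IsC2H (supp M))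
    (hpos : ∀ x, x ≠ 0 → 0 < supp M x)
    (hpd : ∀ u, u ≠ 0 → ∀ w, w ≠ 0 → ⟪u, w⟫_ℝ = 0 → 0 < D2 (supp M) u w w) :
    IntegrableOn (shellDens N M) (closedBall 0 1 \ {0}) ∧
      ∫ x in closedBall 0 1 \ {0}, shellDens N M x =
        (volume ((N + M : ConvexBody (En n)) : Set (En n))).toReal -
          (volume (N : Set (En n))).toReal := by
  set D : Set (En n) := closedBall 0 1 \ {0}
  have hDm : MeasurableSet D := measurableSet_closedBall.diff (measurableSet_singleton 0)
  set f' : En n → En n →L[ℝ] En n := fun x =>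
    (‖x‖⁻¹ • hessOp (supp N) (‖x‖⁻¹ • x) + hessOp (supp M) (‖x‖⁻¹ • x)) +
        rk (‖x‖⁻¹ • x) (grd (supp M) (‖x‖⁻¹ • x)) with hf'
  have hder : ∀ x ∈ D, HasFDerivWithinAt (shellMap N M) (f' x) D x := fun x hx =>
    (hasFDerivAt_shellMap hN hM hx.2).hasFDerivWithinAt
  have hdet : ∀ x ∈ D, |(f' x).det| = shellDens N M x := by
    rintro x ⟨-, hx⟩
    have hx : x ≠ 0 := hx
    have hx' : 0 < ‖x‖ := norm_pos_iff.2 hx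
    have hu : ‖‖x‖⁻¹ • x‖ = 1 := by rw [norm_smul, norm_inv, norm_norm, inv_mul_cancel₀ hx'.ne']
    have hu0 := ne_zero_of_norm_eq_one hu
    simp only [hf', shellDens]
    set u := ‖x‖⁻¹ • x
    rw [det_add_rk hu (((perp_hessOp hN hu0).smul _).add (perp_hessOp hM hu0)),
      real_inner_comm, hM.inner_grd_self hu0, add_comm _ (rk u u), add_comm (‖x‖⁻¹ • _)]
    refine abs_of_nonneg (mul_nonneg (hpos u hu0).le (det_nonneg_of_inner_nonneg fun w => ?_))
    have h1 := hM.D2_nonneg (supp_add_le M) hu0 w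
    have h2 := mul_nonneg (inv_pos.2 hx').le (hN.D2_nonneg (supp_add_le N) hu0 w)
    simp only [add_apply, smul_apply, rk_apply, inner_add_left, real_inner_smul_left, inner_hessOp]
    nlinarith [mul_self_nonneg ⟪u, w⟫_ℝ]
  have hinj := shellMap_injOn hN hM hpos hpd
  have himg := shellMap_image hn hN hM hpos
  have hfin : ∀ K : ConvexBody (En n), volume (K : Set (En n)) ≠ ⊤ := fun K =>
    K.isCompact.measure_lt_top.ne
  constructor
  · have h1 : IntegrableOn (fun _ : En n => (1 : ℝ)) (shellMap N M '' D) := by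
      rw [himg, integrableOn_const_iff]
      right
      exact lt_of_le_of_lt (measure_mono Set.sdiff_subset) (hfin _).lt_top
    rw [integrableOn_image_iff_integrableOn_abs_det_fderiv_smul volume hDm hder hinj] at h1
    refine h1.congr_fun (fun x hx => ?_) hDm
    simp [hdet x hx]
  · have h1 := integral_image_eq_integral_abs_det_fderiv_smul volume hDm hder hinj
      (fun _ => (1 : ℝ))
    rw [himg] at h1
    simp only [smul_eq_mul, mul_one] at h1
    rw [setIntegral_congr_fun hDm hdet] at h1
    rw [← h1]
    have hsub : (N : Set (En n)) ⊆ (N + M : ConvexBody (En n)) := subset_of_supp_le fun w => by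
      rw [supp_add]
      rcases eq_or_ne w 0 with rfl | hw
      · simp [supp_zero_right]
      · linarith [hpos w hw]
    rw [setIntegral_const, smul_eq_mul, mul_one, measureReal_def,
      measure_sdiff hsub N.isCompact.measurableSet.nullMeasurableSet (hfin N),
      ENNReal.toReal_sub_of_le (measure_mono hsub) (hfin _)]

end Shell

theorem IsC2H.sum {ι : Type*} (S : Finset ι) {F : ι → En n → ℝ} (hF : ∀ k ∈ S, IsC2H (F k)) :
    IsC2H fun x => ∑ k ∈ S, F k x :=
  ⟨ContDiffOn.sum fun k hk => (hF k hk).contDiffOn, fun c hc x => by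
    rw [Finset.mul_sum]
    exact Finset.sum_congr rfl fun k hk => (hF k hk).map_smul c hc x⟩

theorem hessOp_sum {ι : Type*} (S : Finset ι) {F : ι → En n → ℝ} (hF : ∀ k ∈ S, IsC2H (F k))
    {x : En n} (hx : x ≠ 0) :
    hessOp (fun x => ∑ k ∈ S, F k x) x = ∑ k ∈ S, hessOp (F k) x := by
  classical
  induction S using Finset.induction_on with
  | empty =>
    simp only [Finset.sum_empty]
    have : D2 (fun _ : En n => (0 : ℝ)) x = 0 := by
      have := D2_clm (0 : En n →L[ℝ] ℝ) x
      exact this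
    rw [hessOp, this, ContinuousLinearMap.comp_zero]
  | insert a S ha ih =>
    simp only [Finset.sum_insert ha]
    have hS : ∀ k ∈ S, IsC2H (F k) := fun k hk => hF k (Finset.mem_insert_of_mem hk)
    rw [(hF a (Finset.mem_insert_self a S)).hessOp_add (IsC2H.sum S hS) hx, ih hS]

theorem hessOp_norm {u : En n} (hu : ‖u‖ = 1) : hessOp (fun y => ‖y‖) u = 1 - rk u u := by
  ext1 v
  refine ext_inner_right ℝ fun w => ?_
  rw [inner_hessOp, D2_norm_unit hu]
  simp [inner_sub_left, real_inner_smul_left]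

/-- The family of bodies `K, …, K, 𝔹ⁿ, …, 𝔹ⁿ` entering the area measure. -/
def famB (i : ℕ) (K : ConvexBody (En n)) (k : Fin n) : ConvexBody (En n) :=
  if (k : ℕ) ≤ i then K else ballB n

/-- The density of the area measure of order `i`. -/
def areaDens (z : Fin n) (i : ℕ) (K : ConvexBody (En n)) (u : En n) : ℝ :=
  phi z i (hessOp (fun x => supp K x - ‖x‖) u)

theorem isC2H_sub_norm {K : ConvexBody (En n)} (hK : IsC2H (supp K)) :
    IsC2H fun x => supp K x - ‖x‖ := hK.sub IsC2H.norm

theorem continuous_areaDens {z : Fin n} {i : ℕ} {K : ConvexBody (En n)} (hK : IsC2H (supp K)) :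
    Continuous fun u : Sph n => areaDens z i K u :=
  (continuous_phi z i).comp (continuous_restrict_sphere (isC2H_sub_norm hK).continuousOn_hessOp)

/-- The alternating volume sum. -/
def volSum (z : Fin n) (Ks : Fin n → ConvexBody (En n)) (L : ConvexBody (En n)) : ℝ :=
  ∑ S ∈ (Finset.univ.erase z).powerset, (-1 : ℝ) ^ (n - 1 - S.card) *
    ((volume ((L + ∑ k ∈ S, Ks k : ConvexBody (En n)) : Set (En n))).toReal -
      (volume ((∑ k ∈ S, Ks k : ConvexBody (En n)) : Set (En n))).toReal)

theorem card_le_of_mem {z : Fin n} {S : Finset (Fin n)} (hS : S ∈ (Finset.univ.erase z).powerset) :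
    S.card ≤ n - 1 := by
  rw [← card_erase_univ z]
  exact Finset.card_le_card (Finset.mem_powerset.1 hS)

theorem mixedVol_eq_volSum (hn : 0 < n) (i : ℕ) (K L : ConvexBody (En n)) :
    (n : ℝ) * mixedVol (fun k : Fin n =>
        if (k : ℕ) = 0 then L else if (k : ℕ) ≤ i then K else ballB n) =
      ((n - 1).factorial : ℝ)⁻¹ * volSum (⟨0, hn⟩ : Fin n) (famB i K) L := by
  classical
  set z : Fin n := ⟨0, hn⟩ with hz
  set Q : Fin n → ConvexBody (En n) := fun k : Fin n =>
        if (k : ℕ) = 0 then L else if (k : ℕ) ≤ i then K else ballB n with hQ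
  have hfac : (n.factorial : ℝ) = n * (n - 1).factorial := by
    obtain ⟨m, rfl⟩ : ∃ m, n = m + 1 := ⟨n - 1, by omega⟩
    rw [Nat.factorial_succ]; push_cast; simp
  have hn' : (n : ℝ) ≠ 0 := by positivity
  rw [mixedVol, hfac, mul_inv, ← mul_assoc, ← mul_assoc, mul_inv_cancel₀ hn', one_mul]
  congr 1
  have hu : (Finset.univ : Finset (Finset (Fin n))) = (insert z (Finset.univ.erase z)).powerset := by
    rw [Finset.insert_erase (Finset.mem_univ z), Finset.powerset_univ]
  rw [hu, Finset.sum_powerset_insert (Finset.notMem_erase z _), volSum, ← Finset.sum_add_distrib]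
  refine Finset.sum_congr rfl fun S hS => ?_
  have hzS : z ∉ S := fun h => Finset.notMem_erase z _ (Finset.mem_powerset.1 hS h)
  have hc := card_le_of_mem hS
  have hsum : ∑ k ∈ S, Q k = ∑ k ∈ S, famB i K k := by
    refine Finset.sum_congr rfl fun k hk => ?_
    have : (k : ℕ) ≠ 0 := fun h => hzS (by
      have : k = z := Fin.ext h
      exact this ▸ hk)
    simp [hQ, famB, this]
  rw [Finset.sum_insert hzS, Finset.card_insert_of_notMem hzS, hsum]
  have hQz : Q z = L := by simp [hQ, hz]
  rw [hQz, show n - S.card = (n - 1 - S.card) + 1 by omega,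
    show n - (S.card + 1) = n - 1 - S.card by omega, pow_succ]
  ring

theorem sum_det_eq_phi (hn : 2 ≤ n) (z : Fin n) {i : ℕ} {K : ConvexBody (En n)}
    (hK : IsC2H (supp K)) {u : En n} (hu : ‖u‖ = 1) {B : En n →L[ℝ] En n} (hB : Perp u B)
    {c : ℝ} (hc : c ≠ 0) :
    ∑ S ∈ (Finset.univ.erase z).powerset, (-1 : ℝ) ^ (n - 1 - S.card) *
      (rk u u + (B + c • hessOp (supp (∑ k ∈ S, famB i K k)) u)).det =
    c ^ (n - 1) * ((n - 1).factorial * areaDens z i K u) := by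
  classical
  have hu0 := ne_zero_of_norm_eq_one hu
  have hfam : ∀ k, IsC2H (supp (famB i K k)) := by
    intro k
    unfold famB
    split_ifs
    · exact hK
    · exact isC2H_supp_ball
  set X : Fin n → En n →L[ℝ] En n := fun k => hessOp (supp (famB i K k)) u with hX
  have hXp : ∀ k, Perp u (X k) := fun k => perp_hessOp (hfam k) hu0
  have hN : ∀ S : Finset (Fin n), hessOp (supp (∑ k ∈ S, famB i K k)) u = ∑ k ∈ S, X k := by
    intro S
    rw [← hessOp_sum S (fun k _ => hfam k) hu0]
    congr 1
    ext x
    exact supp_sum S _ x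
  set E := hessOp (fun x => supp K x - ‖x‖) u with hE
  have hEp : Perp u E := perp_hessOp (isC2H_sub_norm hK) hu0
  have hXk : ∀ k, X k = (1 - rk u u) + (if (k : ℕ) ≤ i then E else 0) := by
    intro k
    simp only [hX, famB]
    split_ifs
    · rw [hE, hK.hessOp_sub IsC2H.norm hu0, hessOp_norm hu]; abel
    · rw [add_zero, ← hessOp_norm hu]
      congr 1
      ext x
      exact supp_ballB x
  have hsumX : ∀ S : Finset (Fin n), ∑ k ∈ S, X k = (S.card : ℝ) • (1 - rk u u) +
      ((S.filter fun k : Fin n => (k : ℕ) ≤ i).card : ℝ) • E := by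
    intro S
    simp only [hXk, Finset.sum_add_distrib, Finset.sum_const, ← Finset.sum_filter]
    simp only [Nat.cast_smul_eq_nsmul]
  have hsgn : ∀ S ∈ (Finset.univ.erase z).powerset,
      (-1 : ℝ) ^ (n - 1 - S.card) = (-1) ^ (n - 1) * (-1) ^ S.card := by
    intro S hS
    have := card_le_of_mem hS
    rw [← pow_add, show n - 1 + S.card = (n - 1 - S.card) + 2 * S.card by omega, pow_add, pow_mul]
    simp
  have h1 := alternating_det hu0 z (fun k => (hXp k).smul c) hB
  calc _ = (-1) ^ (n - 1) * ∑ S ∈ (Finset.univ.erase z).powerset,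
        (-1 : ℝ) ^ S.card * (rk u u + (B + ∑ k ∈ S, c • X k)).det := by
        rw [Finset.mul_sum]
        refine Finset.sum_congr rfl fun S hS => ?_
        rw [hsgn S hS, hN, Finset.smul_sum, mul_assoc]
    _ = (-1) ^ (n - 1) * ∑ S ∈ (Finset.univ.erase z).powerset,
        (-1 : ℝ) ^ S.card * (rk u u + ∑ k ∈ S, c • X k).det := by rw [h1]
    _ = _ := by
        rw [areaDens, phi, ← mul_assoc (((n - 1).factorial : ℝ)), mul_inv_cancel₀ (by positivity),
          one_mul, Finset.mul_sum, Finset.mul_sum]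
        refine Finset.sum_congr rfl fun S hS => ?_
        rw [← Finset.smul_sum, det_rk_add_smul hu (Perp.sum S fun k _ => hXp k) (by omega) hc,
          hsumX, det_rk_add_proj hu hn hEp, hsgn S hS]
        · ring
        · intro h
          have : S = ∅ := by simpa using h
          simp [this]

theorem volSum_eq_integral_of_smooth (hn : 2 ≤ n) (z : Fin n) {i : ℕ} {K M : ConvexBody (En n)}
    (hK : IsC2H (supp K)) (hM : IsC2H (supp M)) (hpos : ∀ x, x ≠ 0 → 0 < supp M x)
    (hpd : ∀ u, u ≠ 0 → ∀ w, w ≠ 0 → ⟪u, w⟫_ℝ = 0 → 0 < D2 (supp M) u w w) :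
    volSum z (famB i K) M =
      (n - 1).factorial * ∫ v : Sph n, supp M v * areaDens z i K v ∂(sphVol n) := by
  classical
  have hfam : ∀ k, IsC2H (supp (famB i K k)) := by
    intro k
    unfold famB
    split_ifs
    · exact hK
    · exact isC2H_supp_ball
  have hNS : ∀ S : Finset (Fin n), IsC2H (supp (∑ k ∈ S, famB i K k)) := by
    intro S
    have h1 := IsC2H.sum S (fun k _ => hfam k)
    have h2 : supp (∑ k ∈ S, famB i K k) = fun x => ∑ k ∈ S, supp (famB i K k) x := by
      ext x; exact supp_sum S _ x
    rw [h2]; exact h1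
  have hsh := fun S : Finset (Fin n) => volume_shell (by omega) (hNS S) hM hpos hpd
  set D : Set (En n) := closedBall 0 1 \ {0} with hD
  have hDm : MeasurableSet D := measurableSet_closedBall.diff (measurableSet_singleton 0)
  have h1 : volSum z (famB i K) M = ∫ x in D, ∑ S ∈ (Finset.univ.erase z).powerset,
      (-1 : ℝ) ^ (n - 1 - S.card) * shellDens (∑ k ∈ S, famB i K k) M x := by
    rw [integral_finsetSum _ fun S _ => (hsh S).1.const_mul _, volSum]
    refine Finset.sum_congr rfl fun S _ => ?_
    rw [integral_const_mul, (hsh S).2, add_comm M]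
  set a : En n → ℝ := fun u => (n - 1).factorial * (supp M u * areaDens z i K u) with ha
  set ψ : ℝ → ℝ := (Set.Ioc (0 : ℝ) 1).indicator fun r => (r⁻¹) ^ (n - 1) with hψ
  have h2 : ∫ x in D, ∑ S ∈ (Finset.univ.erase z).powerset,
      (-1 : ℝ) ^ (n - 1 - S.card) * shellDens (∑ k ∈ S, famB i K k) M x =
      ∫ x, ψ ‖x‖ * a (‖x‖⁻¹ • x) := by
    rw [← integral_indicator hDm]
    congr 1
    ext x
    by_cases hx : x ∈ D
    · obtain ⟨hx1, hx0⟩ := hx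
      have hx0 : x ≠ 0 := hx0
      have hx' : 0 < ‖x‖ := norm_pos_iff.2 hx0
      have hu : ‖‖x‖⁻¹ • x‖ = 1 := by rw [norm_smul, norm_inv, norm_norm, inv_mul_cancel₀ hx'.ne']
      have hmem : ‖x‖ ∈ Set.Ioc (0 : ℝ) 1 := ⟨hx', by simpa using hx1⟩
      rw [Set.indicator_of_mem (show x ∈ D from ⟨hx1, hx0⟩), hψ, Set.indicator_of_mem hmem, ha]
      have h3 := sum_det_eq_phi hn z (i := i) hK hu (perp_hessOp hM (ne_zero_of_norm_eq_one hu))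
        (inv_pos.2 hx').ne'
      simp only [shellDens]
      rw [show ∀ a b c d : ℝ, a * (b * (c * d)) = c * (a * (b * d)) by intros; ring, ← h3,
        Finset.mul_sum]
      refine Finset.sum_congr rfl fun S _ => ?_
      ring
    · rw [Set.indicator_of_notMem hx, hψ, Set.indicator_of_notMem, zero_mul]
      intro h
      exact hx ⟨by simpa using h.2, by rintro rfl; simp at h⟩
  have h4 : ∫ r in Set.Ioi (0 : ℝ), r ^ (n - 1) * ψ r = 1 := by
    have : ∀ r ∈ Set.Ioi (0 : ℝ), r ^ (n - 1) * ψ r = (Set.Ioc (0 : ℝ) 1).indicator 1 r := by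
      intro r hr
      have hr : 0 < r := hr
      by_cases h : r ∈ Set.Ioc (0 : ℝ) 1
      · rw [hψ, Set.indicator_of_mem h, Set.indicator_of_mem h, inv_pow,
          mul_inv_cancel₀ (by positivity), Pi.one_apply]
      · rw [hψ, Set.indicator_of_notMem h, Set.indicator_of_notMem h, mul_zero]
    have hs : Set.Ioc (0 : ℝ) 1 ⊆ Set.Ioi 0 := fun x hx => hx.1
    rw [setIntegral_congr_fun measurableSet_Ioi this, integral_indicator measurableSet_Ioc,
      Measure.restrict_restrict measurableSet_Ioc,
      Set.inter_eq_left.2 hs]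
    simp
  rw [h1, h2, integral_polar (by omega), h4, one_mul, ha, integral_const_mul]

/-! ### Smooth approximation of convex bodies -/

section SmoothMax

theorem sqrt_add_sq_le (a b c d : ℝ) :
    √((a + b) ^ 2 + (c + d) ^ 2) ≤ √(a ^ 2 + c ^ 2) + √(b ^ 2 + d ^ 2) := by
  have h : ∀ x y : ℝ, √(x ^ 2 + y ^ 2) = ‖(⟨x, y⟩ : ℂ)‖ := by
    intro x y
    rw [Complex.norm_def, Complex.normSq_mk, sq, sq]
  rw [h, h, h]
  exact norm_add_le (⟨a, c⟩ : ℂ) ⟨b, d⟩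

/-- A smooth sublinear majorant of the maximum of a linear form and a sublinear function. -/
theorem exists_smooth_max {f : En n → ℝ} (hf : IsC2H f) (hs : ∀ x y, f (x + y) ≤ f x + f y)
    (l : En n →L[ℝ] ℝ) {ε : ℝ} (hε : 0 < ε) :
    ∃ F : En n → ℝ, IsC2H F ∧ (∀ x y, F (x + y) ≤ F x + F y) ∧ (∀ x, l x ≤ F x) ∧
      (∀ x, f x ≤ F x) ∧ ∀ x T, l x ≤ T → f x ≤ T → F x ≤ T + ε * ‖x‖ := by
  refine ⟨fun x => (l x + f x + √((l x - f x) ^ 2 + (ε * ‖x‖) ^ 2)) / 2, ⟨?_, ?_⟩, ?_, ?_, ?_, ?_⟩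
  · have h1 : ContDiffOn ℝ 2 (fun x => (l x - f x) ^ 2 + (ε * ‖x‖) ^ 2) {0}ᶜ :=
      ((l.contDiff.contDiffOn.sub hf.contDiffOn).pow 2).add
        ((contDiffOn_const.mul IsC2H.norm.contDiffOn).pow 2)
    refine ((l.contDiff.contDiffOn.add hf.contDiffOn).add (h1.sqrt fun x hx => ?_)).div_const 2
    have hx : x ≠ 0 := hx
    have := norm_pos_iff.2 hx
    positivity
  · intro c hc x
    simp only [map_smul, smul_eq_mul, hf.map_smul c hc, norm_smul, Real.norm_of_nonneg hc]
    rw [show (c * l x - c * f x) ^ 2 + (ε * (c * ‖x‖)) ^ 2 =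
      c ^ 2 * ((l x - f x) ^ 2 + (ε * ‖x‖) ^ 2) by ring, Real.sqrt_mul (sq_nonneg c),
      Real.sqrt_sq hc]
    ring
  · intro x y
    have h1 := hs x y
    have h2 := sqrt_add_sq_le (l x - f x) (l y - f y) (ε * ‖x‖) (ε * ‖y‖)
    have h3 := sqrt_add_sq_le (l x - f x + (l y - f y)) (f x + f y - f (x + y))
      (ε * ‖x‖ + ε * ‖y‖) 0
    have h4 : √((f x + f y - f (x + y)) ^ 2 + 0 ^ 2) = f x + f y - f (x + y) := by
      rw [zero_pow two_ne_zero, add_zero, Real.sqrt_sq (by linarith)]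
    have h5 : √((l (x + y) - f (x + y)) ^ 2 + (ε * ‖x + y‖) ^ 2) ≤
        √((l x - f x + (l y - f y) + (f x + f y - f (x + y))) ^ 2 +
          (ε * ‖x‖ + ε * ‖y‖ + 0) ^ 2) := by
      apply Real.sqrt_le_sqrt
      have h6 : ε * ‖x + y‖ ≤ ε * ‖x‖ + ε * ‖y‖ + 0 := by
        have := mul_le_mul_of_nonneg_left (norm_add_le x y) hε.le
        linarith
      have h7 := pow_le_pow_left₀ (by positivity) h6 2
      have h8 : l (x + y) - f (x + y) = l x - f x + (l y - f y) + (f x + f y - f (x + y)) := by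
        rw [map_add]; ring
      rw [h8]
      linarith
    rw [h4] at h3
    have h9 := map_add l x y
    linarith
  · intro x
    have : l x - f x ≤ √((l x - f x) ^ 2 + (ε * ‖x‖) ^ 2) :=
      Real.le_sqrt_of_sq_le (by nlinarith [sq_nonneg (ε * ‖x‖)])
    linarith
  · intro x
    have : f x - l x ≤ √((l x - f x) ^ 2 + (ε * ‖x‖) ^ 2) :=
      Real.le_sqrt_of_sq_le (by nlinarith [sq_nonneg (ε * ‖x‖)])
    linarith
  · intro x T h1 h2
    have h3 := sqrt_add_sq_le (l x - f x) 0 0 (ε * ‖x‖)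
    have h4 : 0 ≤ ε * ‖x‖ := by positivity
    rw [add_zero, zero_add, zero_pow two_ne_zero, add_zero, zero_add, Real.sqrt_sq h4,
      Real.sqrt_sq_eq_abs] at h3
    rcases abs_cases (l x - f x) with ⟨h, -⟩ | ⟨h, -⟩ <;> linarith

theorem exists_smooth_max_finset (L : ConvexBody (En n)) (s : Finset (En n))
    (hs : ∀ y ∈ s, y ∈ L) : ∀ ε : ℝ, 0 < ε → ∃ F : En n → ℝ, IsC2H F ∧
      (∀ x y, F (x + y) ≤ F x + F y) ∧ (∀ y ∈ s, ∀ x, ⟪x, y⟫_ℝ ≤ F x) ∧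
      ∀ x, F x ≤ supp L x + ε * ‖x‖ := by
  classical
  induction s using Finset.induction_on with
  | empty =>
    intro ε hε
    obtain ⟨y, hy⟩ := L.nonempty
    refine ⟨fun x => innerSL ℝ y x, IsC2H.clm _, fun a b => (map_add _ a b).le, by simp, fun x => ?_⟩
    have h1 := inner_le_supp L x hy
    rw [real_inner_comm] at h1
    simp only [innerSL_apply_apply]
    have : 0 ≤ ε * ‖x‖ := by positivity
    linarith
  | insert a s ha ih =>
    intro ε hε
    obtain ⟨f, hf, hfs, hfy, hfL⟩ := ih (fun y hy => hs y (Finset.mem_insert_of_mem hy)) (ε / 2)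
      (by positivity)
    obtain ⟨F, hF, hFs, hlF, hfF, hFT⟩ := exists_smooth_max hf hfs (innerSL ℝ a) (half_pos hε)
    refine ⟨F, hF, hFs, fun y hy x => ?_, fun x => ?_⟩
    · rcases Finset.mem_insert.1 hy with rfl | hy
      · have := hlF x
        rwa [innerSL_apply_apply, real_inner_comm] at this
      · exact (hfy y hy x).trans (hfF x)
    · have h1 := inner_le_supp L x (hs a (Finset.mem_insert_self a s))
      have h2 : 0 ≤ ε / 2 * ‖x‖ := by positivity
      have := hFT x (supp L x + ε / 2 * ‖x‖)
        (by rw [innerSL_apply_apply, real_inner_comm]; linarith) (hfL x)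
      linarith

/-- Approximation of a convex body containing the origin by smooth ones from outside. -/
theorem exists_smooth_approx (hn : 0 < n) (L : ConvexBody (En n)) (h0 : (0 : En n) ∈ L) {δ : ℝ}
    (hδ : 0 < δ) : ∃ M : ConvexBody (En n), IsC2H (supp M) ∧ (∀ x, x ≠ 0 → 0 < supp M x) ∧
      (∀ u, u ≠ 0 → ∀ w, w ≠ 0 → ⟪u, w⟫_ℝ = 0 → 0 < D2 (supp M) u w w) ∧
      (∀ x, supp L x ≤ supp M x) ∧ ∀ x, supp M x ≤ supp L x + δ * ‖x‖ := by
  obtain ⟨t, htL, htf, htc⟩ := L.isCompact.finite_cover_balls (show 0 < δ / 4 by positivity)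
  obtain ⟨F, hF, hFs, hFy, hFL⟩ := exists_smooth_max_finset L htf.toFinset
    (fun y hy => htL (by simpa using hy)) (δ / 4) (by positivity)
  have hG : IsC2H fun x => F x + δ / 2 * ‖x‖ := hF.add (IsC2H.norm.const_mul _)
  obtain ⟨M, hM⟩ := exists_body hn hG fun x y => by
    have h1 := hFs x y
    have h2 := mul_le_mul_of_nonneg_left (norm_add_le x y) (show 0 ≤ δ / 2 by positivity)
    linarith
  have hlow : ∀ x, supp L x ≤ F x + δ / 4 * ‖x‖ := by
    intro x
    refine supp_le fun y hy => ?_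
    obtain ⟨z, hz, hyz⟩ := Set.mem_iUnion₂.1 (htc hy)
    have h1 := hFy z (by simpa using hz) x
    have h2 : ⟪x, y - z⟫_ℝ ≤ ‖x‖ * ‖y - z‖ := real_inner_le_norm _ _
    rw [mem_ball_iff_norm] at hyz
    have h3 := mul_le_mul_of_nonneg_left hyz.le (norm_nonneg x)
    rw [inner_sub_right] at h2
    linarith
  rw [← hM] at hG
  have hMx : ∀ x, supp M x = F x + δ / 2 * ‖x‖ := fun x => congrFun hM x
  refine ⟨M, hG, fun x hx => ?_, fun u hu w hw huw => ?_, fun x => ?_, fun x => ?_⟩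
  · have h1 := inner_le_supp L x h0
    rw [inner_zero_right] at h1
    have h2 := hlow x
    have : 0 < δ / 4 * ‖x‖ := mul_pos (by positivity) (norm_pos_iff.2 hx)
    rw [hMx]
    linarith
  · rw [hM, hF.D2_add (IsC2H.norm.const_mul _) hu, IsC2H.norm.D2_const_mul _ hu]
    simp only [add_apply, smul_apply, smul_eq_mul]
    have h1 := hF.D2_nonneg hFs hu w
    rw [D2_norm hu, huw, real_inner_self_eq_norm_sq]
    have := norm_pos_iff.2 hw
    have := norm_pos_iff.2 hu
    simp only [mul_zero, sub_zero]
    positivity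
  · have h2 := hlow x
    have : 0 ≤ δ / 4 * ‖x‖ := by positivity
    rw [hMx]
    linarith
  · have := hFL x
    rw [hMx]
    have : 0 ≤ δ / 4 * ‖x‖ := by positivity
    linarith

end SmoothMax

/-! ### Densities of area measures -/

section AreaMeasure

variable {z : Fin n} {i : ℕ} {K : ConvexBody (En n)}

theorem volSum_translate (Ks : Fin n → ConvexBody (En n)) (L : ConvexBody (En n)) (v : En n) :
    volSum z Ks (translate L v) = volSum z Ks L := by
  refine Finset.sum_congr rfl fun S _ => ?_
  congr 3
  have h1 : translate L v + ∑ k ∈ S, Ks k = translate (L + ∑ k ∈ S, Ks k) v :=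
    body_ext fun u _ => by
      rw [supp_add, supp_translate, supp_translate, supp_add]; ring
  rw [h1]
  have h2 : ((translate (L + ∑ k ∈ S, Ks k) v : ConvexBody (En n)) : Set (En n)) =
      (fun y => v + y) '' ((L + ∑ k ∈ S, Ks k : ConvexBody (En n)) : Set (En n)) := rfl
  rw [h2, Set.image_add_left, measure_preimage_add]

theorem tendsto_volSum (Ks : Fin n → ConvexBody (En n)) (L : ConvexBody (En n))
    {M : ℕ → ConvexBody (En n)} {δ : ℕ → ℝ} (hδ0 : ∀ j, 0 ≤ δ j) (hδ : Tendsto δ atTop (𝓝 0))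
    (hl : ∀ j x, supp L x ≤ supp (M j) x) (hr : ∀ j x, supp (M j) x ≤ supp L x + δ j * ‖x‖) :
    Tendsto (fun j => volSum z Ks (M j)) atTop (𝓝 (volSum z Ks L)) := by
  refine tendsto_finsetSum _ fun S _ => (Tendsto.sub_const ?_ _).const_mul _
  refine (ENNReal.tendsto_toReal (ConvexBody.isCompact _).measure_lt_top.ne).comp ?_
  set N := ∑ k ∈ S, Ks k
  have hup := (tendsto_measure_cthickening_of_isCompact (μ := volume) (L + N).isCompact).comp hδ
  refine tendsto_of_tendsto_of_tendsto_of_le_of_le tendsto_const_nhds hup (fun j => ?_) fun j => ?_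
  · refine measure_mono (subset_of_supp_le fun x => ?_)
    rw [supp_add, supp_add]
    linarith [hl j x]
  · refine measure_mono ?_
    have h1 : ((M j : ConvexBody (En n)) : Set (En n)) ⊆ (L + scale (δ j) (ballB n) :
        ConvexBody (En n)) := subset_of_supp_le fun x => by
      rw [supp_add, supp_scale (hδ0 j), supp_ballB]
      exact hr j x
    rintro _ ⟨m, hm, y, hy, rfl⟩
    obtain ⟨l, hl, _, ⟨b, hb, rfl⟩, rfl⟩ := h1 hm
    refine mem_cthickening_of_dist_le _ (l + y) _ _ (Set.add_mem_add hl hy) ?_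
    have hb : ‖b‖ ≤ 1 := by
      have : b ∈ closedBall (0 : En n) 1 := hb
      simpa using this
    rw [dist_eq_norm, show (fun x => x) l + δ j • b + y - (l + y) = δ j • b by simp only []; abel,
      norm_smul, Real.norm_of_nonneg (hδ0 j)]
    exact mul_le_of_le_one_right (hδ0 j) hb

theorem tendsto_integral_supp {s : Sph n → ℝ} (hs : Continuous s) (L : ConvexBody (En n))
    {M : ℕ → ConvexBody (En n)} {δ : ℕ → ℝ} (hδ : Tendsto δ atTop (𝓝 0))
    (hl : ∀ j x, supp L x ≤ supp (M j) x) (hr : ∀ j x, supp (M j) x ≤ supp L x + δ j * ‖x‖) :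
    Tendsto (fun j => ∫ v : Sph n, supp (M j) v * s v ∂(sphVol n)) atTop
      (𝓝 (∫ v : Sph n, supp L v * s v ∂(sphVol n))) := by
  have hintg : ∀ Q : ConvexBody (En n), Integrable (fun v : Sph n => supp Q v * s v) (sphVol n) :=
    fun Q => integrable_sph (((continuous_supp Q).comp continuous_subtype_val).mul hs)
  rw [tendsto_iff_norm_sub_tendsto_zero]
  have hb : Tendsto (fun j => δ j * ∫ v : Sph n, |s v| ∂(sphVol n)) atTop (𝓝 0) := by
    simpa using hδ.mul_const (∫ v : Sph n, |s v| ∂(sphVol n))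
  refine squeeze_zero (fun j => norm_nonneg _) (fun j => ?_) hb
  rw [← integral_sub (hintg _) (hintg _), ← integral_const_mul]
  refine norm_integral_le_of_norm_le ((integrable_sph hs.abs).const_mul _)
    (Eventually.of_forall fun v => ?_)
  rw [← sub_mul, norm_mul, Real.norm_eq_abs, Real.norm_eq_abs]
  refine mul_le_mul_of_nonneg_right ?_ (abs_nonneg _)
  have h1 := hl j v
  have h2 := hr j v
  rw [norm_sph] at h2
  rw [abs_le]
  constructor <;> linarith

theorem volSum_eq_integral_of_zero_mem (hn : 2 ≤ n) (hK : IsC2H (supp K)) (L : ConvexBody (En n))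
    (h0 : (0 : En n) ∈ L) : volSum z (famB i K) L =
      (n - 1).factorial * ∫ v : Sph n, supp L v * areaDens z i K v ∂(sphVol n) := by
  have hpos : ∀ j : ℕ, (0 : ℝ) < 1 / ((j : ℝ) + 1) := fun j => by positivity
  choose M hM hMp hMd hl hr using fun j : ℕ =>
    exists_smooth_approx (by omega) L h0 (hpos j)
  have h1 := tendsto_volSum (z := z) (famB i K) L (fun j => (hpos j).le)
    tendsto_one_div_add_atTop_nhds_zero_nat hl hr
  have h2 := (tendsto_integral_supp (continuous_areaDens (z := z) (i := i) hK) L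
    tendsto_one_div_add_atTop_nhds_zero_nat hl hr).const_mul
      ((n - 1).factorial : ℝ)
  refine tendsto_nhds_unique h1 (h2.congr fun j => ?_)
  rw [volSum_eq_integral_of_smooth hn z hK (hM j) (hMp j) (hMd j)]

theorem integral_inner_mul_areaDens (hn : 2 ≤ n) (hK : IsC2H (supp K)) (x : En n) :
    ∫ v : Sph n, ⟪(v : En n), x⟫_ℝ * areaDens z i K v ∂(sphVol n) = 0 := by
  set B := scale (‖x‖) (ballB n) with hB
  have hm : ∀ y : En n, ‖y‖ ≤ ‖x‖ → y ∈ B := fun y hy => mem_of_forall_inner_le_supp fun w => by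
    rw [supp_scale (norm_nonneg _), supp_ballB]
    refine (real_inner_le_norm _ _).trans ?_
    rw [mul_comm]
    exact mul_le_mul_of_nonneg_right hy (norm_nonneg _)
  have h0 : (0 : En n) ∈ B := hm 0 (by simp)
  have h1 : (0 : En n) ∈ translate B x := ⟨-x, hm _ (by simp), by simp⟩
  have h2 := volSum_eq_integral_of_zero_mem (z := z) (i := i) hn hK _ h0
  have h3 := volSum_eq_integral_of_zero_mem (z := z) (i := i) hn hK _ h1
  rw [volSum_translate, h2] at h3
  have h4 := mul_left_cancel₀ (by positivity) h3
  simp only [supp_translate, add_mul] at h4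
  have hc := continuous_areaDens (z := z) (i := i) hK
  rw [integral_add] at h4
  · linarith
  · exact integrable_sph ((continuous_subtype_val.inner continuous_const).mul hc)
  · exact integrable_sph (((continuous_supp B).comp continuous_subtype_val).mul hc)

theorem volSum_eq_integral (hn : 2 ≤ n) (hK : IsC2H (supp K)) (L : ConvexBody (En n)) :
    volSum z (famB i K) L =
      (n - 1).factorial * ∫ v : Sph n, supp L v * areaDens z i K v ∂(sphVol n) := by
  obtain ⟨y, hy⟩ := L.nonempty
  have h0 : (0 : En n) ∈ translate L (-y) := ⟨y, hy, by simp⟩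
  have h1 := volSum_eq_integral_of_zero_mem (z := z) (i := i) hn hK _ h0
  rw [volSum_translate] at h1
  rw [h1]
  congr 1
  have hc := continuous_areaDens (z := z) (i := i) hK
  simp only [supp_translate, add_mul]
  rw [integral_add, integral_inner_mul_areaDens hn hK, zero_add]
  · exact integrable_sph ((continuous_subtype_val.inner continuous_const).mul hc)
  · exact integrable_sph (((continuous_supp L).comp continuous_subtype_val).mul hc)

theorem isAreaMeasure_areaDens (hn : 2 ≤ n) (hK : IsC2H (supp K))
    (hs : ∀ u : Sph n, 0 ≤ areaDens (⟨0, by omega⟩ : Fin n) i K u) :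
    IsAreaMeasure i K ((sphVol n).withDensity fun u : Sph n =>
      ENNReal.ofReal (areaDens (⟨0, by omega⟩ : Fin n) i K u)) := by
  intro L
  rw [mixedVol_eq_volSum (by omega) i K L, volSum_eq_integral hn hK, ← mul_assoc,
    inv_mul_cancel₀ (by positivity), one_mul, integral_withDensity_eq_integral_toReal_smul]
  · refine integral_congr_ae (Eventually.of_forall fun v => ?_)
    simp only [ENNReal.toReal_ofReal (hs v), smul_eq_mul, mul_comm]
  · exact (continuous_areaDens hK).measurable.ennreal_ofReal
  · exact Eventually.of_forall fun v => ENNReal.ofReal_lt_top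

end AreaMeasure

/-! ### Isometries and zonal functions -/

theorem exists_isom {u v : En n} (h : ‖u‖ = ‖v‖) :
    ∃ ρ : En n ≃ₗᵢ[ℝ] En n, ρ u = v ∧ ∀ e, ⟪e, u⟫_ℝ = ⟪e, v⟫_ℝ → ρ e = e := by
  refine ⟨(ℝ ∙ (u - v))ᗮ.reflection, Submodule.reflection_sub h, fun e he => ?_⟩
  rw [Submodule.reflection_eq_self_iff, Submodule.mem_orthogonal_singleton_iff_inner_left,
    inner_sub_right, he, sub_self]

/-- The action of a linear isometry on the sphere. -/
def sphMap (ρ : En n ≃ₗᵢ[ℝ] En n) : C(Sph n, Sph n) :=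
  ⟨fun v => ⟨ρ v, by simp⟩, by fun_prop⟩

@[simp] theorem coe_sphMap (ρ : En n ≃ₗᵢ[ℝ] En n) (v : Sph n) : (sphMap ρ v : En n) = ρ v := rfl

theorem integral_sphMap (hn : 0 < n) (ρ : En n ≃ₗᵢ[ℝ] En n) (f : Sph n → ℝ) :
    ∫ v, f (sphMap ρ v) ∂(sphVol n) = ∫ v, f v ∂(sphVol n) := by
  classical
  obtain ⟨a, ha⟩ : ∃ a : En n → ℝ, ∀ v : Sph n, a v = f v :=
    ⟨fun x => if h : x ∈ Metric.sphere (0 : En n) 1 then f ⟨x, h⟩ else 0, fun v => by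
      simp only [v.2, dif_pos]⟩
  have h1 := integral_polar hn (fun r => Real.exp (-r)) a
  have h2 := integral_polar hn (fun r => Real.exp (-r)) (fun x => a (ρ x))
  have h3 : ∫ x : En n, Real.exp (-‖x‖) * a (ρ (‖x‖⁻¹ • x)) =
      ∫ x : En n, Real.exp (-‖x‖) * a (‖x‖⁻¹ • x) := by
    have := ρ.measurePreserving.integral_comp ρ.toHomeomorph.measurableEmbedding
      fun x => Real.exp (-‖x‖) * a (‖x‖⁻¹ • x)
    simpa using this
  have h4 : (∫ r in Set.Ioi (0 : ℝ), r ^ (n - 1) * Real.exp (-r)) ≠ 0 := by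
    have h := Real.Gamma_eq_integral (s := n) (by exact_mod_cast hn)
    have h' : (∫ r in Set.Ioi (0 : ℝ), r ^ (n - 1) * Real.exp (-r)) = Real.Gamma n := by
      rw [h]
      refine setIntegral_congr_fun measurableSet_Ioi fun r _ => ?_
      rw [mul_comm, ← Real.rpow_natCast, Nat.cast_sub (by omega), Nat.cast_one]
    rw [h']
    exact (Real.Gamma_pos_of_pos (by exact_mod_cast hn)).ne'
  rw [h1, h2] at h3
  have h5 := mul_left_cancel₀ h4 h3
  simpa [← ha] using h5

/-- The 1-homogeneous zonal function with axis `v` and profile `κ`. -/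
def zon (κ : ℝ → ℝ) (v x : En n) : ℝ := ‖x‖ * κ ⟪‖x‖⁻¹ • x, v⟫_ℝ

theorem zon_isom (κ : ℝ → ℝ) (ρ : En n ≃ₗᵢ[ℝ] En n) (v x : En n) :
    zon κ (ρ v) (ρ x) = zon κ v x := by
  simp only [zon, ρ.norm_map, ← map_smul, ρ.inner_map_map]

theorem zon_unit (κ : ℝ → ℝ) (v : En n) {u : En n} (hu : ‖u‖ = 1) : zon κ v u = κ ⟪u, v⟫_ℝ := by
  simp [zon, hu]

theorem continuous_zon_left {κ : ℝ → ℝ} (hκ : Continuous κ) (x : En n) :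
    Continuous fun v : En n => zon κ v x := by
  unfold zon; fun_prop

theorem hasFDerivAt_comp_isom {F : En n → ℝ} (hF : IsC2H F) (ρ : En n ≃ₗᵢ[ℝ] En n) {x : En n}
    (hx : x ≠ 0) : HasFDerivAt (fun y => F (ρ y))
      ((fderiv ℝ F (ρ x)).comp (ρ : En n →L[ℝ] En n)) x := by
  have hρ : ρ x ≠ 0 := by simpa using hx
  exact (hF.hasFDerivAt hρ).comp x (ρ : En n →L[ℝ] En n).hasFDerivAt

theorem IsC2H.comp_isom {F : En n → ℝ} (hF : IsC2H F) (ρ : En n ≃ₗᵢ[ℝ] En n) :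
    IsC2H fun y => F (ρ y) where
  contDiffOn := hF.contDiffOn.comp ρ.contDiff.contDiffOn fun x hx => by simpa using hx
  map_smul c hc x := by simpa using hF.map_smul c hc (ρ x)

theorem D2_comp_isom {F : En n → ℝ} (hF : IsC2H F) (ρ : En n ≃ₗᵢ[ℝ] En n) {x : En n}
    (hx : x ≠ 0) (v w : En n) : D2 (fun y => F (ρ y)) x v w = D2 F (ρ x) (ρ v) (ρ w) := by
  have hρ : ρ x ≠ 0 := by simpa using hx
  set l : En n →L[ℝ] En n := (ρ : En n →L[ℝ] En n)
  have h1 : ∀ᶠ y in 𝓝 x, HasFDerivAt (fun y => F (ρ y)) ((fderiv ℝ F (ρ y)).comp l) y :=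
    (eventually_ne_nhds hx).mono fun y hy => hasFDerivAt_comp_isom hF ρ hy
  have h2 : HasFDerivAt (fun y => (fderiv ℝ F (ρ y)).comp l)
      (((ContinuousLinearMap.compL ℝ (En n) (En n) ℝ).flip l).comp ((D2 F (ρ x)).comp l)) x :=
    ((ContinuousLinearMap.compL ℝ (En n) (En n) ℝ).flip l).hasFDerivAt.comp x
      ((hF.hasFDerivAt_fderiv hρ).comp x l.hasFDerivAt)
  rw [D2_of_hasFDerivAt h1 h2]
  rfl

theorem lap_comp_isom {F : En n → ℝ} (hF : IsC2H F) (ρ : En n ≃ₗᵢ[ℝ] En n) {x : En n}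
    (hx : x ≠ 0) : lap (fun y => F (ρ y)) x = lap F (ρ x) := by
  rw [lap_eq_sum (EuclideanSpace.basisFun (Fin n) ℝ),
    lap_eq_sum ((EuclideanSpace.basisFun (Fin n) ℝ).map ρ)]
  exact Finset.sum_congr rfl fun j _ => by rw [D2_comp_isom hF ρ hx]; rfl

theorem norm_fderiv_comp_isom_le {F : En n → ℝ} (hF : IsC2H F) (ρ : En n ≃ₗᵢ[ℝ] En n) {x : En n}
    (hx : x ≠ 0) : ‖fderiv ℝ (fun y => F (ρ y)) x‖ ≤ ‖fderiv ℝ F (ρ x)‖ := by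
  rw [(hasFDerivAt_comp_isom hF ρ hx).fderiv]
  refine ContinuousLinearMap.opNorm_le_bound _ (norm_nonneg _) fun w => ?_
  simpa using (fderiv ℝ F (ρ x)).le_opNorm (ρ w)

theorem norm_D2_comp_isom_le {F : En n → ℝ} (hF : IsC2H F) (ρ : En n ≃ₗᵢ[ℝ] En n) {x : En n}
    (hx : x ≠ 0) : ‖D2 (fun y => F (ρ y)) x‖ ≤ ‖D2 F (ρ x)‖ := by
  refine ContinuousLinearMap.opNorm_le_bound₂ _ (norm_nonneg _) fun v w => ?_
  rw [D2_comp_isom hF ρ hx]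
  simpa using (D2 F (ρ x)).le_opNorm₂ (ρ v) (ρ w)

/-! ### Integrals of families of homogeneous functions -/

theorem aestronglyMeasurable_fderiv {V W : Type*} [MeasurableSpace V] {μ : Measure V}
    [NormedAddCommGroup W] [NormedSpace ℝ W] {F : V → En n → W} {x : En n}
    (hm : ∀ᶠ y in 𝓝 x, AEStronglyMeasurable (fun v => F v y) μ)
    (hd : ∀ v, DifferentiableAt ℝ (F v) x) :
    AEStronglyMeasurable (fun v => fderiv ℝ (F v) x) μ := by
  set b := EuclideanSpace.basisFun (Fin n) ℝ
  have h1 : ∀ w, AEStronglyMeasurable (fun v => fderiv ℝ (F v) x w) μ := by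
    intro w
    have ht : Tendsto (fun k : ℕ => x + ((k : ℝ) + 1)⁻¹ • w) atTop (𝓝 x) := by
      have : Tendsto (fun k : ℕ => ((k : ℝ) + 1)⁻¹) atTop (𝓝 0) := by
        simpa using tendsto_one_div_add_atTop_nhds_zero_nat (𝕜 := ℝ)
      simpa using (this.smul_const w).const_add x
    obtain ⟨k0, hk0⟩ := eventually_atTop.1 (ht.eventually hm)
    refine aestronglyMeasurable_of_tendsto_ae atTop
      (f := fun (k : ℕ) v => (((k + k0 : ℕ) : ℝ) + 1) •
        (F v (x + (((k + k0 : ℕ) : ℝ) + 1)⁻¹ • w) - F v x)) (fun k => ?_) ?_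
    · exact ((hk0 (k + k0) (by omega)).sub hm.self_of_nhds).const_smul _
    · refine Eventually.of_forall fun v => ?_
      have hl := (hd v).hasFDerivAt.hasLineDerivAt w
      have hl' : HasDerivAt (fun t : ℝ => F v (x + t • w)) (fderiv ℝ (F v) x w) 0 := hl
      have hs := hl'.tendsto_slope_zero
      have ht' : Tendsto (fun k : ℕ => (((k + k0 : ℕ) : ℝ) + 1)⁻¹) atTop (𝓝[≠] 0) := by
        refine tendsto_nhdsWithin_iff.2 ⟨?_, Eventually.of_forall fun k => ?_⟩
        · have : Tendsto (fun k : ℕ => ((k : ℝ) + 1)⁻¹) atTop (𝓝 0) := by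
            simpa using tendsto_one_div_add_atTop_nhds_zero_nat (𝕜 := ℝ)
          exact this.comp (tendsto_add_atTop_nat k0)
        · have : (0 : ℝ) < ((k + k0 : ℕ) : ℝ) + 1 := by positivity
          simpa using this.ne'
      have := hs.comp ht'
      simpa [Function.comp_def] using this
  have h2 : (fun v => fderiv ℝ (F v) x) = fun v => ∑ j,
      ContinuousLinearMap.smulRightL ℝ (En n) W (innerSL ℝ (b j)) (fderiv ℝ (F v) x (b j)) := by
    funext v
    ext w
    rw [sum_apply]
    conv_lhs => rw [← b.sum_repr' w]
    simp [map_sum]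
  rw [h2]
  exact Finset.aestronglyMeasurable_fun_sum _ fun j _ =>
    (ContinuousLinearMap.continuous _).comp_aestronglyMeasurable (h1 (b j))

/-- Integrating a uniformly bounded measurable family of homogeneous functions. -/
theorem isC2H_integral {V : Type*} [MeasurableSpace V] {μ : Measure V} [IsFiniteMeasure μ]
    {F : V → En n → ℝ} {C : ℝ} (hF : ∀ v, IsC2H (F v))
    (hm : ∀ x, AEStronglyMeasurable (fun v => F v x) μ)
    (h0 : ∀ v x, ‖x‖ = 1 → ‖F v x‖ ≤ C) (h1 : ∀ v x, ‖x‖ = 1 → ‖fderiv ℝ (F v) x‖ ≤ C)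
    (h2 : ∀ v x, ‖x‖ = 1 → ‖D2 (F v) x‖ ≤ C) :
    IsC2H (fun x => ∫ v, F v x ∂μ) ∧ ∀ x ≠ 0, D2 (fun x => ∫ v, F v x ∂μ) x = ∫ v, D2 (F v) x ∂μ ∧
      Integrable (fun v => D2 (F v) x) μ := by
  have hnorm : ∀ {x : En n}, x ≠ 0 → ‖‖x‖⁻¹ • x‖ = 1 := fun {x} hx => by
    rw [norm_smul, norm_inv, norm_norm, inv_mul_cancel₀ (norm_ne_zero_iff.2 hx)]
  have hx' : ∀ {x : En n}, x ≠ 0 → ‖x‖ • (‖x‖⁻¹ • x) = x := fun {x} hx => by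
    rw [smul_smul, mul_inv_cancel₀ (norm_ne_zero_iff.2 hx), one_smul]
  have b0 : ∀ v x, x ≠ 0 → ‖F v x‖ ≤ C * ‖x‖ := fun v x hx => by
    rw [← hx' hx, (hF v).map_smul _ (norm_nonneg _), norm_mul, norm_norm, mul_comm]
    rw [hx' hx]
    exact mul_le_mul_of_nonneg_right (h0 v _ (hnorm hx)) (norm_nonneg _)
  have b1 : ∀ v x, x ≠ 0 → ‖fderiv ℝ (F v) x‖ ≤ C := fun v x hx => by
    rw [← hx' hx, (hF v).fderiv_smul (norm_pos_iff.2 hx)]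
    exact h1 v _ (hnorm hx)
  have b2 : ∀ v x, x ≠ 0 → ‖D2 (F v) x‖ ≤ C * ‖x‖⁻¹ := fun v x hx => by
    rw [← hx' hx, (hF v).D2_smul (norm_pos_iff.2 hx), norm_smul, norm_inv, norm_norm, mul_comm]
    rw [hx' hx]
    exact mul_le_mul_of_nonneg_right (h2 v _ (hnorm hx)) (by positivity)
  have hm1 : ∀ x ≠ 0, AEStronglyMeasurable (fun v => fderiv ℝ (F v) x) μ := fun x hx =>
    aestronglyMeasurable_fderiv (Eventually.of_forall hm) fun v =>
      ((hF v).hasFDerivAt hx).differentiableAt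
  have hm2 : ∀ x ≠ 0, AEStronglyMeasurable (fun v => D2 (F v) x) μ := fun x hx =>
    aestronglyMeasurable_fderiv ((eventually_ne_nhds hx).mono hm1) fun v =>
      ((hF v).hasFDerivAt_fderiv hx).differentiableAt
  have i0 : ∀ x ≠ 0, Integrable (fun v => F v x) μ := fun x hx =>
    .of_bound (hm x) _ (Eventually.of_forall fun v => b0 v x hx)
  have i1 : ∀ x ≠ 0, Integrable (fun v => fderiv ℝ (F v) x) μ := fun x hx =>
    .of_bound (hm1 x hx) _ (Eventually.of_forall fun v => b1 v x hx)
  have i2 : ∀ x ≠ 0, Integrable (fun v => D2 (F v) x) μ := fun x hx =>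
    .of_bound (hm2 x hx) _ (Eventually.of_forall fun v => b2 v x hx)
  have hC : ∀ v : V, ∀ x : En n, x ≠ 0 → 0 ≤ C := fun v x hx => (norm_nonneg _).trans (b1 v x hx)
  have hd1 : ∀ x ≠ 0, HasFDerivAt (fun x => ∫ v, F v x ∂μ) (∫ v, fderiv ℝ (F v) x ∂μ) x :=
    fun x hx => hasFDerivAt_integral_of_dominated_of_fderiv_le (s := {0}ᶜ) (bound := fun _ => C)
      (isOpen_compl_singleton.mem_nhds hx) (Eventually.of_forall hm) (i0 x hx) (hm1 x hx)
      (Eventually.of_forall fun v y hy => b1 v y hy) (integrable_const _)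
      (Eventually.of_forall fun v y hy => (hF v).hasFDerivAt hy)
  have hs : ∀ x : En n, x ≠ 0 → {y : En n | ‖x‖ / 2 < ‖y‖} ∈ 𝓝 x := fun x hx =>
    (isOpen_lt continuous_const continuous_norm).mem_nhds
      (by simpa using half_lt_self (norm_pos_iff.2 hx))
  have hy0 : ∀ {x y : En n}, x ≠ 0 → ‖x‖ / 2 < ‖y‖ → y ≠ 0 := fun {x y} hx hy =>
    norm_pos_iff.1 (lt_of_le_of_lt (by positivity) hy)
  have b2' : ∀ v (x : En n), x ≠ 0 → ∀ y : En n, ‖x‖ / 2 < ‖y‖ → ‖D2 (F v) y‖ ≤ C * (‖x‖ / 2)⁻¹ :=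
    fun v x hx y hy => (b2 v y (hy0 hx hy)).trans (mul_le_mul_of_nonneg_left
      (inv_anti₀ (by have := norm_pos_iff.2 hx; positivity) hy.le) (hC v x hx))
  have hd2 : ∀ x ≠ 0, HasFDerivAt (fun x => ∫ v, fderiv ℝ (F v) x ∂μ) (∫ v, D2 (F v) x ∂μ) x :=
    fun x hx => hasFDerivAt_integral_of_dominated_of_fderiv_le (hs x hx)
      (bound := fun _ => C * (‖x‖ / 2)⁻¹)
      ((eventually_ne_nhds hx).mono hm1) (i1 x hx) (hm2 x hx)
      (Eventually.of_forall fun v y hy => b2' v x hx y hy)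
      (integrable_const _)
      (Eventually.of_forall fun v y hy => (hF v).hasFDerivAt_fderiv (hy0 hx hy))
  have hD2 : ∀ x ≠ 0, D2 (fun x => ∫ v, F v x ∂μ) x = ∫ v, D2 (F v) x ∂μ := fun x hx =>
    D2_of_hasFDerivAt ((eventually_ne_nhds hx).mono hd1) (hd2 x hx)
  have hc : ContinuousOn (fun x => ∫ v, D2 (F v) x ∂μ) {0}ᶜ := fun x hx => by
    refine ContinuousAt.continuousWithinAt (continuousAt_of_dominated
      (bound := fun _ => C * (‖x‖ / 2)⁻¹) ((eventually_ne_nhds hx).mono hm2)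
      ?_ (integrable_const _) (Eventually.of_forall fun v => (hF v).continuousAt_D2 hx))
    filter_upwards [hs x hx] with y hy
    exact Eventually.of_forall fun v => b2' v x hx y hy
  refine ⟨⟨?_, fun c hc x => ?_⟩, fun x hx => ⟨hD2 x hx, i2 x hx⟩⟩
  · have ho : IsOpen ({0}ᶜ : Set (En n)) := isOpen_compl_singleton
    have e1 : ∀ x ∈ ({0}ᶜ : Set (En n)), fderiv ℝ (fun x => ∫ v, F v x ∂μ) x =
      ∫ v, fderiv ℝ (F v) x ∂μ := fun x hx => (hd1 x hx).fderiv
    have h11 : ContDiffOn ℝ 1 (fun x => ∫ v, fderiv ℝ (F v) x ∂μ) {0}ᶜ := by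
      rw [show (1 : WithTop ℕ∞) = 0 + 1 from rfl, contDiffOn_succ_iff_fderiv_of_isOpen ho]
      refine ⟨fun x hx => (hd2 x hx).differentiableAt.differentiableWithinAt, by simp, ?_⟩
      rw [contDiffOn_zero]
      exact hc.congr fun x hx => (hd2 x hx).fderiv
    rw [show (2 : WithTop ℕ∞) = 1 + 1 from rfl, contDiffOn_succ_iff_fderiv_of_isOpen ho]
    exact ⟨fun x hx => (hd1 x hx).differentiableAt.differentiableWithinAt, by simp,
      h11.congr e1⟩
  · simp only [(hF _).map_smul c hc]
    exact integral_const_mul _ _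

/-! ### Spherical convolution with a zonal kernel -/

theorem exists_zon_bound (hn : 0 < n) {κ : ℝ → ℝ} (hz : ∀ v : En n, ‖v‖ = 1 → IsC2H (zon κ v)) :
    ∃ C, ∀ v x : En n, ‖v‖ = 1 → ‖x‖ = 1 →
      ‖zon κ v x‖ ≤ C ∧ ‖fderiv ℝ (zon κ v) x‖ ≤ C ∧ ‖D2 (zon κ v) x‖ ≤ C := by
  have := nontrivial_En hn
  obtain ⟨e, he⟩ := exists_norm_eq (En n) zero_le_one
  have hE := hz e he
  obtain ⟨C0, -, h0⟩ := exists_bound_sphere hE.continuousOn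
  obtain ⟨C1, -, h1⟩ := exists_bound_sphere hE.continuousOn_fderiv
  obtain ⟨C2, -, h2⟩ := exists_bound_sphere hE.continuousOn_D2
  refine ⟨max C0 (max C1 C2), fun v x hv hx => ?_⟩
  obtain ⟨ρ, hρ, -⟩ := exists_isom (hv.trans he.symm)
  have hx0 := ne_zero_of_norm_eq_one hx
  have hρx : ‖ρ x‖ = 1 := by simpa using hx
  have hzz : zon κ v = fun y => zon κ e (ρ y) := by
    funext y; rw [← hρ, zon_isom]
  rw [hzz]
  exact ⟨(h0 _ hρx).trans (le_max_left _ _),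
    ((norm_fderiv_comp_isom_le hE ρ hx0).trans (h1 _ hρx)).trans (by simp),
    ((norm_D2_comp_isom_le hE ρ hx0).trans (h2 _ hρx)).trans (by simp)⟩

/-- The homogeneous extension of the convolution of `f` with the zonal kernel of profile `κ`. -/
def TT (κ : ℝ → ℝ) (f : C(Sph n, ℝ)) (x : En n) : ℝ := ∫ v : Sph n, f v * zon κ v x ∂(sphVol n)

theorem TT_aux {κ : ℝ → ℝ} (hκ : Continuous κ)
    (hz : ∀ v : En n, ‖v‖ = 1 → IsC2H (zon κ v)) {C : ℝ} (hC : ∀ v x : En n, ‖v‖ = 1 → ‖x‖ = 1 →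
      ‖zon κ v x‖ ≤ C ∧ ‖fderiv ℝ (zon κ v) x‖ ≤ C ∧ ‖D2 (zon κ v) x‖ ≤ C) (f : C(Sph n, ℝ)) :
    IsC2H (TT κ f) ∧ ∀ x ≠ 0,
      D2 (TT κ f) x = ∫ v : Sph n, f v • D2 (zon κ v) x ∂(sphVol n) ∧
      Integrable (fun v : Sph n => f v • D2 (zon κ v) x) (sphVol n) := by
  have hz' : ∀ v : Sph n, IsC2H (zon κ (v : En n)) := fun v => hz v (norm_sph v)
  have hfd : ∀ (v : Sph n) (x : En n), ‖x‖ = 1 →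
      fderiv ℝ (fun x => f v * zon κ v x) x = f v • fderiv ℝ (zon κ v) x := fun v x hx =>
    (((hz' v).hasFDerivAt (ne_zero_of_norm_eq_one hx)).const_mul (f v)).fderiv
  have hD : ∀ (v : Sph n) (x : En n), x ≠ 0 →
      D2 (fun x => f v * zon κ v x) x = f v • D2 (zon κ v) x := fun v x hx =>
    (hz' v).D2_const_mul (f v) hx
  have hb : ∀ (v : Sph n) {a : ℝ}, a ≤ C → 0 ≤ a → ‖f v‖ * a ≤ ‖f‖ * C := fun v a ha h0 =>
    mul_le_mul (f.norm_coe_le_norm v) ha h0 (norm_nonneg _)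
  have h0 : ∀ (v : Sph n) (x : En n), ‖x‖ = 1 → ‖f v * zon κ v x‖ ≤ ‖f‖ * C := fun v x hx => by
    rw [norm_mul]
    exact hb v (hC (v : En n) x (norm_sph v) hx).1 (norm_nonneg _)
  have h1 : ∀ (v : Sph n) (x : En n), ‖x‖ = 1 →
      ‖fderiv ℝ (fun x => f v * zon κ v x) x‖ ≤ ‖f‖ * C := fun v x hx => by
    rw [hfd v x hx, norm_smul]
    exact hb v (hC (v : En n) x (norm_sph v) hx).2.1 (norm_nonneg _)
  have h2 : ∀ (v : Sph n) (x : En n), ‖x‖ = 1 →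
      ‖D2 (fun x => f v * zon κ v x) x‖ ≤ ‖f‖ * C := fun v x hx => by
    rw [hD v x (ne_zero_of_norm_eq_one hx), norm_smul]
    exact hb v (hC (v : En n) x (norm_sph v) hx).2.2 (norm_nonneg _)
  have hm : ∀ x : En n, AEStronglyMeasurable (fun v : Sph n => f v * zon κ v x) (sphVol n) :=
    fun x => Continuous.aestronglyMeasurable
      (f.continuous.mul ((continuous_zon_left hκ x).comp continuous_subtype_val))
  have key := isC2H_integral (μ := sphVol n) (F := fun (v : Sph n) (x : En n) => f v * zon κ v x)
    (C := ‖f‖ * C) (fun v => (hz' v).const_mul (f v)) hm h0 h1 h2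
  obtain ⟨key1, key2⟩ := key
  refine ⟨key1, fun x hx => ?_⟩
  have he : (fun v : Sph n => D2 (fun x => f v * zon κ v x) x) = fun v => f v • D2 (zon κ v) x :=
    funext fun v => hD v x hx
  obtain ⟨h1, h2⟩ := key2 x hx
  rw [he] at h1 h2
  exact ⟨h1, h2⟩

theorem isC2H_TT (hn : 0 < n) {κ : ℝ → ℝ} (hκ : Continuous κ)
    (hz : ∀ v : En n, ‖v‖ = 1 → IsC2H (zon κ v)) (f : C(Sph n, ℝ)) : IsC2H (TT κ f) := by
  obtain ⟨C, hC⟩ := exists_zon_bound hn hz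
  exact (TT_aux hκ hz hC f).1

theorem exists_D2_TT_bound (hn : 0 < n) {κ : ℝ → ℝ} (hκ : Continuous κ)
    (hz : ∀ v : En n, ‖v‖ = 1 → IsC2H (zon κ v)) :
    ∃ C, ∀ (f : C(Sph n, ℝ)) (u : En n), ‖u‖ = 1 → ‖D2 (TT κ f) u‖ ≤ C * ‖f‖ := by
  obtain ⟨C, hC⟩ := exists_zon_bound hn hz
  refine ⟨C * (sphVol n).real Set.univ, fun f u hu => ?_⟩
  rw [((TT_aux hκ hz hC f).2 u (ne_zero_of_norm_eq_one hu)).1]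
  refine (norm_integral_le_of_norm_le_const (C := ‖f‖ * C) (Eventually.of_forall fun v => ?_)).trans
    (le_of_eq (by ring))
  rw [norm_smul]
  exact mul_le_mul (f.norm_coe_le_norm v) (hC v u (norm_sph v) hu).2.2 (norm_nonneg _)
    (norm_nonneg _)

theorem lap_TT (hn : 0 < n) {κ κ' : ℝ → ℝ} (hκ : Continuous κ)
    (hz : ∀ v : En n, ‖v‖ = 1 → IsC2H (zon κ v))
    (hl : ∀ u v : En n, ‖u‖ = 1 → ‖v‖ = 1 → lap (zon κ v) u = ((n : ℝ) - 1) * κ' ⟪u, v⟫_ℝ)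
    (f : C(Sph n, ℝ)) {u : En n} (hu : ‖u‖ = 1) :
    lap (TT κ f) u = ((n : ℝ) - 1) * ∫ v : Sph n, κ' ⟪u, (v : En n)⟫_ℝ * f v ∂(sphVol n) := by
  obtain ⟨C, hC⟩ := exists_zon_bound hn hz
  obtain ⟨h1, h2⟩ := (TT_aux hκ hz hC f).2 u (ne_zero_of_norm_eq_one hu)
  set b := EuclideanSpace.basisFun (Fin n) ℝ
  rw [lap_eq_sum b, ← integral_const_mul]
  have h3 : ∀ j, D2 (TT κ f) u (b j) (b j) =
      ∫ v : Sph n, f v * D2 (zon κ v) u (b j) (b j) ∂(sphVol n) := fun j => by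
    rw [h1, ContinuousLinearMap.integral_apply h2,
      ContinuousLinearMap.integral_apply (h2.apply_continuousLinearMap _)]
    rfl
  have h4 : ∀ j, Integrable (fun v : Sph n => f v * D2 (zon κ v) u (b j) (b j)) (sphVol n) :=
    fun j => (h2.apply_continuousLinearMap (b j)).apply_continuousLinearMap (b j)
  simp only [h3]
  rw [← integral_finsetSum _ fun j _ => h4 j]
  refine integral_congr_ae (Eventually.of_forall fun v => ?_)
  simp only
  rw [← Finset.mul_sum, ← lap_eq_sum b, hl u v hu (norm_sph v)]
  ring

theorem TT_unit (κ : ℝ → ℝ) (f : C(Sph n, ℝ)) {u : En n} (hu : ‖u‖ = 1) :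
    TT κ f u = ∫ v : Sph n, κ ⟪u, (v : En n)⟫_ℝ * f v ∂(sphVol n) := by
  simp only [TT, zon_unit κ _ hu, mul_comm]

/-- The kernel `κ ⟪u, v⟫` on the sphere, as a continuous family of continuous functions. -/
def kerC (κ : C(ℝ, ℝ)) : C(Sph n, C(Sph n, ℝ)) :=
  ContinuousMap.curry ⟨fun p : Sph n × Sph n => κ ⟪(p.1 : En n), (p.2 : En n)⟫_ℝ, by fun_prop⟩

@[simp] theorem kerC_apply (κ : C(ℝ, ℝ)) (u v : Sph n) :
    kerC κ u v = κ ⟪(u : En n), (v : En n)⟫_ℝ := rfl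

theorem norm_integral_mul_le (a f : C(Sph n, ℝ)) :
    ‖∫ v, a v * f v ∂(sphVol n)‖ ≤ ‖a‖ * ‖f‖ * (sphVol n).real Set.univ := by
  refine norm_integral_le_of_norm_le_const (Eventually.of_forall fun v => ?_)
  rw [norm_mul]
  exact mul_le_mul (a.norm_coe_le_norm v) (f.norm_coe_le_norm v) (norm_nonneg _) (norm_nonneg _)

theorem dist_integral_kerC_le (κ : C(ℝ, ℝ)) (f : C(Sph n, ℝ)) (u u' : Sph n) :
    dist (∫ v, kerC κ u v * f v ∂(sphVol n)) (∫ v, kerC κ u' v * f v ∂(sphVol n)) ≤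
      ‖kerC κ u - kerC κ u'‖ * ‖f‖ * (sphVol n).real Set.univ := by
  rw [dist_eq_norm, ← integral_sub (integrable_sph (by fun_prop)) (integrable_sph (by fun_prop))]
  refine (le_of_eq ?_).trans (norm_integral_mul_le (kerC κ u - kerC κ u') f)
  simp only [ContinuousMap.sub_apply, sub_mul]

theorem tendsto_kerC (κ : C(ℝ, ℝ)) (M : ℝ) (u : Sph n) :
    Tendsto (fun u' => ‖kerC κ u - kerC κ u'‖ * M * (sphVol n).real Set.univ) (𝓝 u) (𝓝 0) := by
  have : Continuous fun u' => ‖kerC κ u - kerC κ u'‖ * M * (sphVol n).real Set.univ := by fun_prop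
  simpa using this.tendsto u

/-- The convolution operator with continuous zonal kernel of profile `κ`. -/
def Top (κ : C(ℝ, ℝ)) : C(Sph n, ℝ) →L[ℝ] C(Sph n, ℝ) :=
  LinearMap.mkContinuousOfExistsBound
    { toFun := fun f => ⟨fun u => ∫ v, kerC κ u v * f v ∂(sphVol n), by
        refine continuous_iff_continuousAt.2 fun u => tendsto_iff_dist_tendsto_zero.2 ?_
        refine squeeze_zero (fun _ => dist_nonneg) (fun u' => ?_) (tendsto_kerC κ ‖f‖ u)
        rw [dist_comm]
        exact dist_integral_kerC_le κ f u u'⟩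
      map_add' := fun f f' => by
        ext u
        simp only [ContinuousMap.coe_mk, ContinuousMap.add_apply, mul_add]
        exact integral_add (integrable_sph (by fun_prop)) (integrable_sph (by fun_prop))
      map_smul' := fun c f => by
        ext u
        simp only [ContinuousMap.coe_mk, ContinuousMap.smul_apply, smul_eq_mul, RingHom.id_apply,
          ← integral_const_mul]
        exact integral_congr_ae (Eventually.of_forall fun v => by simp only; ring) }
    ⟨‖kerC κ‖ * (sphVol n).real Set.univ, fun f => by
      refine (ContinuousMap.norm_le _ (by positivity)).2 fun u => ?_
      refine (norm_integral_mul_le (kerC κ u) f).trans ?_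
      have := (kerC κ).norm_coe_le_norm u
      calc _ ≤ ‖kerC κ‖ * ‖f‖ * (sphVol n).real Set.univ := by gcongr
        _ = _ := by ring⟩

theorem Top_apply (κ : C(ℝ, ℝ)) (f : C(Sph n, ℝ)) (u : Sph n) :
    Top κ f u = ∫ v : Sph n, κ ⟪(u : En n), (v : En n)⟫_ℝ * f v ∂(sphVol n) := rfl

theorem isCompactOperator_Top (κ : C(ℝ, ℝ)) : IsCompactOperator (Top (n := n) κ) := by
  set J := ContinuousMap.isometryEquivBoundedOfCompact (Sph n) ℝ
  set A := J '' (Top (n := n) κ '' closedBall 0 1)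
  have hA : IsCompact (closure A) := by
    refine BoundedContinuousFunction.arzela_ascoli (closedBall 0 ‖Top (n := n) κ‖)
      (isCompact_closedBall _ _) A ?_ fun u => ?_
    · rintro _ x ⟨_, ⟨f, hf, rfl⟩, rfl⟩
      rw [mem_closedBall_zero_iff] at hf ⊢
      refine (ContinuousMap.norm_coe_le_norm (Top κ f) x).trans (((Top κ).le_opNorm f).trans ?_)
      exact mul_le_of_le_one_right (norm_nonneg _) hf
    · refine Metric.equicontinuousAt_of_continuity_modulus _ (tendsto_kerC κ 1 u) _
        (Eventually.of_forall fun u' => ?_)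
      rintro ⟨_, _, ⟨f, hf, rfl⟩, rfl⟩
      rw [mem_closedBall_zero_iff] at hf
      refine (dist_integral_kerC_le κ f u u').trans ?_
      gcongr
  refine ⟨J.symm '' closure A, hA.image J.symm.continuous,
    mem_of_superset (closedBall_mem_nhds 0 one_pos) fun f hf => ?_⟩
  exact ⟨J (Top κ f), subset_closure ⟨_, ⟨f, hf, rfl⟩, rfl⟩, J.symm_apply_apply _⟩

/-! ### Zonal profiles -/

/-- The profile of a zonal function `F` with axis `e`, read off along the arc through `e'`. -/
def prof (F : En n → ℝ) (e e' : En n) (t : ℝ) : ℝ := F (t • e + √(1 - t ^ 2) • e')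

theorem inner_arc {e e' : En n} (he : ‖e‖ = 1) (hee : ⟪e', e⟫_ℝ = 0) (t : ℝ) :
    ⟪t • e + √(1 - t ^ 2) • e', e⟫_ℝ = t := by
  rw [inner_add_left, inner_smul_left, inner_smul_left, real_inner_self_eq_norm_sq, he, hee]
  simp

theorem norm_arc {e e' : En n} (he : ‖e‖ = 1) (he' : ‖e'‖ = 1) (hee : ⟪e', e⟫_ℝ = 0) {t : ℝ}
    (ht : |t| ≤ 1) : ‖t • e + √(1 - t ^ 2) • e'‖ = 1 := by
  have h1 : 0 ≤ 1 - t ^ 2 := by nlinarith [abs_le.1 ht]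
  have : ‖t • e + √(1 - t ^ 2) • e'‖ ^ 2 = 1 := by
    rw [norm_add_sq_real, norm_smul, norm_smul, he, he', inner_smul_left, inner_smul_right,
      real_inner_comm, hee, Real.norm_eq_abs, Real.norm_eq_abs, mul_one, mul_one, sq_abs, sq_abs,
      Real.sq_sqrt h1]
    simp
  exact (pow_eq_one_iff_of_nonneg (norm_nonneg _) two_ne_zero).1 this

theorem arc_ne_zero {e e' : En n} (he : ‖e‖ = 1) (he' : ‖e'‖ = 1) (hee : ⟪e', e⟫_ℝ = 0) (t : ℝ) :
    t • e + √(1 - t ^ 2) • e' ≠ 0 := fun h => by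
  have ht := inner_arc he hee t
  rw [h, inner_zero_left] at ht
  subst ht
  have := norm_arc (t := 0) he he' hee (by simp)
  rw [h, norm_zero] at this
  exact zero_ne_one this

theorem continuous_prof {F : En n → ℝ} (hF : ContinuousOn F {0}ᶜ) {e e' : En n} (he : ‖e‖ = 1)
    (he' : ‖e'‖ = 1) (hee : ⟪e', e⟫_ℝ = 0) : Continuous (prof F e e') :=
  hF.comp_continuous (by fun_prop) fun t => arc_ne_zero he he' hee t

/-- A function is zonal with axis `e` if on the unit sphere it only depends on `⟪·, e⟫`. -/
def Zonal (F : En n → ℝ) (e : En n) : Prop :=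
  ∀ u u' : En n, ‖u‖ = 1 → ‖u'‖ = 1 → ⟪u, e⟫_ℝ = ⟪u', e⟫_ℝ → F u = F u'

theorem Zonal.eq_prof {F : En n → ℝ} {e e' : En n} (hz : Zonal F e) (he : ‖e‖ = 1)
    (he' : ‖e'‖ = 1) (hee : ⟪e', e⟫_ℝ = 0) {u : En n} (hu : ‖u‖ = 1) :
    F u = prof F e e' ⟪u, e⟫_ℝ := by
  refine hz _ _ hu (norm_arc he he' hee ?_) (inner_arc he hee _).symm
  simpa [hu, he] using abs_real_inner_le_norm u e

theorem Zonal.zon_prof {F : En n → ℝ} {e e' : En n} (hz : Zonal F e) (hF : IsC2H F) (he : ‖e‖ = 1)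
    (he' : ‖e'‖ = 1) (hee : ⟪e', e⟫_ℝ = 0) : zon (prof F e e') e = F := by
  funext x
  rcases eq_or_ne x 0 with rfl | hx
  · simp [zon, hF.map_zero]
  · have h1 : ‖‖x‖⁻¹ • x‖ = 1 := by
      rw [norm_smul, norm_inv, norm_norm, inv_mul_cancel₀ (norm_ne_zero_iff.2 hx)]
    rw [zon, ← hz.eq_prof he he' hee h1, ← hF.map_smul _ (norm_nonneg _), smul_smul,
      mul_inv_cancel₀ (norm_ne_zero_iff.2 hx), one_smul]

theorem Zonal.comp_isom_eq {F : En n → ℝ} {e : En n} (hz : Zonal F e) (hF : IsC2H F)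
    {ρ : En n ≃ₗᵢ[ℝ] En n} (hρ : ρ e = e) : (fun x => F (ρ x)) = F := by
  funext x
  rcases eq_or_ne x 0 with rfl | hx
  · simp
  · have h1 : ‖‖x‖⁻¹ • x‖ = 1 := by
      rw [norm_smul, norm_inv, norm_norm, inv_mul_cancel₀ (norm_ne_zero_iff.2 hx)]
    have hx' : x = ‖x‖ • (‖x‖⁻¹ • x) := by
      rw [smul_smul, mul_inv_cancel₀ (norm_ne_zero_iff.2 hx), one_smul]
    have h2 : F (ρ (‖x‖⁻¹ • x)) = F (‖x‖⁻¹ • x) := by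
      refine hz _ _ (by rw [LinearIsometryEquiv.norm_map, h1]) h1 ?_
      rw [← hρ, LinearIsometryEquiv.inner_map_map, hρ]
    rw [hx', map_smul, hF.map_smul _ (norm_nonneg _), hF.map_smul _ (norm_nonneg _), h2]

theorem Zonal.lap {F : En n → ℝ} {e : En n} (hz : Zonal F e) (hF : IsC2H F) : Zonal (lap F) e := by
  intro u u' hu hu' h
  obtain ⟨ρ, hρ, h1⟩ := exists_isom (hu.trans hu'.symm)
  have hρe := h1 e (by rwa [real_inner_comm, real_inner_comm u'])
  rw [← hρ, ← lap_comp_isom hF ρ (ne_zero_of_norm_eq_one hu), hz.comp_isom_eq hF hρe]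

theorem lap_pos_of_hess_pos (hn : 2 ≤ n) {F : En n → ℝ} (hF : IsC2H F)
    (hs : ∀ x y, F (x + y) ≤ F x + F y) {u : En n} (hu : ‖u‖ = 1)
    (hp : ∀ w : En n, w ≠ 0 → ⟪u, w⟫_ℝ = 0 → 0 < D2 F u w w) : 0 < lap F u := by
  have hu0 := ne_zero_of_norm_eq_one hu
  set b := EuclideanSpace.basisFun (Fin n) ℝ
  have hnn : ∀ w, 0 ≤ D2 F u w w := fun w => hF.D2_nonneg hs hu0 w
  have hw : ∀ w : En n, D2 F u w w = 0 → w = ⟪u, w⟫_ℝ • u := fun w h0 => by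
    by_contra hne
    have := hp (w - ⟪u, w⟫_ℝ • u) (sub_ne_zero.2 hne) (by
      rw [inner_sub_right, inner_smul_right, real_inner_self_eq_norm_sq, hu]; ring)
    simp [hF.D2_self_left hu0, hF.D2_self_right hu0, h0] at this
  rw [lap_eq_sum b]
  refine lt_of_le_of_ne (Finset.sum_nonneg fun j _ => hnn _) fun h => ?_
  have h0 := (Finset.sum_eq_zero_iff_of_nonneg fun j _ => hnn (b j)).1 h.symm
  have e0 := hw _ (h0 ⟨0, by omega⟩ (Finset.mem_univ _))
  have e1 := hw _ (h0 ⟨1, by omega⟩ (Finset.mem_univ _))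
  have horth : ⟪b ⟨0, by omega⟩, b ⟨1, by omega⟩⟫_ℝ = 0 := b.orthonormal.2 (by simp)
  have n0 : b ⟨0, by omega⟩ ≠ 0 := b.orthonormal.ne_zero _
  have n1 : b ⟨1, by omega⟩ ≠ 0 := b.orthonormal.ne_zero _
  rw [e0, inner_smul_left] at horth
  rcases mul_eq_zero.1 horth with h | h
  · rw [e0] at n0
    simp at h
    simp [h] at n0
  · rw [e1] at n1
    simp [h] at n1

/-- A pair of zonal kernels on the sphere, the first generating support functions, the second
being (up to normalization) its positive Laplacian. -/
structure KData (n : ℕ) (g k : C(ℝ, ℝ)) : Prop where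
  zg : ∀ v : En n, ‖v‖ = 1 → IsC2H (zon g v)
  zk : ∀ v : En n, ‖v‖ = 1 → IsC2H (zon k v)
  lap_zg : ∀ u v : En n, ‖u‖ = 1 → ‖v‖ = 1 → lap (zon g v) u = ((n : ℝ) - 1) * k ⟪u, v⟫_ℝ
  kpos : ∀ u v : En n, ‖u‖ = 1 → ‖v‖ = 1 → 0 < k ⟪u, v⟫_ℝ
  sub : ∀ v : En n, ‖v‖ = 1 → ∀ x y, zon g v (x + y) ≤ zon g v x + zon g v y

theorem isC2H_sq_mul_lap {F : En n → ℝ} (hF : IsC2H F) (hs : ContDiffOn ℝ (⊤ : ℕ∞) F {0}ᶜ) :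
    IsC2H fun x => ‖x‖ ^ 2 * lap F x := by
  refine ⟨?_, fun c hc x => ?_⟩
  · refine ContDiffOn.mul (contDiff_norm_sq ℝ).contDiffOn ?_
    have ho : IsOpen ({0}ᶜ : Set (En n)) := isOpen_compl_singleton
    have h1 : ContDiffOn ℝ 3 (fderiv ℝ F) {0}ᶜ := hs.fderiv_of_isOpen ho (by norm_cast)
    have h2 : ContDiffOn ℝ 2 (D2 F) {0}ᶜ := h1.fderiv_of_isOpen ho (by norm_num)
    have : lap F = fun x => ∑ j, D2 F x (EuclideanSpace.basisFun (Fin n) ℝ j)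
        (EuclideanSpace.basisFun (Fin n) ℝ j) := funext fun x => lap_eq_sum _ F x
    rw [this]
    exact ContDiffOn.sum fun j _ => (h2.clm_apply contDiffOn_const).clm_apply contDiffOn_const
  · rcases hc.eq_or_lt with rfl | hc
    · simp
    · rw [hF.lap_smul hc, norm_smul, Real.norm_of_nonneg hc.le]
      field_simp

theorem exists_kdata (hn : 3 ≤ n) {i : ℕ} {Φ : ConvexBody (En n) → ConvexBody (En n)}
    (h : CInfRegular i Φ) : ∃ g k : C(ℝ, ℝ), KData n g k ∧ GeneratedBy i Φ g := by
  obtain ⟨L, g₀, -, ⟨hsm, hpos⟩, hg₀, hgen⟩ := h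
  have hn0 : 0 < n := by omega
  have hn1 : (0 : ℝ) < (n : ℝ) - 1 := by
    have : (3 : ℝ) ≤ n := by exact_mod_cast hn
    linarith
  have hH : IsC2H (supp L) := isC2H_supp (hsm.of_le (by norm_cast))
  set e := pole n with hedef
  have hep : e = EuclideanSpace.single (⟨0, hn0⟩ : Fin n) 1 := by simp [hedef, pole, hn0]
  set e' : En n := EuclideanSpace.single (⟨1, by omega⟩ : Fin n) 1
  have he : ‖e‖ = 1 := by simp [hep]
  have he' : ‖e'‖ = 1 := by simp [e']
  have hee : ⟪e', e⟫_ℝ = 0 := by rw [hep, EuclideanSpace.inner_single_left]; simp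
  have hZ : Zonal (supp L) e := fun u u' hu hu' h => by rw [hg₀ u hu, hg₀ u' hu', h]
  have hH2 : IsC2H fun x => ((n : ℝ) - 1)⁻¹ * (‖x‖ ^ 2 * lap (supp L) x) :=
    (isC2H_sq_mul_lap hH hsm).const_mul _
  have hZ2 : Zonal (fun x => ((n : ℝ) - 1)⁻¹ * (‖x‖ ^ 2 * lap (supp L) x)) e :=
    fun u u' hu hu' h => by simp only [hu, hu', hZ.lap hH u u' hu hu' h]
  set H2 := fun x => ((n : ℝ) - 1)⁻¹ * (‖x‖ ^ 2 * lap (supp L) x) with hH2def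
  let g : C(ℝ, ℝ) := ⟨prof (supp L) e e', continuous_prof hH.continuousOn he he' hee⟩
  let k : C(ℝ, ℝ) := ⟨prof H2 e e', continuous_prof hH2.continuousOn he he' hee⟩
  have hge : zon g e = supp L := hZ.zon_prof hH he he' hee
  have hke : zon k e = H2 := hZ2.zon_prof hH2 he he' hee
  have hrot : ∀ v : En n, ‖v‖ = 1 → ∃ ρ : En n ≃ₗᵢ[ℝ] En n, ρ v = e ∧
      ∀ κ : ℝ → ℝ, zon κ v = fun x => zon κ e (ρ x) := fun v hv => by
    obtain ⟨ρ, hρ, -⟩ := exists_isom (hv.trans he.symm)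
    exact ⟨ρ, hρ, fun κ => funext fun x => by rw [← hρ, zon_isom]⟩
  have hlap : ∀ u : En n, ‖u‖ = 1 → lap (supp L) u = ((n : ℝ) - 1) * k ⟪u, e⟫_ℝ := fun u hu => by
    rw [← zon_unit k e hu, hke, hH2def]
    simp only [hu]
    field_simp
  refine ⟨g, k, ⟨fun v hv => ?_, fun v hv => ?_, fun u v hu hv => ?_, fun u v hu hv => ?_,
    fun v hv x y => ?_⟩, fun K μ hμ u hu => ?_⟩
  · obtain ⟨ρ, -, h⟩ := hrot v hv
    rw [h, hge]; exact hH.comp_isom ρ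
  · obtain ⟨ρ, -, h⟩ := hrot v hv
    rw [h, hke]; exact hH2.comp_isom ρ
  · obtain ⟨ρ, hρ, h⟩ := hrot v hv
    rw [h, hge, lap_comp_isom hH ρ (ne_zero_of_norm_eq_one hu), hlap _ (by simpa using hu), ← hρ,
      LinearIsometryEquiv.inner_map_map]
  · obtain ⟨ρ, hρ, h⟩ := hrot v hv
    have hρu : ‖ρ u‖ = 1 := by simpa using hu
    have := lap_pos_of_hess_pos (by omega) hH (supp_add_le L) hρu fun w hw0 hw => by
      rw [D2_apply_eq_iteratedFDeriv]; exact hpos _ hρu w hw0 hw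
    rw [hlap _ hρu, ← hρ, LinearIsometryEquiv.inner_map_map] at this
    exact (mul_pos_iff_of_pos_left hn1).1 this
  · obtain ⟨ρ, -, h⟩ := hrot v hv
    rw [h, hge]
    simp only [map_add]
    exact supp_add_le L _ _
  · rw [hgen K μ hμ u hu]
    refine integral_congr_ae (Eventually.of_forall fun v => ?_)
    obtain ⟨ρ, hρ, -⟩ := exists_isom ((norm_sph v).trans he.symm)
    have h1 : ⟪u, (v : En n)⟫_ℝ = ⟪ρ u, e⟫_ℝ := by rw [← hρ, LinearIsometryEquiv.inner_map_map]
    have hρu : ‖ρ u‖ = 1 := by simpa using hu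
    simp only
    rw [h1, ← hg₀ _ hρu, ← zon_unit g e hρu, hge]

/-! ### Symmetric operators on finite-dimensional spaces -/

theorem exists_eigenvector {V : Type*} [AddCommGroup V] [Module ℝ V] [FiniteDimensional ℝ V]
    [Nontrivial V] (B : V →ₗ[ℝ] V →ₗ[ℝ] ℝ) (hs : ∀ x y, B x y = B y x)
    (hp : ∀ x, x ≠ 0 → 0 < B x x) (T : V →ₗ[ℝ] V) (hT : ∀ x y, B (T x) y = B x (T y)) :
    ∃ (a : ℝ) (x : V), x ≠ 0 ∧ T x = a • x := by
  let core : InnerProductSpace.Core ℝ V :=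
    { inner := fun x y => B x y
      conj_inner_symm := fun x y => hs y x
      re_inner_nonneg := fun x => by
        rcases eq_or_ne x 0 with rfl | hx
        · simp
        · exact (hp x hx).le
      add_left := fun x y z => by simp
      smul_left := fun x y r => by simp
      definite := fun x hx => by
        by_contra h
        exact (hp x h).ne' hx }
  let _ : NormedAddCommGroup V := core.toNormedAddCommGroup
  let _ : InnerProductSpace ℝ V := InnerProductSpace.ofCore core.toCore
  have hsym : T.IsSymmetric := fun x y => hT x y
  obtain ⟨x, hx⟩ := hsym.hasEigenvalue_iSup_of_finiteDimensional.exists_hasEigenvector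
  exact ⟨_, x, hx.2, hx.apply_eq_smul⟩

theorem exists_riesz {V : Type*} [AddCommGroup V] [Module ℝ V] [FiniteDimensional ℝ V]
    (B : V →ₗ[ℝ] V →ₗ[ℝ] ℝ) (hp : ∀ x, x ≠ 0 → 0 < B x x) (φ : V →ₗ[ℝ] ℝ) :
    ∃ z, ∀ x, B z x = φ x := by
  have hinj : Function.Injective B := by
    rw [injective_iff_map_eq_zero]
    intro x hx
    by_contra h
    have := hp x h
    simp [hx] at this
  have hsur := (LinearMap.injective_iff_surjective_of_finrank_eq_finrank (f := B)
    Subspace.dual_finrank_eq.symm).1 hinj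
  obtain ⟨z, hz⟩ := hsur φ
  exact ⟨z, fun x => by rw [hz]⟩

/-! ### Convolution operators: symmetry, equivariance, commutation -/

/-- The `L²` inner product on continuous functions on the sphere. -/
def l2 : C(Sph n, ℝ) →ₗ[ℝ] C(Sph n, ℝ) →ₗ[ℝ] ℝ :=
  LinearMap.mk₂ ℝ (fun f h => ∫ v, f v * h v ∂(sphVol n))
    (fun f f' h => by
      simp only [ContinuousMap.add_apply, add_mul]
      exact integral_add (integrable_sph (by fun_prop)) (integrable_sph (by fun_prop)))
    (fun c f h => by
      simp only [ContinuousMap.smul_apply, smul_eq_mul, mul_assoc, integral_const_mul])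
    (fun f h h' => by
      simp only [ContinuousMap.add_apply, mul_add]
      exact integral_add (integrable_sph (by fun_prop)) (integrable_sph (by fun_prop)))
    (fun c f h => by
      simp only [ContinuousMap.smul_apply, smul_eq_mul, mul_left_comm _ c, integral_const_mul])

theorem l2_apply (f h : C(Sph n, ℝ)) : l2 f h = ∫ v, f v * h v ∂(sphVol n) := rfl

theorem l2_comm (f h : C(Sph n, ℝ)) : l2 f h = l2 h f := by simp only [l2_apply, mul_comm]

theorem integral_pos_of_nonneg {f : C(Sph n, ℝ)} (h : ∀ v, 0 ≤ f v) {v : Sph n} (hv : f v ≠ 0) :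
    0 < ∫ v, f v ∂(sphVol n) := by
  refine (integral_nonneg h).lt_of_ne fun h0 => hv ?_
  have := (integral_eq_zero_iff_of_nonneg h (integrable_sph f.continuous)).1 h0.symm
  have h1 := f.continuous.ae_eq_iff_eq (sphVol n) (continuous_const (y := (0 : ℝ))) |>.1 this
  exact congrFun h1 v

theorem l2_self_pos {f : C(Sph n, ℝ)} (hf : f ≠ 0) : 0 < l2 f f := by
  obtain ⟨v, hv⟩ : ∃ v, f v ≠ 0 := by
    by_contra! h
    exact hf (ContinuousMap.ext h)
  exact integral_pos_of_nonneg (f := f * f) (v := v) (fun v => mul_self_nonneg (f v))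
    (mul_self_ne_zero.2 hv)

theorem Top_comp_isom (hn : 0 < n) (κ : C(ℝ, ℝ)) (ρ : En n ≃ₗᵢ[ℝ] En n) (f : C(Sph n, ℝ)) :
    Top κ (f.comp (sphMap ρ)) = (Top κ f).comp (sphMap ρ) := by
  ext u
  rw [ContinuousMap.comp_apply, Top_apply, Top_apply,
    ← integral_sphMap hn ρ fun v => κ ⟪(sphMap ρ u : En n), (v : En n)⟫_ℝ * f v]
  simp

theorem integral_integral_swap_sph {F : Sph n → Sph n → ℝ} (hF : Continuous (Function.uncurry F)) :
    ∫ u, ∫ v, F u v ∂(sphVol n) ∂(sphVol n) = ∫ v, ∫ u, F u v ∂(sphVol n) ∂(sphVol n) :=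
  integral_integral_swap (hF.integrable_of_hasCompactSupport (HasCompactSupport.of_compactSpace _))

theorem l2_Top (κ : C(ℝ, ℝ)) (f h : C(Sph n, ℝ)) : l2 (Top κ f) h = l2 f (Top κ h) := by
  simp only [l2_apply, Top_apply, ← integral_mul_const, ← integral_const_mul]
  rw [integral_integral_swap_sph (by unfold Function.uncurry; fun_prop)]
  refine integral_congr_ae (Eventually.of_forall fun v => ?_)
  refine integral_congr_ae (Eventually.of_forall fun u => ?_)
  simp only
  rw [real_inner_comm]
  ring

theorem Top_comm (hn : 0 < n) (g k : C(ℝ, ℝ)) (f : C(Sph n, ℝ)) :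
    Top g (Top k f) = Top k (Top g f) := by
  have key : ∀ (a b : C(ℝ, ℝ)) (u : Sph n), Top a (Top b f) u =
      ∫ w : Sph n, (∫ v : Sph n, a ⟪(u : En n), (v : En n)⟫_ℝ * b ⟪(v : En n), (w : En n)⟫_ℝ
        ∂(sphVol n)) * f w ∂(sphVol n) := fun a b u => by
    simp only [Top_apply, ← integral_mul_const, ← integral_const_mul]
    rw [integral_integral_swap_sph (by unfold Function.uncurry; fun_prop)]
    simp only [mul_assoc]
  ext u
  rw [key, key]
  refine integral_congr_ae (Eventually.of_forall fun w => ?_)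
  simp only
  congr 1
  obtain ⟨ρ, h1, h2⟩ : ∃ ρ : En n ≃ₗᵢ[ℝ] En n, ρ u = w ∧ ρ w = u := by
    have h : (ℝ ∙ ((u : En n) - w))ᗮ.reflection u = w :=
      Submodule.reflection_sub ((norm_sph u).trans (norm_sph w).symm)
    exact ⟨_, h, (congrArg _ h).symm.trans (Submodule.reflection_reflection _ _)⟩
  rw [← integral_sphMap hn ρ]
  refine integral_congr_ae (Eventually.of_forall fun v => ?_)
  simp only [coe_sphMap]
  nth_rewrite 1 [← h2]
  nth_rewrite 2 [← h1]
  rw [LinearIsometryEquiv.inner_map_map, LinearIsometryEquiv.inner_map_map, mul_comm,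
    real_inner_comm (v : En n), real_inner_comm (u : En n)]

theorem exists_Top_one (hn : 0 < n) (κ : C(ℝ, ℝ)) :
    ∃ a : ℝ, ∀ u : Sph n, ∫ v : Sph n, κ ⟪(u : En n), (v : En n)⟫_ℝ ∂(sphVol n) = a := by
  have := nontrivial_En hn
  obtain ⟨e, he⟩ := exists_norm_eq (En n) zero_le_one
  refine ⟨∫ v : Sph n, κ ⟪e, (v : En n)⟫_ℝ ∂(sphVol n), fun u => ?_⟩
  obtain ⟨ρ, hρ, -⟩ := exists_isom ((norm_sph u).trans he.symm)
  rw [← hρ, ← integral_sphMap hn ρ fun v => κ ⟪ρ u, (v : En n)⟫_ℝ]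
  simp

theorem integral_Top {κ : C(ℝ, ℝ)} {a : ℝ}
    (ha : ∀ u : Sph n, ∫ v : Sph n, κ ⟪(u : En n), (v : En n)⟫_ℝ ∂(sphVol n) = a)
    (f : C(Sph n, ℝ)) : ∫ v, Top κ f v ∂(sphVol n) = a * ∫ v, f v ∂(sphVol n) := by
  have h1 : Top κ (1 : C(Sph n, ℝ)) = a • 1 := by
    ext u
    rw [Top_apply]
    simpa using ha u
  have := l2_Top κ f 1
  rw [h1, map_smul, l2_apply, l2_apply] at this
  simpa using this

theorem Top_neg (hn : 0 < n) (κ : C(ℝ, ℝ)) (f : C(Sph n, ℝ)) (hf : ∀ u, f (-u) = f u) (u : Sph n) :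
    Top κ f (-u) = Top κ f u := by
  have hs : ∀ v : Sph n, sphMap (LinearIsometryEquiv.neg ℝ) v = -v := fun v => by
    ext1; simp
  have h1 : f.comp (sphMap (LinearIsometryEquiv.neg ℝ)) = f := by
    ext v; rw [ContinuousMap.comp_apply, hs, hf]
  have := Top_comp_isom hn κ (LinearIsometryEquiv.neg ℝ) f
  rw [h1] at this
  nth_rewrite 2 [this]
  rw [ContinuousMap.comp_apply, hs]

/-- Even eigenfunctions with mean zero. -/
def eigV (κ : C(ℝ, ℝ)) (l : ℝ) : Submodule ℝ C(Sph n, ℝ) where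
  carrier := {f | (∀ u, f (-u) = f u) ∧ l2 1 f = 0 ∧ Top κ f = l • f}
  add_mem' := fun {f h} hf hh => ⟨fun u => by simp [hf.1, hh.1], by simp [hf.2.1, hh.2.1],
    by rw [map_add, hf.2.2, hh.2.2, smul_add]⟩
  zero_mem' := ⟨by simp, by simp, by simp⟩
  smul_mem' := fun c f hf => ⟨fun u => by simp [hf.1], by simp [hf.2.1],
    by rw [map_smul, hf.2.2, smul_comm]⟩

theorem finiteDimensional_eigV (κ : C(ℝ, ℝ)) {l : ℝ} (hl : l ≠ 0) :
    FiniteDimensional ℝ (eigV (n := n) κ l) := by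
  set T : C(Sph n, ℝ) →L[ℝ] C(Sph n, ℝ) := Top κ
  set W : Submodule ℝ C(Sph n, ℝ) := (T - l • ContinuousLinearMap.id ℝ _).ker with hW
  have hmem : ∀ f, f ∈ W ↔ T f = l • f := fun f => by
    simp [hW, LinearMap.mem_ker, sub_eq_zero]
  have hcl : IsClosed (W : Set C(Sph n, ℝ)) := ContinuousLinearMap.isClosed_ker _
  have hc := (isCompactOperator_Top (n := n) κ)
  have hr : IsCompactOperator ((T : C(Sph n, ℝ) →ₗ[ℝ] C(Sph n, ℝ)).restrict
      (p := W) (q := W) fun f hf => by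
        rw [hmem] at hf ⊢
        change T (T f) = l • T f
        rw [hf, map_smul, hf]) := IsCompactOperator.restrict hc _ hcl
  have hid : IsCompactOperator (id : W → W) := by
    have := hr.smul l⁻¹
    refine (congrArg IsCompactOperator (funext fun f => Subtype.ext ?_)).mpr this
    change (f : C(Sph n, ℝ)) = l⁻¹ • T f
    rw [(hmem f).1 f.2, smul_smul, inv_mul_cancel₀ hl, one_smul]
  have := FiniteDimensional.of_isCompactOperator_id (𝕜 := ℝ) hid
  exact Submodule.finiteDimensional_of_le (S₂ := W) fun f hf => (hmem f).2 hf.2.2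

theorem comp_isom_mem_eigV (hn : 0 < n) {κ : C(ℝ, ℝ)} {l : ℝ} (ρ : En n ≃ₗᵢ[ℝ] En n)
    {f : C(Sph n, ℝ)} (hf : f ∈ eigV κ l) : f.comp (sphMap ρ) ∈ eigV κ l := by
  refine ⟨fun u => ?_, ?_, ?_⟩
  · have : sphMap ρ (-u) = - sphMap ρ u := by ext1; simp
    rw [ContinuousMap.comp_apply, ContinuousMap.comp_apply, this, hf.1]
  · rw [← hf.2.1, l2_apply, l2_apply,
      ← integral_sphMap hn ρ fun v => (1 : C(Sph n, ℝ)) v * f v]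
    simp
  · rw [Top_comp_isom hn, hf.2.2]
    rfl

/-! ### Zonal reproducing kernels -/

theorem l2_self_nonneg (f : C(Sph n, ℝ)) : 0 ≤ l2 f f :=
  integral_nonneg fun v => mul_self_nonneg (f v)

theorem l2_comp_isom (hn : 0 < n) (ρ : En n ≃ₗᵢ[ℝ] En n) (f h : C(Sph n, ℝ)) :
    l2 (f.comp (sphMap ρ)) (h.comp (sphMap ρ)) = l2 f h :=
  integral_sphMap hn ρ fun v => f v * h v

theorem exists_reproducing (hn : 0 < n) (V : Submodule ℝ C(Sph n, ℝ)) [FiniteDimensional ℝ V]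
    (hinv : ∀ ρ : En n ≃ₗᵢ[ℝ] En n, ∀ f ∈ V, f.comp (sphMap ρ) ∈ V) (hne : V ≠ ⊥) :
    ∃ z : Sph n → C(Sph n, ℝ), (∀ u, z u ∈ V) ∧ (∀ u, ∀ f ∈ V, l2 (z u) f = f u) ∧
      (∀ (ρ : En n ≃ₗᵢ[ℝ] En n) (u v), z (sphMap ρ u) (sphMap ρ v) = z u v) ∧ ∀ u, 0 < z u u := by
  have hz : ∀ u : Sph n, ∃ z : V, ∀ f : V, l2 (z : C(Sph n, ℝ)) f = (f : C(Sph n, ℝ)) u := fun u =>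
    exists_riesz (l2.domRestrict₁₂ V V)
      (fun f hf => l2_self_pos fun h => hf (Subtype.ext h))
      { toFun := fun f => (f : C(Sph n, ℝ)) u
        map_add' := fun f f' => rfl
        map_smul' := fun c f => rfl }
  choose z hz using hz
  have hz' : ∀ u, ∀ f ∈ V, l2 (z u : C(Sph n, ℝ)) f = f u := fun u f hf => hz u ⟨f, hf⟩
  have hinvz : ∀ (ρ : En n ≃ₗᵢ[ℝ] En n) (u), (z (sphMap ρ u) : C(Sph n, ℝ)).comp (sphMap ρ) =
      z u := fun ρ u => by
    have hm := V.sub_mem (hinv ρ _ (z (sphMap ρ u)).2) (z u).2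
    have key : ∀ f ∈ V, l2 ((z (sphMap ρ u) : C(Sph n, ℝ)).comp (sphMap ρ) -
        (z u : C(Sph n, ℝ))) f = 0 :=
      fun f hf => by
        have h1 : (f.comp (sphMap ρ.symm)).comp (sphMap ρ) = f := by
          ext v
          simp only [ContinuousMap.comp_apply]
          congr 1
          ext1
          simp
        have h2 : f.comp (sphMap ρ.symm) (sphMap ρ u) = f u := by
          nth_rewrite 2 [← h1]
          simp only [ContinuousMap.comp_apply]
        rw [map_sub, LinearMap.sub_apply, hz' _ f hf]
        nth_rewrite 1 [← h1]
        rw [l2_comp_isom hn, hz' _ _ (hinv ρ.symm f hf), h2, sub_self]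
    by_contra h
    exact (l2_self_pos (sub_ne_zero.2 h)).ne' (key _ hm)
  refine ⟨fun u => z u, fun u => (z u).2, hz', fun ρ u v => by
    simp only [← hinvz ρ u, ContinuousMap.comp_apply], fun u => ?_⟩
  rw [← hz' u _ (z u).2]
  refine l2_self_pos fun h0 => hne ?_
  rw [Submodule.eq_bot_iff]
  intro f hf
  ext w
  obtain ⟨ρ, hρ, -⟩ := exists_isom ((norm_sph w).trans (norm_sph u).symm)
  have hρ' : sphMap ρ w = u := by ext1; exact hρ
  have h1 := hinvz ρ w
  rw [hρ', h0] at h1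
  rw [← hz' w f hf, ← h1]
  simp

/-- `n` unit vectors in `ℝⁿ` with prescribed pairwise inner products in `[0,1]`. -/
theorem exists_equiangular (hn : 0 < n) {t : ℝ} (h0 : 0 ≤ t) (h1 : t ≤ 1) :
    ∃ w : Fin n → En n, ∀ j l, ⟪w j, w l⟫_ℝ = if j = l then 1 else t := by
  set b : Fin n → En n := fun j => EuclideanSpace.single j 1
  have hb : ∀ j l, ⟪b j, b l⟫_ℝ = if j = l then 1 else 0 := fun j l => by
    simp only [b, EuclideanSpace.inner_single_left]
    simp
  have hbs : ∀ j, ⟪b j, ∑ l, b l⟫_ℝ = 1 := fun j => by simp [inner_sum, hb]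
  have hsb : ∀ j, ⟪∑ l, b l, b j⟫_ℝ = 1 := fun j => by rw [real_inner_comm, hbs]
  have hss : ⟪∑ l, b l, ∑ l, b l⟫_ℝ = n := by rw [sum_inner]; simp [hbs]
  have hn' : (0 : ℝ) < n := by exact_mod_cast hn
  set α := √(1 - t)
  have hα : α ^ 2 = 1 - t := Real.sq_sqrt (by linarith)
  set q := √(α ^ 2 + n * t)
  have hq : q ^ 2 = α ^ 2 + n * t := Real.sq_sqrt (by positivity)
  set β := (q - α) / n
  have hβ : n * β = q - α := by simp only [β]; field_simp
  have hab : 2 * α * β + n * β ^ 2 = t := by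
    have : n * (2 * α * β + n * β ^ 2) = n * t := by
      calc n * (2 * α * β + n * β ^ 2) = 2 * α * (n * β) + (n * β) ^ 2 := by ring
        _ = q ^ 2 - α ^ 2 := by rw [hβ]; ring
        _ = n * t := by rw [hq]; ring
    exact mul_left_cancel₀ hn'.ne' this
  refine ⟨fun j => α • b j + β • ∑ l, b l, fun j l => ?_⟩
  simp only [inner_add_left, inner_add_right, real_inner_smul_left, real_inner_smul_right, hb, hss,
    hbs, hsb]
  split_ifs with h
  · linear_combination hab + hα
  · linear_combination hab

theorem reproducing_lower_bound (hn : 2 ≤ n) {V : Submodule ℝ C(Sph n, ℝ)}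
    {z : Sph n → C(Sph n, ℝ)} (hz : ∀ u, z u ∈ V) (hr : ∀ u, ∀ f ∈ V, l2 (z u) f = f u)
    (hi : ∀ (ρ : En n ≃ₗᵢ[ℝ] En n) (u v), z (sphMap ρ u) (sphMap ρ v) = z u v)
    (hev : ∀ f ∈ V, ∀ u, f (-u) = f u) (e u : Sph n) : -(z e e) ≤ ((n : ℝ) - 1) * z e u := by
  wlog hpos : 0 ≤ ⟪(u : En n), (e : En n)⟫_ℝ generalizing u
  · have := this (-u) (by rw [coe_neg_sphere, inner_neg_left]; linarith)
    rwa [hev _ (hz e)] at this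
  have hle : ⟪(u : En n), (e : En n)⟫_ℝ ≤ 1 := by
    simpa using real_inner_le_norm (u : En n) (e : En n)
  obtain ⟨w, hw⟩ := exists_equiangular (n := n) (by omega) hpos hle
  have hw1 : ∀ j, ‖w j‖ = 1 := fun j => by
    have := hw j j
    rw [real_inner_self_eq_norm_sq, if_pos rfl] at this
    exact (pow_eq_one_iff_of_nonneg (norm_nonneg _) two_ne_zero).1 this
  set W : Fin n → Sph n := fun j => ⟨w j, by simpa using hw1 j⟩
  have hpair : ∀ u₁ v₁ u₂ v₂ : Sph n, ⟪(v₁ : En n), (u₁ : En n)⟫_ℝ = ⟪(v₂ : En n), (u₂ : En n)⟫_ℝ →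
      z u₁ v₁ = z u₂ v₂ := fun u₁ v₁ u₂ v₂ h => by
    obtain ⟨ρ, hρ, -⟩ := exists_isom ((norm_sph u₁).trans (norm_sph u₂).symm)
    obtain ⟨τ, hτ, hτ'⟩ := exists_isom (u := ρ v₁) (v := (v₂ : En n))
      (by rw [LinearIsometryEquiv.norm_map, norm_sph, norm_sph])
    have h2 := hτ' u₂ (by
      rw [← hρ, LinearIsometryEquiv.inner_map_map, real_inner_comm, h, ← hρ, real_inner_comm])
    rw [← hi ρ, ← hi τ]
    congr 1
    · congr 1
      ext1
      simp only [coe_sphMap, hρ, h2]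
    · ext1
      simp only [coe_sphMap, hτ]
  have hsum : l2 (∑ j, z (W j)) (∑ j, z (W j)) = ∑ j : Fin n, ∑ l : Fin n, if j = l then z e e else z e u := by
    rw [map_sum]
    refine Finset.sum_congr rfl fun j _ => ?_
    rw [map_sum, LinearMap.sum_apply]
    refine Finset.sum_congr rfl fun l _ => ?_
    rw [hr _ _ (hz _)]
    split_ifs with h
    · refine hpair _ _ _ _ ?_
      simp [W, h, hw1]
    · refine hpair _ _ _ _ ?_
      simp only [W]
      rw [hw, if_neg (Ne.symm h)]
  have h0 := l2_self_nonneg (∑ j, z (W j))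
  have hcount : ∑ j : Fin n, ∑ l : Fin n, (if j = l then z e e else z e u) =
      n * (z e e + ((n : ℝ) - 1) * z e u) := by
    have : ∀ j l : Fin n, (if j = l then z e e else z e u) =
        (if j = l then z e e - z e u else 0) + z e u := fun j l => by split_ifs <;> ring
    simp only [this, Finset.sum_add_distrib, Finset.sum_ite_eq, Finset.mem_univ, if_true,
      Finset.sum_const, Finset.card_univ, Fintype.card_fin, nsmul_eq_mul]
    ring
  rw [hsum, hcount] at h0
  have hn' : (0 : ℝ) < n := by exact_mod_cast (by omega : 0 < n)
  have := nonneg_of_mul_nonneg_right h0 hn'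
  linarith

/-! ### Zonal eigenfunctions -/

theorem exists_lap_nonpos_of_zonal {F : En n → ℝ} (hF : IsC2H F) {e : En n} (he : ‖e‖ = 1)
    (hZ : Zonal F e) (hev : ∀ x, F (-x) = F x) {b : En n} (hb : ‖b‖ = 1) (hbe : ⟪b, e⟫_ℝ = 0)
    (hb0 : F b ≤ 0) {u₁ : En n} (hu₁ : ‖u₁‖ = 1) (hp : 0 < F u₁) :
    ∃ u, ‖u‖ = 1 ∧ 0 < F u ∧ lap F u ≤ 0 := by
  wlog h0 : 0 ≤ ⟪u₁, e⟫_ℝ generalizing u₁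
  · exact this (u₁ := -u₁) (by simpa using hu₁) (by rwa [hev])
      (by rw [inner_neg_left]; linarith)
  set t₁ := ⟪u₁, e⟫_ℝ with ht₁
  have ht₁0 : 0 < t₁ := h0.lt_of_ne fun h => by
    have := hZ u₁ b hu₁ hb (by rw [← ht₁, ← h, hbe])
    linarith
  set q := prof F e b with hqdef
  have hq : ∀ u : En n, ‖u‖ = 1 → F u = q ⟪u, e⟫_ℝ := fun u hu => hZ.eq_prof he hb hbe hu
  have hq0 : q 0 = F b := by simp [hqdef, prof]
  have hqe : ∀ t : ℝ, |t| ≤ 1 → q (-t) = q t := fun t ht => by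
    have h1 : q (-t) = F (-((-t) • e + √(1 - (-t) ^ 2) • b)) := by rw [hev]; rfl
    have h2 : ‖-((-t) • e + √(1 - (-t) ^ 2) • b)‖ = 1 := by
      rw [norm_neg]; exact norm_arc he hb hbe (by simpa using ht)
    rw [h1, hq _ h2, inner_neg_left, inner_arc he hbe, neg_neg]
  obtain ⟨d, hd⟩ : ∃ d, HasDerivAt q d 0 := by
    have h1 : DifferentiableAt ℝ (fun t : ℝ => t • e + √(1 - t ^ 2) • b) 0 := by
      have : DifferentiableAt ℝ (fun t : ℝ => √(1 - t ^ 2)) 0 :=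
        DifferentiableAt.sqrt (by fun_prop) (by norm_num)
      fun_prop
    have h2 := (hF.hasFDerivAt (arc_ne_zero he hb hbe 0)).differentiableAt
    exact ⟨_, (h2.comp (0 : ℝ) h1).hasDerivAt⟩
  have hd0 : d = 0 := by
    have h1 : HasDerivAt (fun t => q (-t)) (-d) 0 := by
      have hd' : HasDerivAt q d (-0) := by simpa using hd
      simpa [Function.comp_def] using hd'.comp (0 : ℝ) (hasDerivAt_neg (0 : ℝ))
    have h2 : (fun t => q (-t)) =ᶠ[𝓝 0] q := by
      filter_upwards [Metric.closedBall_mem_nhds (0 : ℝ) one_pos] with t ht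
      exact hqe t (by simpa using ht)
    have := (h1.congr_of_eventuallyEq h2.symm).unique hd
    linarith
  subst hd0
  set μ := F u₁ / t₁
  have hμ : 0 < μ := div_pos hp ht₁0
  obtain ⟨δ, hδ, hsm⟩ : ∃ δ > 0, ∀ t : ℝ, |t| < δ → q t ≤ μ / 2 * |t| := by
    have h1 := (hasDerivAt_iff_isLittleO.1 hd).def (half_pos hμ)
    obtain ⟨δ, hδ, h⟩ := Metric.eventually_nhds_iff.1 h1
    refine ⟨δ, hδ, fun t ht => ?_⟩
    have h2 := h (y := t) (by simpa using ht)
    simp only [sub_zero, smul_zero, Real.norm_eq_abs] at h2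
    have := le_abs_self (q t - q 0)
    linarith
  set m := min δ t₁
  have hm : 0 < m := lt_min hδ ht₁0
  have hS : IsCompact (sphere (0 : En n) 1 ∩ {u | m ≤ ⟪u, e⟫_ℝ}) :=
    (isCompact_sphere _ _).inter_right (isClosed_le continuous_const (by fun_prop))
  have hcont : ContinuousOn (fun u => F u / ⟪u, e⟫_ℝ)
      (sphere (0 : En n) 1 ∩ {u | m ≤ ⟪u, e⟫_ℝ}) := by
    refine ContinuousOn.div (hF.continuousOn.mono fun u hu => ?_) (by fun_prop) fun u hu => ?_
    · exact ne_zero_of_norm_eq_one (by simpa using hu.1)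
    · exact (hm.trans_le hu.2).ne'
  obtain ⟨u₀, ⟨hu₀, hm₀⟩, hmax⟩ := hS.exists_isMaxOn
    ⟨u₁, by simpa using hu₁, min_le_right δ t₁⟩ hcont
  have hu₀1 : ‖u₀‖ = 1 := by simpa using hu₀
  have ht₀ : 0 < ⟪u₀, e⟫_ℝ := hm.trans_le hm₀
  set M := F u₀ / ⟪u₀, e⟫_ℝ with hM
  have hMμ : μ ≤ M := hmax (show u₁ ∈ _ from ⟨by simpa using hu₁, min_le_right δ t₁⟩)
  have hM0 : F u₀ = M * ⟪u₀, e⟫_ℝ := by rw [hM]; field_simp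
  have hunit : ∀ u : En n, ‖u‖ = 1 → 0 < ⟪u, e⟫_ℝ → F u ≤ M * ⟪u, e⟫_ℝ := fun u hu ht => by
    rcases le_or_gt m ⟪u, e⟫_ℝ with h | h
    · have : F u / ⟪u, e⟫_ℝ ≤ M := hmax (show u ∈ _ from ⟨by simpa using hu, h⟩)
      rwa [div_le_iff₀ ht] at this
    · have h1 := hsm ⟪u, e⟫_ℝ (by rw [abs_of_pos ht]; exact h.trans_le (min_le_left _ _))
      rw [abs_of_pos ht, ← hq u hu] at h1
      nlinarith
  have hall : ∀ x : En n, 0 < ⟪x, e⟫_ℝ → F x ≤ M * ⟪x, e⟫_ℝ := fun x hx => by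
    have hx0 : x ≠ 0 := by rintro rfl; simp at hx
    have hnx := norm_pos_iff.2 hx0
    have h1 := hunit (‖x‖⁻¹ • x)
      (by rw [norm_smul, norm_inv, norm_norm, inv_mul_cancel₀ hnx.ne'])
      (by rw [real_inner_smul_left]; positivity)
    rw [hF.map_smul _ (by positivity), real_inner_smul_left] at h1
    have h2 := mul_le_mul_of_nonneg_left h1 hnx.le
    field_simp at h2
    linarith
  have hF0 := hF.contDiffAt (ne_zero_of_norm_eq_one hu₀1)
  refine ⟨u₀, hu₀1, by rw [hM0]; exact mul_pos (hμ.trans_le hMμ) ht₀, ?_⟩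
  rw [lap_eq_sum (EuclideanSpace.basisFun (Fin n) ℝ)]
  refine Finset.sum_nonpos fun j _ => ?_
  have hlin : ∀ x, (M • innerSL ℝ e) x = M * ⟪x, e⟫_ℝ := fun x => by
    simp [real_inner_comm]
  have h1 := D2_nonneg_of_touch (F := fun x => (M • innerSL ℝ e) x) (G := F) (x := u₀)
    (M • innerSL ℝ e).contDiff.contDiffAt hF0 ?_ ?_ (EuclideanSpace.basisFun (Fin n) ℝ j)
  · rw [D2_clm] at h1
    simpa using h1
  · have hev : ∀ᶠ y in 𝓝 u₀, 0 < ⟪y, e⟫_ℝ :=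
      (show Continuous fun y : En n => ⟪y, e⟫_ℝ by fun_prop).continuousAt.eventually
        (lt_mem_nhds ht₀)
    filter_upwards [hev] with y hy
    exact (hall y hy).trans_eq (hlin y).symm
  · exact (hlin u₀).trans hM0.symm

theorem lap_le_of_zonal_max {F : En n → ℝ} (hF : IsC2H F) {e : En n} (he : ‖e‖ = 1)
    (hZ : Zonal F e) {A B : ℝ} (hA : ∀ u, ‖u‖ = 1 → F u ≤ A)
    (hB : ∀ x y, B * ‖x + y‖ + F (x + y) ≤ B * ‖x‖ + F x + (B * ‖y‖ + F y)) {u₀ : En n}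
    (hu₀ : ‖u₀‖ = 1) (hF₀ : F u₀ = A) (hlt : ⟪u₀, e⟫_ℝ ^ 2 < 1) :
    A * ((n : ℝ) - 1) - lap F u₀ ≤ A + B := by
  have hu0 := ne_zero_of_norm_eq_one hu₀
  set t := ⟪u₀, e⟫_ℝ with ht
  set r := √(1 - t ^ 2)
  have hr2 : r ^ 2 = 1 - t ^ 2 := Real.sq_sqrt (by linarith)
  have hr : 0 < r := Real.sqrt_pos.2 (by linarith)
  have hN : IsC2H fun x : En n => A * ‖x‖ := IsC2H.norm.const_mul A
  have hG : IsC2H fun x => A * ‖x‖ - F x := hN.sub hF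
  set G := fun x => A * ‖x‖ - F x with hGdef
  have hGnn : ∀ x, 0 ≤ G x := fun x => by
    have := forall_of_unit_of_smul (F := F) (G := fun x => A * ‖x‖) hF.map_smul
      hN.map_smul (fun u hu => by simpa [hu] using hA u hu) x
    simp only [hGdef]; linarith
  have hD2G : ∀ v w, D2 G u₀ v w = A * (⟪v, w⟫_ℝ - ⟪u₀, v⟫_ℝ * ⟪u₀, w⟫_ℝ) - D2 F u₀ v w :=
    fun v w => by
      rw [hGdef, hN.D2_sub hF hu0, IsC2H.norm.D2_const_mul A hu0, sub_apply, sub_apply, smul_apply,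
        smul_apply, D2_norm_unit hu₀, smul_eq_mul]
  have horb : ∀ w : En n, ‖w‖ = 1 → ⟪w, u₀⟫_ℝ = 0 → ⟪w, e⟫_ℝ = 0 → D2 G u₀ w = 0 :=
    fun w hw hwu hwe => by
      set c : ℝ → En n := fun s => t • e + Real.cos s • (u₀ - t • e) + (r * Real.sin s) • w with hc
      have hc0 : c 0 = u₀ := by simp [hc]
      have hcd : HasDerivAt c (r • w) 0 := by
        have h1 := ((Real.hasDerivAt_cos 0).smul_const (u₀ - t • e)).const_add (t • e)
        have h2 := ((Real.hasDerivAt_sin 0).const_mul r).smul_const w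
        exact (h1.fun_add h2).congr_deriv (by simp)
      have hce : ∀ s, ⟪c s, e⟫_ℝ = t := fun s => by
        simp only [hc, inner_add_left, inner_sub_left, real_inner_smul_left, hwe, ← ht,
          real_inner_self_eq_norm_sq, he]
        ring
      have hcn : ∀ s, ‖c s‖ = 1 := fun s => by
        have hx : ⟪e, u₀⟫_ℝ = t := by rw [real_inner_comm]
        have hy : ⟪u₀, w⟫_ℝ = 0 := by rw [real_inner_comm]; exact hwu
        have hz : ⟪e, w⟫_ℝ = 0 := by rw [real_inner_comm]; exact hwe
        have : ‖c s‖ ^ 2 = 1 := by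
          rw [← real_inner_self_eq_norm_sq]
          simp only [hc, inner_add_left, inner_sub_left, real_inner_smul_left, inner_add_right,
            inner_sub_right, real_inner_smul_right, hwe, hwu, hx, hy, hz, ← ht]
          simp only [real_inner_self_eq_norm_sq, he, hw, hu₀]
          have := Real.sin_sq_add_cos_sq s
          linear_combination (1 - t ^ 2) * this + Real.sin s ^ 2 * hr2
        exact (pow_eq_one_iff_of_nonneg (norm_nonneg _) two_ne_zero).1 this
      have hcG : ∀ s, fderiv ℝ G (c s) = 0 := fun s => by
        have hz : G (c s) = 0 := by
          simp only [hGdef, hcn]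
          rw [hZ _ u₀ (hcn s) hu₀ (hce s), hF₀]
          ring
        have hmin : IsLocalMin G (c s) := Eventually.of_forall fun x => by rw [hz]; exact hGnn x
        exact hmin.fderiv_eq_zero
      have h1 : HasDerivAt (fun s => fderiv ℝ G (c s)) (D2 G u₀ (r • w)) 0 := by
        have h2 := hG.hasFDerivAt_fderiv hu0
        rw [← hc0] at h2 ⊢
        exact h2.comp_hasDerivAt (0 : ℝ) hcd
      simp only [hcG] at h1
      have h2 := h1.unique (hasDerivAt_const (0 : ℝ) (0 : En n →L[ℝ] ℝ))
      rw [map_smul] at h2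
      exact (smul_eq_zero.1 h2).resolve_left hr.ne'
  have horb' : ∀ w : En n, ⟪w, u₀⟫_ℝ = 0 → ⟪w, e⟫_ℝ = 0 → D2 G u₀ w = 0 := fun w h1 h2 => by
    rcases eq_or_ne w 0 with rfl | hw
    · simp
    have hnw := norm_ne_zero_iff.2 hw
    have := horb (‖w‖⁻¹ • w) (by rw [norm_smul, norm_inv, norm_norm, inv_mul_cancel₀ hnw])
      (by rw [real_inner_smul_left, h1, mul_zero]) (by rw [real_inner_smul_left, h2, mul_zero])
    rw [map_smul] at this
    exact (smul_eq_zero.1 this).resolve_left (inv_ne_zero hnw)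
  set w₁ := r⁻¹ • (e - t • u₀) with hw₁
  have hw₁u : ⟪w₁, u₀⟫_ℝ = 0 := by
    rw [hw₁, real_inner_smul_left, inner_sub_left, real_inner_smul_left, real_inner_comm, ← ht,
      real_inner_self_eq_norm_sq, hu₀]
    ring
  have hw₁e : ⟪w₁, e⟫_ℝ = r := by
    rw [hw₁, real_inner_smul_left, inner_sub_left, real_inner_smul_left, ← ht,
      real_inner_self_eq_norm_sq, he]
    field_simp
    linarith
  have hw₁n : ⟪w₁, w₁⟫_ℝ = 1 := by
    nth_rewrite 2 [hw₁]
    rw [real_inner_smul_right, inner_sub_right, real_inner_smul_right, hw₁e, hw₁u]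
    field_simp
    ring
  have hrank : ∀ v, D2 G u₀ v v = ⟪v, w₁⟫_ℝ ^ 2 * D2 G u₀ w₁ w₁ := fun v => by
    have hv : D2 G u₀ v = ⟪v, w₁⟫_ℝ • D2 G u₀ w₁ := by
      have h1 := horb' (v - ⟪v, u₀⟫_ℝ • u₀ - ⟪v, w₁⟫_ℝ • w₁)
        (by rw [inner_sub_left, inner_sub_left, real_inner_smul_left, real_inner_smul_left, hw₁u,
              real_inner_self_eq_norm_sq, hu₀]; ring)
        (by
          have : ⟪v, w₁⟫_ℝ = r⁻¹ * (⟪v, e⟫_ℝ - t * ⟪v, u₀⟫_ℝ) := by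
            rw [hw₁, real_inner_smul_right, inner_sub_right, real_inner_smul_right]
          rw [inner_sub_left, inner_sub_left, real_inner_smul_left, real_inner_smul_left, hw₁e,
            ← ht, this]
          field_simp
          ring)
      rw [map_sub, map_sub, map_smul, map_smul, hG.D2_self hu0, smul_zero, sub_zero,
        sub_eq_zero] at h1
      exact h1
    rw [hv, smul_apply, hG.D2_symm hu0, hv, smul_apply, smul_eq_mul, smul_eq_mul]
    ring
  have hlapG : lap G u₀ = D2 G u₀ w₁ w₁ := by
    rw [lap_eq_sum (EuclideanSpace.basisFun (Fin n) ℝ)]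
    rw [Finset.sum_congr rfl fun j _ => hrank _, ← Finset.sum_mul]
    have h1 := (EuclideanSpace.basisFun (Fin n) ℝ).sum_sq_norm_inner_right w₁
    simp only [Real.norm_eq_abs, sq_abs, real_inner_self_eq_norm_sq] at h1 hw₁n
    rw [h1, hw₁n, one_mul]
  have hlapG' : lap G u₀ = A * ((n : ℝ) - 1) - lap F u₀ := by
    rw [hGdef, hN.lap_sub hF hu0, IsC2H.norm.lap_const_mul A hu0, lap_norm hu₀]
  have hQ : IsC2H fun x : En n => B * ‖x‖ + F x := (IsC2H.norm.const_mul B).add hF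
  have hQ0 := hQ.D2_nonneg hB hu0 w₁
  rw [(IsC2H.norm.const_mul B).D2_add hF hu0, IsC2H.norm.D2_const_mul B hu0, add_apply, add_apply,
    smul_apply, smul_apply, D2_norm_unit hu₀, real_inner_comm w₁ u₀, hw₁u, hw₁n] at hQ0
  have h2 := hD2G w₁ w₁
  rw [real_inner_comm w₁ u₀, hw₁u, hw₁n] at h2
  simp only [mul_zero, sub_zero, mul_one, smul_eq_mul] at hQ0 h2
  linarith

/-! ### Spectral gap for the convolution operators -/

theorem IsC2H.ext_unit {F G : En n → ℝ} (hF : IsC2H F) (hG : IsC2H G)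
    (h : ∀ u, ‖u‖ = 1 → F u = G u) : F = G := by
  funext x
  exact le_antisymm
    (forall_of_unit_of_smul (F := F) (G := G) hF.map_smul hG.map_smul (fun u hu => (h u hu).le) x)
    (forall_of_unit_of_smul (F := G) (G := F) hG.map_smul hF.map_smul (fun u hu => (h u hu).ge) x)

theorem KData.integral_k (hn : 3 ≤ n) {g k : C(ℝ, ℝ)} (D : KData n g k) {a : ℝ}
    (hg : ∀ u : Sph n, ∫ v : Sph n, g ⟪(u : En n), (v : En n)⟫_ℝ ∂(sphVol n) = a) (u : Sph n) :
    ∫ v : Sph n, k ⟪(u : En n), (v : En n)⟫_ℝ ∂(sphVol n) = a := by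
  have hn0 : 0 < n := by omega
  have hN : IsC2H fun x : En n => a * ‖x‖ := IsC2H.norm.const_mul a
  have h1 : TT g (1 : C(Sph n, ℝ)) = fun x => a * ‖x‖ := by
    refine (isC2H_TT hn0 g.continuous D.zg 1).ext_unit hN fun u hu => ?_
    rw [TT_unit _ _ hu, hu, mul_one, ← hg ⟨u, by simpa using hu⟩]
    simp
  have h2 := lap_TT hn0 g.continuous D.zg D.lap_zg (1 : C(Sph n, ℝ)) (norm_sph u)
  rw [h1, IsC2H.norm.lap_const_mul a (sphere_ne_zero u), lap_norm (norm_sph u), mul_comm] at h2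
  have h3 : (n : ℝ) - 1 ≠ 0 := by
    have : (3 : ℝ) ≤ n := by exact_mod_cast hn
    linarith
  have h4 := mul_left_cancel₀ h3 h2
  rw [h4]
  simp

theorem KData.kernel_pos {g k : C(ℝ, ℝ)} (D : KData n g k) (u : Sph n) {f : C(Sph n, ℝ)}
    (hf : ∀ v, 0 ≤ f v) {w : Sph n} (hw : f w ≠ 0) : 0 < Top k f u := by
  have h := integral_pos_of_nonneg (f := kerC k u * f)
    (fun v => mul_nonneg (D.kpos u v (norm_sph u) (norm_sph v)).le (hf v)) (v := w)
    (mul_ne_zero (D.kpos u w (norm_sph u) (norm_sph w)).ne' hw)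
  exact h

theorem KData.eigenvalue_lt_of_zonal (hn : 3 ≤ n) {g k : C(ℝ, ℝ)} (D : KData n g k) {a₀ : ℝ}
    (hg : ∀ u : Sph n, ∫ v : Sph n, g ⟪(u : En n), (v : En n)⟫_ℝ ∂(sphVol n) = a₀)
    {P : C(Sph n, ℝ)} {e : Sph n} (hPe : 0 < P e) (hlow : ∀ u, -(P e) ≤ ((n : ℝ) - 1) * P u)
    (hZ : ∀ u u' : Sph n, ⟪(u : En n), (e : En n)⟫_ℝ = ⟪(u' : En n), (e : En n)⟫_ℝ → P u = P u')
    (hev : ∀ u, P (-u) = P u) (hmean : ∫ v, P v ∂(sphVol n) = 0) {l a : ℝ}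
    (hkP : Top k P = l • P) (hgP : Top g P = a • P) : ((n : ℝ) - 1) * |l| < a₀ := by
  have hn0 : 0 < n := by omega
  have hn3 : (3 : ℝ) ≤ n := by exact_mod_cast hn
  have hk := D.integral_k hn hg
  have ha₀ : 0 < a₀ := by
    have := D.kernel_pos e (f := 1) (fun v => zero_le_one) (w := e) one_ne_zero
    rw [Top_apply] at this
    simpa [hk e] using this
  rcases lt_trichotomy l 0 with hl | rfl | hl
  · have h1 := D.kernel_pos e (f := ((n : ℝ) - 1) • P + P e • (1 : C(Sph n, ℝ)))
      (fun v => by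
        have := hlow v
        simp only [ContinuousMap.add_apply, ContinuousMap.smul_apply, ContinuousMap.one_apply,
          smul_eq_mul, mul_one]
        linarith) (w := e)
      (by
        simp only [ContinuousMap.add_apply, ContinuousMap.smul_apply, ContinuousMap.one_apply,
          smul_eq_mul, mul_one]
        nlinarith)
    have h2 : Top k (1 : C(Sph n, ℝ)) e = a₀ := by rw [Top_apply, ← hk e]; simp
    rw [map_add, map_smul, map_smul, hkP] at h1
    simp only [ContinuousMap.add_apply, ContinuousMap.smul_apply, smul_eq_mul, h2] at h1
    rw [abs_of_neg hl]
    have h3 : 0 < P e * (((n : ℝ) - 1) * l + a₀) := by linarith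
    have := (mul_pos_iff_of_pos_left hPe).1 h3
    linarith
  · simpa using ha₀
  rw [abs_of_pos hl]
  have hFC : IsC2H (TT g P) := isC2H_TT hn0 g.continuous D.zg P
  have hFu : ∀ u : Sph n, TT g P u = a * P u := fun u => by
    rw [TT_unit _ _ (norm_sph u), ← Top_apply, hgP]; rfl
  have hFl : ∀ u : Sph n, lap (TT g P) u = ((n : ℝ) - 1) * (l * P u) := fun u => by
    rw [lap_TT hn0 g.continuous D.zg D.lap_zg P (norm_sph u), ← Top_apply, hkP]; rfl
  have hFZ : Zonal (TT g P) e := fun u u' hu hu' h => by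
    have h1 := hFu ⟨u, by simpa using hu⟩
    have h2 := hFu ⟨u', by simpa using hu'⟩
    rw [h1, h2, hZ ⟨u, by simpa using hu⟩ ⟨u', by simpa using hu'⟩ h]
  have hFe : ∀ x, TT g P (-x) = TT g P x := fun x => by
    refine congrFun ((hFC.comp_isom (LinearIsometryEquiv.neg ℝ)).ext_unit hFC fun u hu => ?_) x
    have h1 := hFu ⟨u, by simpa using hu⟩
    have h2 := hFu (-⟨u, by simpa using hu⟩)
    rw [coe_neg_sphere] at h2
    simp only [LinearIsometryEquiv.coe_neg]
    rw [h1, h2, hev]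
  obtain ⟨u₂, hu₂⟩ : ∃ u, P u < 0 := by
    by_contra! h
    exact (integral_pos_of_nonneg h hPe.ne').ne' hmean
  have hnl : 0 < ((n : ℝ) - 1) * l := mul_pos (by linarith) hl
  rcases lt_trichotomy a 0 with ha | rfl | ha
  · obtain ⟨u₀, -, hu₀⟩ := (isCompact_univ (X := Sph n)).exists_isMinOn ⟨e, trivial⟩
      P.continuous.continuousOn
    have hmin : ∀ u, P u₀ ≤ P u := fun u => hu₀ (Set.mem_univ u)
    have hp : P u₀ < 0 := (hmin u₂).trans_lt hu₂
    have hlt : ⟪(u₀ : En n), (e : En n)⟫_ℝ ^ 2 < 1 := by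
      have h1 := abs_real_inner_le_norm (u₀ : En n) (e : En n)
      rw [norm_sph, norm_sph, mul_one] at h1
      refine lt_of_le_of_ne (by rw [← sq_abs]; exact pow_le_one₀ (abs_nonneg _) h1) fun h => ?_
      rcases (sq_eq_sq_iff_eq_or_eq_neg.1 (h.trans (one_pow 2).symm)) with h | h
      · have := hZ u₀ e (by rw [h, real_inner_self_eq_norm_sq, norm_sph]; norm_num)
        linarith
      · have := hZ u₀ (-e) (by
          rw [h, coe_neg_sphere, inner_neg_left, real_inner_self_eq_norm_sq, norm_sph]; norm_num)
        rw [hev] at this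
        linarith
    have key := lap_le_of_zonal_max hFC (norm_sph e) hFZ (A := a * P u₀) (B := -(P u₀) * a₀)
      (fun u hu => by
        have h1 := hFu ⟨u, by simpa using hu⟩
        rw [h1]
        exact mul_le_mul_of_nonpos_left (hmin _) ha.le) ?_ (norm_sph u₀) (hFu u₀) hlt
    · rw [hFl] at key
      have h1 : 0 < -(P u₀) * (-a * ((n : ℝ) - 2)) :=
        mul_pos (by linarith) (mul_pos (by linarith) (by linarith))
      have h2 : 0 < -(P u₀) * (a₀ - ((n : ℝ) - 1) * l) := by linarith
      have := (mul_pos_iff_of_pos_left (by linarith)).1 h2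
      linarith
    · have hQ : (fun x : En n => -(P u₀) * a₀ * ‖x‖ + TT g P x) =
          TT g (P + (-(P u₀)) • (1 : C(Sph n, ℝ))) := by
        refine ((IsC2H.norm.const_mul _).add hFC).ext_unit
          (isC2H_TT hn0 g.continuous D.zg _) fun u hu => ?_
        have h1 : Top g (P + (-(P u₀)) • (1 : C(Sph n, ℝ))) ⟨u, by simpa using hu⟩ =
            TT g (P + (-(P u₀)) • (1 : C(Sph n, ℝ))) u := (TT_unit _ _ hu).symm
        have h2 : Top g (1 : C(Sph n, ℝ)) ⟨u, by simpa using hu⟩ = a₀ := by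
          rw [Top_apply, ← hg ⟨u, by simpa using hu⟩]; simp
        have h3 : Top g P ⟨u, by simpa using hu⟩ = TT g P u := (TT_unit _ _ hu).symm
        rw [← h1, map_add, map_smul, ContinuousMap.add_apply, ContinuousMap.smul_apply, h2, h3, hu,
          smul_eq_mul]
        ring
      intro x y
      have hc : ∀ x : En n, Continuous fun v : Sph n => zon g v x := fun x =>
        (continuous_zon_left g.continuous x).comp continuous_subtype_val
      have hcQ := (P + (-(P u₀)) • (1 : C(Sph n, ℝ))).continuous
      have hsub : TT g (P + (-(P u₀)) • (1 : C(Sph n, ℝ))) (x + y) ≤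
          TT g (P + (-(P u₀)) • (1 : C(Sph n, ℝ))) x +
            TT g (P + (-(P u₀)) • (1 : C(Sph n, ℝ))) y := by
        unfold TT
        have hi := fun x : En n => integrable_sph (f := fun v : Sph n =>
          (P + (-(P u₀)) • (1 : C(Sph n, ℝ))) v * zon g v x) (hcQ.mul (hc x))
        rw [← integral_add (hi x) (hi y)]
        refine integral_mono (hi _) ((hi x).add (hi y)) fun v => ?_
        simp only
        rw [← mul_add]
        refine mul_le_mul_of_nonneg_left (D.sub v (norm_sph v) x y) ?_
        simpa using hmin v
      rw [← hQ] at hsub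
      exact hsub
  · have h0 : TT g P = fun x => (0 : ℝ) * ‖x‖ :=
      hFC.ext_unit (IsC2H.norm.const_mul 0) fun u hu => by
        have h1 := hFu ⟨u, by simpa using hu⟩
        rw [h1]; ring
    have h1 := hFl e
    rw [h0, IsC2H.norm.lap_const_mul 0 (sphere_ne_zero e), zero_mul, ← mul_assoc] at h1
    exact absurd h1 (mul_pos hnl hPe).ne
  · exfalso
    obtain ⟨b, hb, hbe⟩ : ∃ b : En n, ‖b‖ = 1 ∧ ⟪b, (e : En n)⟫_ℝ = 0 := by
      obtain ⟨ρ, hρ, -⟩ := exists_isom (u := EuclideanSpace.single (⟨0, hn0⟩ : Fin n) (1 : ℝ))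
        (v := (e : En n)) (by rw [norm_sph]; simp)
      refine ⟨ρ (EuclideanSpace.single (⟨1, by omega⟩ : Fin n) 1), by simp, ?_⟩
      rw [← hρ, LinearIsometryEquiv.inner_map_map, EuclideanSpace.inner_single_left]
      simp
    have main : ∀ s : ℝ, s ^ 2 = 1 → s * P ⟨b, by simpa using hb⟩ ≤ 0 →
        ∀ u₁ : Sph n, 0 < s * P u₁ → False := fun s hs hb' u₁ hu₁ => by
      obtain ⟨u, hu, h1, h2⟩ := exists_lap_nonpos_of_zonal (hFC.const_mul s) (norm_sph e)
        (fun u u' hu hu' h => by simp only [hFZ u u' hu hu' h]) (fun x => by simp only [hFe]) hb hbe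
        (by
          have h1 := hFu ⟨b, by simpa using hb⟩
          rw [h1]
          nlinarith)
        (norm_sph u₁) (by rw [hFu]; nlinarith)
      have h3 := hFu ⟨u, by simpa using hu⟩
      have h4 := hFl ⟨u, by simpa using hu⟩
      rw [hFC.lap_const_mul s (ne_zero_of_norm_eq_one hu), h4] at h2
      rw [h3] at h1
      have h5 : 0 < a * (s * P ⟨u, by simpa using hu⟩) := by linarith
      have h6 := mul_pos hnl ((mul_pos_iff_of_pos_left ha).1 h5)
      linarith
    rcases le_total (P ⟨b, by simpa using hb⟩) 0 with h | h
    · exact main 1 (by norm_num) (by linarith) e (by linarith)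
    · exact main (-1) (by norm_num) (by linarith) u₂ (by linarith)

/-! ### Absence of extremal eigenvalues -/

theorem mem_eigV {κ : C(ℝ, ℝ)} {l : ℝ} {f : C(Sph n, ℝ)} :
    f ∈ eigV κ l ↔ (∀ u, f (-u) = f u) ∧ l2 1 f = 0 ∧ Top κ f = l • f := Iff.rfl

theorem l2_one_Top {κ : C(ℝ, ℝ)} {a : ℝ}
    (ha : ∀ u : Sph n, ∫ v : Sph n, κ ⟪(u : En n), (v : En n)⟫_ℝ ∂(sphVol n) = a)
    (f : C(Sph n, ℝ)) : l2 1 (Top κ f) = a * l2 1 f := by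
  simpa [l2_apply] using integral_Top ha f

theorem KData.const_pos {g k : C(ℝ, ℝ)} (D : KData n g k) {a₀ : ℝ} (e : Sph n)
    (hk : ∀ u : Sph n, ∫ v : Sph n, k ⟪(u : En n), (v : En n)⟫_ℝ ∂(sphVol n) = a₀) : 0 < a₀ := by
  have := D.kernel_pos e (f := 1) (fun v => zero_le_one) (w := e) one_ne_zero
  rw [Top_apply] at this
  simpa [hk e] using this

theorem KData.eigV_eq_bot (hn : 3 ≤ n) {g k : C(ℝ, ℝ)} (D : KData n g k) {a₀ : ℝ}
    (hg : ∀ u : Sph n, ∫ v : Sph n, g ⟪(u : En n), (v : En n)⟫_ℝ ∂(sphVol n) = a₀) {l : ℝ}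
    (hl : a₀ ≤ ((n : ℝ) - 1) * |l|) : eigV (n := n) k l = ⊥ := by
  have hn0 : 0 < n := by omega
  obtain ⟨e⟩ : Nonempty (Sph n) := ⟨⟨EuclideanSpace.single (⟨0, hn0⟩ : Fin n) (1 : ℝ), by simp⟩⟩
  have ha₀ := D.const_pos e (D.integral_k hn hg)
  have hl0 : l ≠ 0 := by
    rintro rfl
    simp at hl
    linarith
  by_contra hne
  have hfin := finiteDimensional_eigV (n := n) k hl0
  have hnt : Nontrivial (eigV (n := n) k l) := Submodule.nontrivial_iff_ne_bot.2 hne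
  have hT : ∀ f ∈ eigV (n := n) k l, (Top (n := n) g).toLinearMap f ∈ eigV k l :=
    fun f hf => by
      obtain ⟨h1, h2, h3⟩ := mem_eigV.1 hf
      change Top g f ∈ eigV k l
      refine mem_eigV.2 ⟨Top_neg hn0 g f h1, ?_, ?_⟩
      · rw [l2_one_Top hg, h2, mul_zero]
      · rw [← Top_comm hn0 g k, h3, map_smul]
  obtain ⟨a, x, hx0, hx⟩ := exists_eigenvector
    (l2.domRestrict₁₂ (eigV (n := n) k l) (eigV (n := n) k l))
    (fun x y => l2_comm _ _) (fun x hx => l2_self_pos (by simpa using hx))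
    ((Top (n := n) g).toLinearMap.restrict hT) (fun x y => l2_Top g _ _)
  have hxg : Top g (x : C(Sph n, ℝ)) = a • (x : C(Sph n, ℝ)) := congrArg Subtype.val hx
  set V := eigV (n := n) k l ⊓ eigV g a
  have hxV : (x : C(Sph n, ℝ)) ∈ V :=
    ⟨x.2, mem_eigV.2 ⟨(mem_eigV.1 x.2).1, (mem_eigV.1 x.2).2.1, hxg⟩⟩
  have hVne : V ≠ ⊥ := fun h => by
    rw [h, Submodule.mem_bot] at hxV
    exact hx0 (by simpa using hxV)
  have hVfin : FiniteDimensional ℝ V := Submodule.finiteDimensional_inf_left _ _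
  obtain ⟨z, hz, hr, hi, hp⟩ := exists_reproducing hn0 V
    (fun ρ f hf => ⟨comp_isom_mem_eigV hn0 ρ hf.1, comp_isom_mem_eigV hn0 ρ hf.2⟩) hVne
  have hlow := reproducing_lower_bound (by omega) hz hr hi (fun f hf => hf.1.1) e
  obtain ⟨⟨h1, h2, h3⟩, -, -, h4⟩ := hz e
  refine (D.eigenvalue_lt_of_zonal hn hg (hp e) hlow (fun u u' huu => ?_) h1
    (by simpa [l2_apply] using h2) h3 h4).not_ge hl
  obtain ⟨ρ, hρ, hfix⟩ := exists_isom (u := (u : En n)) (v := (u' : En n))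
    (by rw [norm_sph, norm_sph])
  have h5 : sphMap ρ u = u' := Subtype.ext hρ
  have h6 : sphMap ρ e = e := Subtype.ext (hfix e (by rw [real_inner_comm, huu, real_inner_comm]))
  rw [← hi ρ e u, h5, h6]

theorem KData.exists_antilipschitz (hn : 3 ≤ n) {g k : C(ℝ, ℝ)} (D : KData n g k) {a₀ : ℝ}
    (hg : ∀ u : Sph n, ∫ v : Sph n, g ⟪(u : En n), (v : En n)⟫_ℝ ∂(sphVol n) = a₀) {l : ℝ}
    (hl0 : l ≠ 0) (hl : a₀ ≤ ((n : ℝ) - 1) * |l|) :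
    ∃ C : ℝ, ∀ f : C(Sph n, ℝ), (∀ u, f (-u) = f u) → l2 1 f = 0 →
      ‖f‖ ≤ C * ‖Top k (Top k f) - l ^ 2 • f‖ := by
  have hn0 : 0 < n := by omega
  obtain ⟨e⟩ : Nonempty (Sph n) := ⟨⟨EuclideanSpace.single (⟨0, hn0⟩ : Fin n) (1 : ℝ), by simp⟩⟩
  have hk := D.integral_k hn hg
  have hone : l2 (1 : C(Sph n, ℝ)) 1 ≠ 0 := (l2_self_pos fun h => by
    simpa using congrArg (fun f : C(Sph n, ℝ) => f e) h).ne'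
  set c := a₀ / l2 (1 : C(Sph n, ℝ)) 1
  -- the even, centred version of the kernel
  set k' : C(ℝ, ℝ) := (2 : ℝ)⁻¹ • (k + k.comp ⟨fun t => -t, continuous_neg⟩) -
    ContinuousMap.const ℝ c
  have hk' : ∀ (f : C(Sph n, ℝ)) (u : Sph n),
      Top k' f u = 2⁻¹ * (Top k f u + Top k f (-u)) - c * l2 1 f := fun f u => by
    have h1 : ∀ w : Sph n, Integrable (fun v : Sph n => k ⟪(w : En n), (v : En n)⟫_ℝ * f v)
        (sphVol n) := fun w => integrable_sph ((kerC k w * f).continuous)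
    have h2 : Integrable (fun v : Sph n => 2⁻¹ * (k ⟪(u : En n), (v : En n)⟫_ℝ * f v +
        k ⟪((-u : Sph n) : En n), (v : En n)⟫_ℝ * f v)) (sphVol n) :=
      ((h1 u).add (h1 (-u))).const_mul _
    have h3 : Integrable (fun v : Sph n => c * ((1 : C(Sph n, ℝ)) v * f v)) (sphVol n) :=
      (integrable_sph ((1 : C(Sph n, ℝ)) * f).continuous).const_mul c
    rw [Top_apply, Top_apply, Top_apply, l2_apply, ← integral_add (h1 u) (h1 (-u)),
      ← integral_const_mul, ← integral_const_mul, ← integral_sub h2 h3]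
    refine integral_congr_ae (Eventually.of_forall fun v => ?_)
    simp only [k', coe_neg_sphere, inner_neg_left, ContinuousMap.sub_apply,
      ContinuousMap.smul_apply, ContinuousMap.add_apply, ContinuousMap.comp_apply,
      ContinuousMap.coe_mk, ContinuousMap.const_apply, ContinuousMap.one_apply, smul_eq_mul]
    ring
  have heq : ∀ f : C(Sph n, ℝ), (∀ u, f (-u) = f u) → l2 1 f = 0 → Top k' f = Top k f :=
    fun f h1 h2 => by
      ext u
      rw [hk', h2, Top_neg hn0 k f h1]
      ring
  have hran : ∀ f : C(Sph n, ℝ), (∀ u, Top k' f (-u) = Top k' f u) ∧ l2 1 (Top k' f) = 0 :=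
    fun f => by
      refine ⟨fun u => ?_, ?_⟩
      · rw [hk', hk', neg_neg, add_comm]
      · have h1 : Top k' f = (2 : ℝ)⁻¹ • (Top k f +
            (Top k f).comp (sphMap (LinearIsometryEquiv.neg ℝ))) - (c * l2 1 f) • 1 := by
          ext u
          have : sphMap (LinearIsometryEquiv.neg ℝ) u = -u := Subtype.ext (by simp [coe_sphMap])
          rw [hk']
          simp only [ContinuousMap.sub_apply, ContinuousMap.smul_apply, ContinuousMap.add_apply,
            ContinuousMap.comp_apply, ContinuousMap.one_apply, smul_eq_mul, mul_one, this]
        have h2 : l2 1 ((Top k f).comp (sphMap (LinearIsometryEquiv.neg ℝ))) = l2 1 (Top k f) :=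
          l2_comp_isom hn0 (LinearIsometryEquiv.neg ℝ) 1 (Top k f)
        rw [h1, map_sub, map_smul, map_add, map_smul, h2, l2_one_Top hk]
        simp only [smul_eq_mul, c]
        field_simp
        ring
  have hT : IsCompactOperator (Top (n := n) k' ∘L Top k') :=
    (isCompactOperator_Top k').comp_clm (Top k')
  have hbot : ∀ s : ℝ, |s| = |l| → eigV (n := n) k s = ⊥ := fun s hs =>
    D.eigV_eq_bot hn hg (by rwa [hs])
  obtain ⟨K, hK⟩ := hT.antilipschitz_of_not_hasEigenvalue (pow_ne_zero 2 hl0) fun h => by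
    obtain ⟨x, hx⟩ := h.exists_hasEigenvector
    have h1 : Top k' (Top k' x) = l ^ 2 • x := hx.apply_eq_smul
    have hx0 : x ≠ 0 := hx.2
    have hl2 : l ^ 2 ≠ 0 := pow_ne_zero 2 hl0
    have hxe : (∀ u, x (-u) = x u) ∧ l2 1 x = 0 := by
      have h2 : x = (l ^ 2)⁻¹ • Top k' (Top k' x) := by rw [h1, inv_smul_smul₀ hl2]
      rw [h2]
      exact ⟨fun u => by simp [(hran _).1], by rw [map_smul, (hran _).2, smul_zero]⟩
    rw [heq _ (hran x).1 (hran x).2, heq x hxe.1 hxe.2] at h1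
    have hmem : ∀ s : ℝ, |s| = |l| → Top k x + s • x = 0 := fun s hs => by
      have hss : s ^ 2 = l ^ 2 := by rw [← sq_abs, hs, sq_abs]
      have : Top k x + s • x ∈ eigV k s := mem_eigV.2 ⟨fun u => by
        simp [hxe.1, Top_neg hn0 k x hxe.1], by
          rw [map_add, map_smul, l2_one_Top hk, hxe.2]; simp, by
          rw [map_add, map_smul, h1, smul_add, smul_smul, ← pow_two, hss, add_comm]⟩
      rwa [hbot s hs, Submodule.mem_bot] at this
    have h3 := hmem l rfl
    have h4 := hmem (-l) (abs_neg l)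
    have h5 : (2 * l) • x = 0 := by
      have : (2 * l) • x = (Top k x + l • x) - (Top k x + (-l) • x) := by module
      rw [this, h3, h4, sub_zero]
    exact hx0 ((smul_eq_zero.1 h5).resolve_left (mul_ne_zero two_ne_zero hl0))
  refine ⟨K, fun f h1 h2 => ?_⟩
  have h3 := hK.le_mul_dist f 0
  rw [map_zero, dist_zero_right, dist_zero_right] at h3
  have h4 : (Top (n := n) k' ∘L Top k' - l ^ 2 • 1) f = Top k (Top k f) - l ^ 2 • f := by
    rw [sub_apply, smul_apply, ContinuousLinearMap.comp_apply,
      heq _ (hran f).1 (hran f).2, heq f h1 h2]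
    rfl
  rwa [h4] at h3

/-! ### First order expansion of the valuation at the ball -/

theorem exists_phi_expansion (hn : 2 ≤ n) {i : ℕ} (hi : i ≤ n - 1) {η : ℝ} (hη : 0 < η) :
    ∃ δ > 0, ∀ E : En n →L[ℝ] En n, ‖E‖ ≤ δ → 0 ≤ phi (⟨0, by omega⟩ : Fin n) i E ∧
      |phi (⟨0, by omega⟩ : Fin n) i E - 1 - (i : ℝ) / (n - 1 : ℕ) * trL E| ≤ η * ‖E‖ := by
  have h1 := (hasFDerivAt_iff_isLittleO_nhds_zero.1 (hasFDerivAt_phi hn hi)).def hη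
  have h2 := (continuous_phi (⟨0, by omega⟩ : Fin n) i).continuousAt.eventually
    (lt_mem_nhds (show (0 : ℝ) < phi (⟨0, by omega⟩ : Fin n) i 0 by rw [phi_zero]; exact one_pos))
  obtain ⟨δ, hδ, h⟩ := Metric.eventually_nhds_iff.1 (h1.and h2)
  refine ⟨δ / 2, half_pos hδ, fun E hE => ?_⟩
  obtain ⟨h3, h4⟩ := h (y := E) (by rw [dist_zero_right]; linarith)
  refine ⟨h4.le, ?_⟩
  simpa [phi_zero, zero_add] using h3

section Expansion

variable {i : ℕ} {Φ : ConvexBody (En n) → ConvexBody (En n)} {g k : C(ℝ, ℝ)} {a₀ : ℝ}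
  {K : ConvexBody (En n)}

theorem GeneratedBy.supp_eq (hn : 2 ≤ n) (hgen : GeneratedBy i Φ g) (hK : IsC2H (supp K))
    {s : C(Sph n, ℝ)} (hs : ∀ u : Sph n, s u = areaDens (⟨0, by omega⟩ : Fin n) i K u)
    (hs0 : ∀ u, 0 ≤ s u) (u : Sph n) : supp (Φ K) u = Top g s u := by
  rw [hgen K _ (isAreaMeasure_areaDens hn hK fun u => (hs0 u).trans_eq (hs u)) u (norm_sph u),
    integral_withDensity_eq_integral_toReal_smul, Top_apply]
  · refine integral_congr_ae (Eventually.of_forall fun v => ?_)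
    simp only [← hs, ENNReal.toReal_ofReal (hs0 v), smul_eq_mul, mul_comm]
  · exact (continuous_areaDens hK).measurable.ennreal_ofReal
  · exact Eventually.of_forall fun v => ENNReal.ofReal_lt_top

theorem hessOp_comp_neg {F : En n → ℝ} (hF : IsC2H F) {x : En n} (hx : x ≠ 0) :
    hessOp (fun y => F (-y)) x = hessOp F (-x) := by
  ext1 v
  refine ext_inner_right ℝ fun w => ?_
  have h := D2_comp_isom hF (LinearIsometryEquiv.neg ℝ) hx v w
  simp only [LinearIsometryEquiv.coe_neg, map_neg, neg_apply, neg_neg] at h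
  rw [inner_hessOp, inner_hessOp, h]

theorem areaDens_scale_neg (z : Fin n) (hK : IsC2H (supp K)) (u : Sph n) :
    areaDens z i (scale (-1) K) u = areaDens z i K (-(u : En n)) := by
  have h : (fun x => supp (scale (-1) K) x - ‖x‖) =
      fun x => (fun y => supp K y - ‖y‖) (-x) := by
    funext x
    simp only [supp_scale_neg, norm_neg]
  rw [areaDens, areaDens, h, hessOp_comp_neg (isC2H_sub_norm hK) (sphere_ne_zero u)]

theorem isC2H_supp_scale_neg (hK : IsC2H (supp K)) : IsC2H (supp (scale (-1) K)) := by
  have h : supp (scale (-1) K) = fun x => supp K (LinearIsometryEquiv.neg ℝ x) := by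
    funext x
    rw [supp_scale_neg]; rfl
  rw [h]
  exact hK.comp_isom _

theorem GeneratedBy.supp_neg (hn : 2 ≤ n) (hgen : GeneratedBy i Φ g) (heven : IsEven Φ)
    (hK : IsC2H (supp K)) {s : C(Sph n, ℝ)}
    (hs : ∀ u : Sph n, s u = areaDens (⟨0, by omega⟩ : Fin n) i K u)
    (hs0 : ∀ u, 0 ≤ s u) (u : Sph n) : supp (Φ K) (-(u : En n)) = supp (Φ K) u := by
  set ν : En n ≃ₗᵢ[ℝ] En n := LinearIsometryEquiv.neg ℝ
  have hν : ∀ u, sphMap ν u = -u := fun u => Subtype.ext (by simp [coe_sphMap, ν])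
  have h1 := hgen.supp_eq hn (isC2H_supp_scale_neg hK) (s := s.comp (sphMap ν))
    (fun u => by
      rw [areaDens_scale_neg _ hK, ContinuousMap.comp_apply, hs, hν, coe_neg_sphere])
    (fun u => hs0 _) u
  rw [heven K, Top_comp_isom (by omega), ContinuousMap.comp_apply, hν,
    ← hgen.supp_eq hn hK hs hs0, coe_neg_sphere] at h1
  exact h1.symm

theorem KData.Top_lap (hn : 3 ≤ n) (D : KData n g k) {F : En n → ℝ} (hF : IsC2H F)
    {f f' : C(Sph n, ℝ)} (hf : ∀ u : Sph n, f u = F u) (hf' : ∀ u : Sph n, f' u = lap F u) :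
    Top g f' = ((n : ℝ) - 1) • Top k f := by
  ext u
  have h := integral_mul_lap_comm (by omega) (D.zg u (norm_sph u)) hF
  rw [ContinuousMap.smul_apply, Top_apply, Top_apply, smul_eq_mul, ← integral_const_mul]
  refine Eq.trans (integral_congr_ae (Eventually.of_forall fun v => ?_)) (h.trans
    (integral_congr_ae (Eventually.of_forall fun v => ?_)))
  · simp only [hf', zon_unit _ _ (norm_sph v), real_inner_comm]
  · simp only [hf, D.lap_zg v u (norm_sph v) (norm_sph u), real_inner_comm]
    ring

set_option maxHeartbeats 1000000 in
theorem KData.exists_expansion (hn : 3 ≤ n) (hi : i ≤ n - 1) (D : KData n g k)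
    (hgen : GeneratedBy i Φ g) (heven : IsEven Φ)
    (hg : ∀ u : Sph n, ∫ v : Sph n, g ⟪(u : En n), (v : En n)⟫_ℝ ∂(sphVol n) = a₀) :
    ∀ η > 0, ∃ δ > 0, ∀ (K : ConvexBody (En n)) (ρ : ℝ), IsC2H (supp K) → ρ ≤ δ →
      (∀ u : En n, ‖u‖ = 1 → ‖D2 (fun x => supp K x - ‖x‖) u‖ ≤ ρ) →
      ∀ f : C(Sph n, ℝ), (∀ u : Sph n, f u = supp K u - 1) →
      ∃ R : C(Sph n, ℝ), ‖R‖ ≤ η * ρ ∧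
        (supp (Φ K) = fun x => a₀ * ‖x‖ + (i * TT k f x + TT g R x)) ∧
        ∀ u : Sph n, supp (Φ K) (-(u : En n)) = supp (Φ K) u := by
  intro η hη
  have hn0 : 0 < n := by omega
  have hn3 : (3 : ℝ) ≤ n := by exact_mod_cast hn
  have hcast : ((n - 1 : ℕ) : ℝ) = (n : ℝ) - 1 := by rw [Nat.cast_sub (by omega), Nat.cast_one]
  obtain ⟨δ, hδ, hphi⟩ := exists_phi_expansion (by omega) hi hη
  refine ⟨δ, hδ, fun K ρ hK hρ hD f hf => ?_⟩
  obtain ⟨e⟩ : Nonempty (Sph n) := ⟨⟨EuclideanSpace.single (⟨0, hn0⟩ : Fin n) (1 : ℝ), by simp⟩⟩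
  have hρ0 : 0 ≤ ρ := (norm_nonneg _).trans (hD e (norm_sph e))
  have hF := isC2H_sub_norm hK
  set F : En n → ℝ := fun x => supp K x - ‖x‖ with hFdef
  have hH : ∀ u : Sph n, ‖hessOp F u‖ ≤ ρ := fun u =>
    (norm_hessOp_le _ _).trans (hD u (norm_sph u))
  set s : C(Sph n, ℝ) := ⟨fun u => areaDens (⟨0, by omega⟩ : Fin n) i K u, continuous_areaDens hK⟩
  have hs0 : ∀ u, 0 ≤ s u := fun u => (hphi _ ((hH u).trans hρ)).1
  set f' : C(Sph n, ℝ) := ⟨fun u => lap F u, continuous_restrict_sphere hF.continuousOn_lap⟩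
  set R : C(Sph n, ℝ) := s - 1 - ((i : ℝ) / (n - 1 : ℕ)) • f' with hR
  have hRn : ‖R‖ ≤ η * ρ := by
    refine (ContinuousMap.norm_le _ (by positivity)).2 fun u => ?_
    have h1 := (hphi _ ((hH u).trans hρ)).2
    rw [trL_hessOp] at h1
    exact h1.trans (mul_le_mul_of_nonneg_left (hH u) hη.le)
  have hTop : ∀ u : Sph n, supp (Φ K) u = a₀ + (i * Top k f u + Top g R u) := fun u => by
    have h1 : s = 1 + ((i : ℝ) / (n - 1 : ℕ)) • f' + R := by rw [hR]; abel
    have h2 : Top g (1 : C(Sph n, ℝ)) u = a₀ := by rw [Top_apply, ← hg u]; simp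
    have h3 := D.Top_lap hn hF (f := f) (f' := f') (fun u => by rw [hf, hFdef]; simp)
      fun u => rfl
    rw [hgen.supp_eq (by omega) hK (s := s) (fun u => rfl) hs0, h1, map_add, map_add, map_smul, h3]
    simp only [ContinuousMap.add_apply, ContinuousMap.smul_apply, smul_eq_mul, h2, hcast]
    have : (n : ℝ) - 1 ≠ 0 := by linarith
    field_simp
    ring
  refine ⟨R, hRn, ?_, hgen.supp_neg (by omega) heven hK (s := s) (fun u => rfl) hs0⟩
  have hC : IsC2H fun x => a₀ * ‖x‖ + (i * TT k f x + TT g R x) :=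
    (IsC2H.norm.const_mul a₀).add (((isC2H_TT hn0 k.continuous D.zk f).const_mul (i : ℝ)).add
      (isC2H_TT hn0 g.continuous D.zg R))
  funext x
  have hun : ∀ u : En n, ‖u‖ = 1 →
      supp (Φ K) u = a₀ * ‖u‖ + (i * TT k f u + TT g R u) := fun u hu => by
    rw [TT_unit _ _ hu, TT_unit _ _ hu, hu, mul_one]
    exact hTop ⟨u, by simpa using hu⟩
  exact le_antisymm
    (forall_of_unit_of_smul (fun c hc x => supp_smul _ hc x) hC.map_smul
      (fun u hu => (hun u hu).le) x)
    (forall_of_unit_of_smul hC.map_smul (fun c hc x => supp_smul _ hc x)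
      (fun u hu => (hun u hu).ge) x)

end Expansion

/-! ### Rigidity of centred fixed points near the ball -/

section Rigidity

variable {i : ℕ} {Φ : ConvexBody (En n) → ConvexBody (En n)} {g k : C(ℝ, ℝ)} {a₀ : ℝ}

/-- The linearization of `K ↦ a₀⁻¹ Φ K`, acting on a perturbation `f` with remainder `R`. -/
def linOp (i : ℕ) (a₀ : ℝ) (g k : C(ℝ, ℝ)) (f R : C(Sph n, ℝ)) : C(Sph n, ℝ) :=
  a₀⁻¹ • ((i : ℝ) • Top k f + Top g R)

/-- The homogeneous extension of `linOp`. -/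
def linFn (i : ℕ) (a₀ : ℝ) (g k : C(ℝ, ℝ)) (f R : C(Sph n, ℝ)) (x : En n) : ℝ :=
  a₀⁻¹ * ((i : ℝ) * TT k f x + TT g R x)

theorem linFn_coe (f R : C(Sph n, ℝ)) (u : Sph n) :
    linFn i a₀ g k f R u = linOp i a₀ g k f R u := by
  rw [linFn, TT_unit _ _ (norm_sph u), TT_unit _ _ (norm_sph u)]
  rfl

theorem KData.isC2H_linFn (hn : 0 < n) (D : KData n g k) (f R : C(Sph n, ℝ)) :
    IsC2H (linFn i a₀ g k f R) :=
  (((isC2H_TT hn k.continuous D.zk f).const_mul (i : ℝ)).add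
    (isC2H_TT hn g.continuous D.zg R)).const_mul a₀⁻¹

theorem KData.exists_linOp_bound (hn : 0 < n) (D : KData n g k) (i : ℕ) (ha₀ : 0 < a₀) :
    ∃ Q ≥ (1 : ℝ), ∀ f R : C(Sph n, ℝ), ‖linOp i a₀ g k f R‖ ≤ Q * (‖f‖ + ‖R‖) ∧
      ∀ u : En n, ‖u‖ = 1 → ‖D2 (linFn i a₀ g k f R) u‖ ≤ Q * (‖f‖ + ‖R‖) := by
  obtain ⟨Mk, hMk⟩ := exists_D2_TT_bound hn k.continuous D.zk
  obtain ⟨Mg, hMg⟩ := exists_D2_TT_bound hn g.continuous D.zg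
  have hi : (0 : ℝ) ≤ i := Nat.cast_nonneg i
  have ha : 0 < a₀⁻¹ := inv_pos.2 ha₀
  set q := a₀⁻¹ * (i * (‖Top (n := n) k‖ + |Mk|) + (‖Top (n := n) g‖ + |Mg|)) with hq
  have hq0 : 0 ≤ q := by positivity
  have key : ∀ x y r s : ℝ, 0 ≤ r → 0 ≤ s → x ≤ (‖Top (n := n) k‖ + |Mk|) * r →
      y ≤ (‖Top (n := n) g‖ + |Mg|) * s → a₀⁻¹ * (i * x + y) ≤ (q + 1) * (r + s) := by
    intro x y r s hr hs hx hy
    have h1 : a₀⁻¹ * (i * x + y) ≤ a₀⁻¹ * (i * ((‖Top (n := n) k‖ + |Mk|) * r) +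
        (‖Top (n := n) g‖ + |Mg|) * s) := by gcongr
    have h2 : 0 ≤ a₀⁻¹ * (i * (‖Top (n := n) k‖ + |Mk|)) * s := by positivity
    have h3 : 0 ≤ a₀⁻¹ * (‖Top (n := n) g‖ + |Mg|) * r := by positivity
    have h4 : (q + 1) * (r + s) = a₀⁻¹ * (i * ((‖Top (n := n) k‖ + |Mk|) * r) +
        (‖Top (n := n) g‖ + |Mg|) * s) + a₀⁻¹ * (i * (‖Top (n := n) k‖ + |Mk|)) * s +
        a₀⁻¹ * (‖Top (n := n) g‖ + |Mg|) * r + (r + s) := by rw [hq]; ring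
    linarith
  refine ⟨q + 1, by linarith, fun f R => ⟨?_, fun u hu => ?_⟩⟩
  · rw [linOp, norm_smul, Real.norm_of_nonneg ha.le]
    refine (mul_le_mul_of_nonneg_left (norm_add_le _ _) ha.le).trans ?_
    rw [norm_smul, Real.norm_of_nonneg hi]
    refine key _ _ _ _ (norm_nonneg f) (norm_nonneg R) (((Top k).le_opNorm f).trans ?_)
      (((Top g).le_opNorm R).trans ?_) <;> gcongr <;> simp
  · have hu0 := ne_zero_of_norm_eq_one hu
    have hTk := isC2H_TT hn k.continuous D.zk f
    have hTg := isC2H_TT hn g.continuous D.zg R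
    have h1 : D2 (linFn i a₀ g k f R) u =
        a₀⁻¹ • ((i : ℝ) • D2 (TT k f) u + D2 (TT g R) u) := by
      rw [← hTk.D2_const_mul (i : ℝ) hu0, ← (hTk.const_mul (i : ℝ)).D2_add hTg hu0,
        ← ((hTk.const_mul (i : ℝ)).add hTg).D2_const_mul a₀⁻¹ hu0]
      rfl
    rw [h1, norm_smul, Real.norm_of_nonneg ha.le]
    refine (mul_le_mul_of_nonneg_left (norm_add_le _ _) ha.le).trans ?_
    rw [norm_smul, Real.norm_of_nonneg hi]
    refine key _ _ _ _ (norm_nonneg f) (norm_nonneg R) ((hMk f u hu).trans ?_)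
      ((hMg R u hu).trans ?_) <;> gcongr
    · exact (le_abs_self _).trans (le_add_of_nonneg_left (norm_nonneg _))
    · exact (le_abs_self _).trans (le_add_of_nonneg_left (norm_nonneg _))

theorem linOp_linOp (ha₀ : a₀ ≠ 0) (hi : (i : ℝ) ≠ 0) (f R R₁ : C(Sph n, ℝ)) :
    (a₀ / i) ^ 2 • linOp i a₀ g k (linOp i a₀ g k f R) R₁ =
      Top k (Top k f) + (a₀ / i) ^ 2 • linOp i a₀ g k (linOp i a₀ g k 0 R) R₁ := by
  simp only [linOp, map_smul, map_add, map_zero, smul_zero, zero_add, smul_add, smul_smul]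
  have h : (a₀ / i) ^ 2 * (a₀⁻¹ * (i * (a₀⁻¹ * i))) = 1 := by field_simp
  rw [h, one_smul, add_assoc]

theorem abs_l2_one_le (f : C(Sph n, ℝ)) : |l2 1 f| ≤ l2 (1 : C(Sph n, ℝ)) 1 * ‖f‖ := by
  have h1 := norm_integral_le_of_norm_le_const (μ := sphVol n) (f := fun v => (1 : C(Sph n, ℝ)) v *
    f v) (C := ‖f‖) (Eventually.of_forall fun v => by simpa using f.norm_coe_le_norm v)
  have h2 : l2 (1 : C(Sph n, ℝ)) 1 = (sphVol n).real Set.univ := by simp [l2_apply]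
  rw [h2, mul_comm]
  exact h1

/-- The sup norm estimate for a centred even solution of the perturbed fixed point equation. -/
theorem KData.norm_le_of_fixed (hn : 3 ≤ n) (D : KData n g k)
    (hg : ∀ u : Sph n, ∫ v : Sph n, g ⟪(u : En n), (v : En n)⟫_ℝ ∂(sphVol n) = a₀)
    (ha₀ : a₀ ≠ 0) (hi : (i : ℝ) ≠ 0) {C Q t β : ℝ} (hQ : 1 ≤ Q) (hC : 0 ≤ C)
    (hanti : ∀ f : C(Sph n, ℝ), (∀ u, f (-u) = f u) → l2 1 f = 0 →
      ‖f‖ ≤ C * ‖Top k (Top k f) - (a₀ / i) ^ 2 • f‖)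
    (hlin : ∀ f R : C(Sph n, ℝ), ‖linOp i a₀ g k f R‖ ≤ Q * (‖f‖ + ‖R‖))
    {f R R₁ : C(Sph n, ℝ)} (hev : ∀ u, f (-u) = f u) (hf0 : l2 1 f = 0) (hf1 : ‖f‖ ≤ 1)
    (hR : ‖R‖ ≤ t) (hR₁ : ‖R₁‖ ≤ 2 * Q * t)
    (hfix : β • (1 + f) = 1 + linOp i a₀ g k (linOp i a₀ g k f R) R₁) :
    |β - 1| ≤ 3 * Q ^ 2 * t ∧ ‖f‖ ≤ 3 * C * (a₀ / i) ^ 2 * (3 * Q ^ 2) * t := by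
  obtain ⟨e⟩ : Nonempty (Sph n) :=
    ⟨⟨EuclideanSpace.single (⟨0, by omega⟩ : Fin n) (1 : ℝ), by simp⟩⟩
  have hone : 0 < l2 (1 : C(Sph n, ℝ)) 1 := l2_self_pos fun h => by
    simpa using congrArg (fun F : C(Sph n, ℝ) => F e) h
  have hk := D.integral_k hn hg
  set l := a₀ / i with hl
  have hl0 : l ^ 2 ≠ 0 := pow_ne_zero 2 (div_ne_zero ha₀ hi)
  have hdec := linOp_linOp (g := g) (k := k) ha₀ hi f R R₁
  rw [← hl] at hdec
  set E := linOp i a₀ g k (linOp i a₀ g k 0 R) R₁ with hE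
  set G := linOp i a₀ g k (linOp i a₀ g k f R) R₁ with hG
  have hEn : ‖E‖ ≤ 3 * Q ^ 2 * t := by
    have h1 := hlin (linOp i a₀ g k 0 R) R₁
    have h2 := hlin 0 R
    rw [norm_zero, zero_add] at h2
    have hQ0 : 0 ≤ Q := by linarith
    calc ‖E‖ ≤ Q * (‖linOp i a₀ g k 0 R‖ + ‖R₁‖) := h1
      _ ≤ Q * (Q * t + 2 * Q * t) := by
        gcongr
        exact h2.trans (by gcongr)
      _ = 3 * Q ^ 2 * t := by ring
  have hβ : |β - 1| ≤ ‖E‖ := by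
    have h1 : l2 1 G = l2 1 E := by
      have h := congrArg (l2 (1 : C(Sph n, ℝ))) hdec
      rw [map_smul, map_add, map_smul, l2_one_Top hk, l2_one_Top hk, hf0, mul_zero, mul_zero,
        zero_add] at h
      exact smul_right_injective ℝ hl0 h
    have h2 := congrArg (l2 (1 : C(Sph n, ℝ))) hfix
    rw [map_smul, map_add, map_add, hf0, h1, add_zero, smul_eq_mul] at h2
    have h3 := abs_l2_one_le E
    have h4 : l2 1 E = (β - 1) * l2 (1 : C(Sph n, ℝ)) 1 := by linarith
    rw [h4, abs_mul, abs_of_pos hone, mul_comm] at h3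
    exact le_of_mul_le_mul_left h3 hone
  refine ⟨hβ.trans hEn, ?_⟩
  have hid : Top k (Top k f) - l ^ 2 • f = l ^ 2 • ((β - 1) • 1 + (β - 1) • f - E) := by
    have h1 : Top k (Top k f) = l ^ 2 • (G - E) := by rw [smul_sub, hdec]; abel
    have h2 : G = β • (1 + f) - 1 := by rw [hfix]; abel
    rw [h1, h2, ← smul_sub]
    congr 1
    module
  have hn1 : ‖(β - 1) • (1 : C(Sph n, ℝ)) + (β - 1) • f - E‖ ≤ 3 * ‖E‖ := by
    refine (norm_sub_le _ _).trans ?_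
    have h1 : ‖(1 : C(Sph n, ℝ))‖ ≤ 1 := (ContinuousMap.norm_le _ zero_le_one).2 fun u => by simp
    have h2 := norm_add_le ((β - 1) • (1 : C(Sph n, ℝ))) ((β - 1) • f)
    rw [norm_smul, norm_smul, Real.norm_eq_abs] at h2
    have h3 : |β - 1| * ‖(1 : C(Sph n, ℝ))‖ ≤ |β - 1| * 1 := by gcongr
    have h4 : |β - 1| * ‖f‖ ≤ |β - 1| * 1 := by gcongr
    linarith
  calc ‖f‖ ≤ C * ‖Top k (Top k f) - l ^ 2 • f‖ := hanti f hev hf0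
    _ ≤ C * (l ^ 2 * (3 * (3 * Q ^ 2 * t))) := by
      rw [hid, norm_smul, Real.norm_of_nonneg (sq_nonneg l)]
      gcongr
      exact hn1.trans (by gcongr)
    _ = 3 * C * l ^ 2 * (3 * Q ^ 2) * t := by ring

/-- The second order estimate for a solution of the perturbed fixed point equation. -/
theorem KData.norm_D2_le_of_fixed (hn : 0 < n) (D : KData n g k) {M Q t β q : ℝ}
    (hM : ∀ u : En n, ‖u‖ = 1 → ‖D2 (fun x : En n => ‖x‖) u‖ ≤ M) (hQ : 1 ≤ Q)
    (hlin : ∀ f R : C(Sph n, ℝ), ‖linOp i a₀ g k f R‖ ≤ Q * (‖f‖ + ‖R‖) ∧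
      ∀ u : En n, ‖u‖ = 1 → ‖D2 (linFn i a₀ g k f R) u‖ ≤ Q * (‖f‖ + ‖R‖))
    {h : En n → ℝ} (hh : IsC2H h) {f R R₁ : C(Sph n, ℝ)} (hf : ‖f‖ ≤ q * t)
    (hR : ‖R‖ ≤ t) (hR₁ : ‖R₁‖ ≤ 2 * Q * t) (hβ : |β - 1| ≤ 3 * Q ^ 2 * t)
    (ht : 3 * Q ^ 2 * t ≤ 1 / 2)
    (hfix : ∀ x, β * h x = ‖x‖ + linFn i a₀ g k (linOp i a₀ g k f R) R₁ x)
    {u : En n} (hu : ‖u‖ = 1) :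
    ‖D2 (fun x => h x - ‖x‖) u‖ ≤ 2 * (3 * Q ^ 2 * M + Q ^ 2 * (q + 3)) * t := by
  have hu0 := ne_zero_of_norm_eq_one hu
  have hF : IsC2H fun x => h x - ‖x‖ := hh.sub IsC2H.norm
  set L := linFn i a₀ g k (linOp i a₀ g k f R) R₁ with hL
  have hLC : IsC2H L := D.isC2H_linFn hn _ _
  have hM0 : 0 ≤ M := (norm_nonneg _).trans (hM u hu)
  have hQ0 : 0 ≤ Q := by linarith
  have hDL : ‖D2 L u‖ ≤ Q ^ 2 * (q + 3) * t := by
    calc ‖D2 L u‖ ≤ Q * (‖linOp i a₀ g k f R‖ + ‖R₁‖) := (hlin _ _).2 u hu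
      _ ≤ Q * (Q * (q * t + t) + 2 * Q * t) := by
        gcongr
        exact (hlin f R).1.trans (by gcongr)
      _ = Q ^ 2 * (q + 3) * t := by ring
  have hid : (fun x => β * (h x - ‖x‖)) = fun x => (1 - β) * ‖x‖ + L x := by
    funext x
    have := hfix x
    linarith
  have hD : β • D2 (fun x => h x - ‖x‖) u = (1 - β) • D2 (fun x : En n => ‖x‖) u + D2 L u := by
    rw [← hF.D2_const_mul β hu0, hid, (IsC2H.norm.const_mul (1 - β)).D2_add hLC hu0,
      IsC2H.norm.D2_const_mul _ hu0]
  have hβ2 : 1 / 2 ≤ β := by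
    have := (abs_le.1 hβ).1
    linarith
  have h1 : ‖β • D2 (fun x => h x - ‖x‖) u‖ ≤ 3 * Q ^ 2 * t * M + Q ^ 2 * (q + 3) * t := by
    rw [hD]
    refine (norm_add_le _ _).trans (add_le_add ?_ hDL)
    rw [norm_smul, Real.norm_eq_abs, abs_sub_comm]
    exact mul_le_mul hβ (hM u hu) (norm_nonneg _) ((abs_nonneg _).trans hβ)
  rw [norm_smul, Real.norm_of_nonneg (by linarith)] at h1
  nlinarith [mul_le_mul_of_nonneg_right hβ2 (norm_nonneg (D2 (fun x => h x - ‖x‖) u))]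

end Rigidity

theorem scale_scale (a b : ℝ) (K : ConvexBody (En n)) : scale a (scale b K) = scale (a * b) K :=
  ConvexBody.ext (smul_smul a b (K : Set (En n)))

theorem scale_one (K : ConvexBody (En n)) : scale 1 K = K :=
  ConvexBody.ext (one_smul ℝ (K : Set (En n)))

section Rigidity

variable {i : ℕ} {Φ : ConvexBody (En n) → ConvexBody (En n)} {g k : C(ℝ, ℝ)} {a₀ : ℝ}

set_option maxHeartbeats 2000000 in
/-- Centred fixed points that are `C²` close to the unit ball equal the unit ball. -/
theorem KData.exists_rigidity (hn : 3 ≤ n) (hi₀ : i ≠ 0) (hi : i ≤ n - 1) (D : KData n g k)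
    (hgen : GeneratedBy i Φ g) (heven : IsEven Φ) (hdeg : HasDegree i Φ)
    (hg : ∀ u : Sph n, ∫ v : Sph n, g ⟪(u : En n), (v : En n)⟫_ℝ ∂(sphVol n) = a₀) :
    ∃ δ > 0, ∀ K : ConvexBody (En n), IsC2H (supp K) → ∀ f : C(Sph n, ℝ),
      (∀ u : Sph n, f u = supp K u - 1) → ‖f‖ ≤ δ →
      (∀ u : En n, ‖u‖ = 1 → ‖D2 (fun x => supp K x - ‖x‖) u‖ ≤ δ) → l2 1 f = 0 →
      ∀ α : ℝ, 0 < α → Φ (Φ K) = scale α K → f = 0 := by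
  have hn0 : 0 < n := by omega
  obtain ⟨e⟩ : Nonempty (Sph n) :=
    ⟨⟨EuclideanSpace.single (⟨0, hn0⟩ : Fin n) (1 : ℝ), by simp⟩⟩
  have ha₀ : 0 < a₀ := D.const_pos e (D.integral_k hn hg)
  have hir : (0 : ℝ) < i := by exact_mod_cast Nat.pos_of_ne_zero hi₀
  have hin : (i : ℝ) ≤ (n : ℝ) - 1 := by
    have : (i : ℝ) + 1 ≤ n := by exact_mod_cast (by omega : i + 1 ≤ n)
    linarith
  obtain ⟨C, hC⟩ := D.exists_antilipschitz hn hg (l := a₀ / i) (div_pos ha₀ hir).ne' (by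
    rw [abs_of_pos (div_pos ha₀ hir), ← mul_div_assoc, le_div_iff₀ hir, mul_comm]
    gcongr)
  obtain ⟨Q, hQ1, hQ⟩ := D.exists_linOp_bound hn0 i ha₀
  obtain ⟨M, hM0, hM⟩ := exists_bound_sphere (IsC2H.norm (E := En n)).continuousOn_D2
  set q := 3 * |C| * (a₀ / i) ^ 2 * (3 * Q ^ 2) with hq
  have hq0 : 0 ≤ q := by positivity
  set W := 1 + 3 * Q ^ 2 + q + 2 * (3 * Q ^ 2 * M + Q ^ 2 * (q + 3)) with hW
  have hW1 : 3 * Q ^ 2 ≤ W ∧ q ≤ W ∧ 2 * (3 * Q ^ 2 * M + Q ^ 2 * (q + 3)) ≤ W ∧ 1 ≤ W := by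
    have h1 : 0 ≤ Q ^ 2 := sq_nonneg Q
    have h2 : 0 ≤ 2 * (3 * Q ^ 2 * M + Q ^ 2 * (q + 3)) := by positivity
    refine ⟨?_, ?_, ?_, ?_⟩ <;> linarith
  have hW0 : 0 < W := by linarith [hW1.2.2.2]
  set η := (2 * W)⁻¹ with hη
  have hη0 : 0 < η := by positivity
  have hWη : W * η = 1 / 2 := by rw [hη]; field_simp
  obtain ⟨δ₁, hδ₁, hexp⟩ := D.exists_expansion hn hi hgen heven hg η hη0
  refine ⟨min 1 (min δ₁ (δ₁ / (2 * Q))), by positivity, fun K hK f hf hfδ hDδ hf0 α hα hfix => ?_⟩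
  have hF := isC2H_sub_norm hK
  obtain ⟨u₀, hu₀, hmax⟩ := (isCompact_sphere (0 : En n) 1).exists_isMaxOn ⟨e, e.2⟩
    ((hF.continuousOn_D2.norm).mono fun x hx => ne_zero_of_norm_eq_one (by simpa using hx))
  rw [mem_sphere_zero_iff_norm] at hu₀
  set d := ‖D2 (fun x => supp K x - ‖x‖) u₀‖ with hd
  have hdmax : ∀ u : En n, ‖u‖ = 1 → ‖D2 (fun x => supp K x - ‖x‖) u‖ ≤ d := fun u hu =>
    hmax (by simpa using hu)
  set ρ := max ‖f‖ d with hρ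
  have hρ0 : 0 ≤ ρ := (norm_nonneg f).trans (le_max_left _ _)
  have hρδ : ρ ≤ min 1 (min δ₁ (δ₁ / (2 * Q))) := max_le hfδ (hDδ u₀ hu₀)
  have hρ1 : ρ ≤ 1 := hρδ.trans (min_le_left _ _)
  have hρδ₁ : ρ ≤ δ₁ := hρδ.trans ((min_le_right _ _).trans (min_le_left _ _))
  have hρQ : 2 * Q * ρ ≤ δ₁ := by
    have h := hρδ.trans ((min_le_right _ _).trans (min_le_right _ _))
    rw [le_div_iff₀ (by positivity)] at h
    linarith
  obtain ⟨R, hR, hΦ, -⟩ := hexp K ρ hK hρδ₁ (fun u hu => (hdmax u hu).trans (le_max_right _ _)) f hf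
  have hηρ : η * ρ ≤ ρ := by
    have : η ≤ 1 := by nlinarith [hW1.2.2.2]
    nlinarith
  set K₁ := scale a₀⁻¹ (Φ K) with hK₁
  have hsK₁ : supp K₁ = fun x => ‖x‖ + linFn i a₀ g k f R x := by
    funext x
    rw [hK₁, supp_scale (inv_pos.2 ha₀).le, hΦ, linFn, mul_add, inv_mul_cancel_left₀ ha₀.ne']
  have hLC := D.isC2H_linFn (i := i) (a₀ := a₀) hn0 f R
  have hK₁C : IsC2H (supp K₁) := by
    rw [hsK₁]
    exact IsC2H.norm.add hLC
  have hsub : (fun x => supp K₁ x - ‖x‖) = linFn i a₀ g k f R := by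
    funext x
    rw [hsK₁]
    ring
  have hsum : Q * (‖f‖ + ‖R‖) ≤ 2 * Q * ρ := by
    have h1 : ‖f‖ ≤ ρ := le_max_left _ _
    have h2 : ‖R‖ ≤ ρ := hR.trans hηρ
    nlinarith
  obtain ⟨R₁, hR₁, hΦ₁, hneg⟩ := hexp K₁ (2 * Q * ρ) hK₁C hρQ
    (fun u hu => by
      rw [hsub]
      exact ((hQ f R).2 u hu).trans hsum)
    (linOp i a₀ g k f R) fun u => by
      rw [← linFn_coe, ← hsub]
      simp
  have hΦK : Φ K = scale a₀ K₁ := by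
    rw [hK₁, scale_scale, mul_inv_cancel₀ ha₀.ne', scale_one]
  have hrel : ∀ x, α * supp K x = a₀ ^ i * supp (Φ K₁) x := fun x => by
    rw [← supp_scale hα.le, ← hfix, hΦK, hdeg _ _ ha₀.le, supp_scale (by positivity)]
  set β := α / a₀ ^ (i + 1) with hβ
  have hfixβ : ∀ x, β * supp K x = ‖x‖ + linFn i a₀ g k (linOp i a₀ g k f R) R₁ x := fun x => by
    have h1 : β * supp K x = a₀⁻¹ * supp (Φ K₁) x := by
      rw [hβ, div_mul_eq_mul_div, hrel, pow_succ]
      field_simp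
    rw [h1, hΦ₁, linFn, mul_add, inv_mul_cancel_left₀ ha₀.ne']
  have hev : ∀ u, f (-u) = f u := fun u => by
    have h1 : α * supp K (-(u : En n)) = α * supp K u := by rw [hrel, hrel, hneg]
    rw [hf, hf, coe_neg_sphere, mul_left_cancel₀ hα.ne' h1]
  have hfixf : β • (1 + f) = 1 + linOp i a₀ g k (linOp i a₀ g k f R) R₁ := by
    ext u
    have h1 := hfixβ u
    rw [linFn_coe, norm_sph] at h1
    simp only [ContinuousMap.smul_apply, ContinuousMap.add_apply, ContinuousMap.one_apply,
      smul_eq_mul, hf]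
    rw [← h1]
    ring
  have hR₁' : ‖R₁‖ ≤ 2 * Q * (η * ρ) := hR₁.trans_eq (by ring)
  obtain ⟨h1, h2⟩ := D.norm_le_of_fixed hn hg ha₀.ne' hir.ne' hQ1 (abs_nonneg C)
    (fun f hf hf0 => (hC f hf hf0).trans (by gcongr; exact le_abs_self C)) (fun f R => (hQ f R).1)
    hev hf0 ((le_max_left _ _).trans hρ1) hR hR₁' hfixf
  have hηρ0 : 0 ≤ η * ρ := by positivity
  have hWρ : W * (η * ρ) = ρ / 2 := by rw [← mul_assoc, hWη]; ring
  have h3 := D.norm_D2_le_of_fixed (q := q) hn0 hM hQ1 hQ hK h2 hR hR₁' h1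
    (by nlinarith [mul_le_mul_of_nonneg_right hW1.1 hηρ0]) hfixβ hu₀
  have h4 : ρ ≤ ρ / 2 := by
    rw [← hWρ]
    exact max_le (h2.trans (mul_le_mul_of_nonneg_right hW1.2.1 hηρ0))
      (h3.trans (mul_le_mul_of_nonneg_right hW1.2.2.1 hηρ0))
  have h5 : ‖f‖ ≤ 0 := (le_max_left ‖f‖ d).trans (by linarith)
  exact norm_le_zero_iff.1 h5

end Rigidity

theorem bound_of_C2dist_lt {F G : En n → ℝ} (hF : IsC2H F) (hG : IsC2H G) {ε : ℝ}
    (h : C2dist F G < ε) {u : En n} (hu : ‖u‖ = 1) :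
    |F u - G u| ≤ ε ∧ ‖D2 (fun x => F x - G x) u‖ ≤ ε := by
  have hcont : ∀ {H : En n → ℝ}, IsC2H H → ContinuousOn (iteratedFDeriv ℝ 2 H) {0}ᶜ := fun hH =>
    ((hH.contDiffOn.continuousOn_iteratedFDerivWithin le_rfl isOpen_compl_singleton.uniqueDiffOn)
      ).congr fun x hx => (iteratedFDerivWithin_of_isOpen 2 isOpen_compl_singleton hx).symm
  have hcont₁ : ∀ {H : En n → ℝ}, IsC2H H → ContinuousOn (fderiv ℝ H) {0}ᶜ := fun hH =>
    hH.contDiffOn.continuousOn_fderiv_of_isOpen isOpen_compl_singleton one_le_two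
  obtain ⟨C₀, -, hC₀⟩ := exists_bound_sphere (hF.continuousOn.sub hG.continuousOn)
  obtain ⟨C₁, -, hC₁⟩ := exists_bound_sphere ((hcont₁ hF).sub (hcont₁ hG))
  obtain ⟨C₂, -, hC₂⟩ := exists_bound_sphere ((hcont hF).sub (hcont hG))
  have hle := (le_ciSup (f := fun u : Sph n => |F (u : En n) - G (u : En n)| +
    ‖fderiv ℝ F (u : En n) - fderiv ℝ G (u : En n)‖ +
    ‖iteratedFDeriv ℝ 2 F (u : En n) - iteratedFDeriv ℝ 2 G (u : En n)‖)
    ⟨C₀ + C₁ + C₂, by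
      rintro _ ⟨v, rfl⟩
      exact add_le_add (add_le_add (hC₀ v (norm_sph v)) (hC₁ v (norm_sph v)))
        (hC₂ v (norm_sph v))⟩ ⟨u, by simpa using hu⟩).trans h.le
  have h0 := abs_nonneg (F u - G u)
  have h1 := norm_nonneg (fderiv ℝ F u - fderiv ℝ G u)
  have h2 := norm_nonneg (iteratedFDeriv ℝ 2 F u - iteratedFDeriv ℝ 2 G u)
  refine ⟨by simp only at hle; linarith, ?_⟩
  refine le_trans ?_ (by simp only at hle; linarith :
    ‖iteratedFDeriv ℝ 2 F u - iteratedFDeriv ℝ 2 G u‖ ≤ ε)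
  rw [hF.D2_sub hG (ne_zero_of_norm_eq_one hu)]
  refine ContinuousLinearMap.opNorm_le_bound _ h2 fun v =>
    ContinuousLinearMap.opNorm_le_bound _ (by positivity) fun w => ?_
  have h3 := (iteratedFDeriv ℝ 2 F u - iteratedFDeriv ℝ 2 G u).le_opNorm ![v, w]
  rw [sub_apply, sub_apply, D2_apply_eq_iteratedFDeriv, D2_apply_eq_iteratedFDeriv]
  simpa [Fin.prod_univ_two, mul_assoc] using h3

theorem isBall_of_scale_eq {K : ConvexBody (En n)} {t : ℝ} (ht : 0 < t)
    (h : scale t K = ballB n) : IsBall K := by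
  refine ⟨0, t⁻¹, inv_pos.2 ht, ?_⟩
  have h1 : K = scale t⁻¹ (ballB n) := by
    rw [← h, scale_scale, inv_mul_cancel₀ ht.ne', scale_one]
  rw [h1]
  change t⁻¹ • closedBall (0 : En n) 1 = closedBall 0 t⁻¹
  rw [_root_.smul_closedBall _ _ zero_le_one, smul_zero, mul_one, Real.norm_of_nonneg (inv_pos.2 ht).le]

/-- A function close to the norm, divided by its mean, is close to the norm. -/
theorem exists_normalization (hn : 0 < n) {δ : ℝ} (hδ : 0 < δ) :
    ∃ ε > 0, ∀ h : En n → ℝ, IsC2H h → C2dist h (fun x => ‖x‖) < ε →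
      ∃ c > 0, ∃ f : C(Sph n, ℝ), (∀ u : Sph n, f u = c * h u - 1) ∧ ‖f‖ ≤ δ ∧ l2 1 f = 0 ∧
        ∀ u : En n, ‖u‖ = 1 → ‖D2 (fun x => c * h x - ‖x‖) u‖ ≤ δ := by
  obtain ⟨M, hM0, hM⟩ := exists_bound_sphere (IsC2H.norm (E := En n)).continuousOn_D2
  obtain ⟨e⟩ : Nonempty (Sph n) :=
    ⟨⟨EuclideanSpace.single (⟨0, hn⟩ : Fin n) (1 : ℝ), by simp⟩⟩
  have hone : 0 < l2 (1 : C(Sph n, ℝ)) 1 := l2_self_pos fun h => by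
    simpa using congrArg (fun F : C(Sph n, ℝ) => F e) h
  set ε := min (1 / 2) (δ / (4 * (1 + M))) with hε
  have hε0 : 0 < ε := by positivity
  have hε1 : ε ≤ 1 / 2 := min_le_left _ _
  have hεδ : 4 * (1 + M) * ε ≤ δ := by
    have h := min_le_right (1 / 2) (δ / (4 * (1 + M)))
    rw [← hε, le_div_iff₀ (by positivity)] at h
    linarith
  refine ⟨ε, hε0, fun h hh hd => ?_⟩
  have hb := fun u hu => bound_of_C2dist_lt hh IsC2H.norm hd (u := u) hu
  set F : C(Sph n, ℝ) := ⟨fun u => h u, continuous_restrict_sphere hh.continuousOn⟩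
  have hF1 : ‖F - 1‖ ≤ ε := (ContinuousMap.norm_le _ hε0.le).2 fun u => by
    have := (hb u (norm_sph u)).1
    rwa [norm_sph] at this
  set m := l2 1 F / l2 (1 : C(Sph n, ℝ)) 1 with hm
  have hmF : l2 1 F = m * l2 (1 : C(Sph n, ℝ)) 1 := by rw [hm, div_mul_cancel₀ _ hone.ne']
  have hm1 : |m - 1| ≤ ε := by
    have h1 := abs_l2_one_le (F - 1)
    have h2 : l2 1 (F - 1) = (m - 1) * l2 (1 : C(Sph n, ℝ)) 1 := by rw [map_sub, hmF]; ring
    rw [h2, abs_mul, abs_of_pos hone, mul_comm] at h1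
    exact (le_of_mul_le_mul_left h1 hone).trans hF1
  have hm2 : 1 / 2 ≤ m := by linarith [(abs_le.1 hm1).1]
  have hm0 : 0 < m := by linarith
  have hmi : m⁻¹ ≤ 2 := by
    rw [inv_le_comm₀ hm0 two_pos]
    linarith
  have hmi0 : 0 < m⁻¹ := inv_pos.2 hm0
  have hmi1 : |m⁻¹ - 1| ≤ 2 * ε := by
    have h1 : m⁻¹ - 1 = m⁻¹ * (1 - m) := by field_simp
    rw [h1, abs_mul, abs_of_pos hmi0, abs_sub_comm]
    exact mul_le_mul hmi hm1 (abs_nonneg _) zero_le_two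
  refine ⟨m⁻¹, hmi0, m⁻¹ • F - 1, fun u => rfl, ?_, ?_, fun u hu => ?_⟩
  · have h1 : m⁻¹ • F - 1 = m⁻¹ • (F - 1) + (m⁻¹ - 1) • (1 : C(Sph n, ℝ)) := by module
    have h2 : ‖(1 : C(Sph n, ℝ))‖ ≤ 1 := (ContinuousMap.norm_le _ zero_le_one).2 fun u => by simp
    rw [h1]
    calc _ ≤ ‖m⁻¹ • (F - 1)‖ + ‖(m⁻¹ - 1) • (1 : C(Sph n, ℝ))‖ := norm_add_le _ _
      _ ≤ 2 * ε + 2 * ε * 1 := by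
        rw [norm_smul, norm_smul, Real.norm_of_nonneg hmi0.le, Real.norm_eq_abs]
        gcongr
      _ ≤ δ := by nlinarith
  · rw [map_sub, map_smul, hmF, smul_eq_mul, inv_mul_cancel_left₀ hm0.ne', sub_self]
  · have hu0 := ne_zero_of_norm_eq_one hu
    have h1 : (fun x => m⁻¹ * h x - ‖x‖) =
        fun x => m⁻¹ * (h x - ‖x‖) + (m⁻¹ - 1) * ‖x‖ := by
      funext x
      ring
    have hs : IsC2H fun x => h x - ‖x‖ := hh.sub IsC2H.norm
    rw [h1, (hs.const_mul m⁻¹).D2_add (IsC2H.norm.const_mul _) hu0, hs.D2_const_mul _ hu0,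
      IsC2H.norm.D2_const_mul _ hu0]
    calc _ ≤ ‖m⁻¹ • D2 (fun x => h x - ‖x‖) u‖ + ‖(m⁻¹ - 1) • D2 (fun x : En n => ‖x‖) u‖ :=
          norm_add_le _ _
      _ ≤ 2 * ε + 2 * ε * M := by
        rw [norm_smul, norm_smul, Real.norm_of_nonneg hmi0.le, Real.norm_eq_abs]
        exact add_le_add (mul_le_mul hmi (hb u hu).2 (norm_nonneg _) zero_le_two)
          (mul_le_mul hmi1 (hM u hu) (norm_nonneg _) (by positivity))
      _ ≤ δ := by nlinarith

end

/-- **Corollary 1.** Locally around the ball, the only smooth solutions of the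
fixed point problem `Φ_i² K = α K` for a `C^∞₊` regular valuation are balls. -/
theorem fixed_points_are_balls
    (n i : ℕ) (hn : 3 ≤ n) (hi₁ : 2 ≤ i) (hi₂ : i ≤ n - 1)
    (Φ : ConvexBody (En n) → ConvexBody (En n))
    (hval : IsMinkowskiValuation Φ)
    (htrans : TranslationInvariant Φ)
    (hdeg : HasDegree i Φ)
    (hrot : RotationEquivariant Φ)
    (heven : IsEven Φ)
    (hreg : CInfRegular i Φ) :
    ∃ ε > (0 : ℝ), ∀ K : ConvexBody (En n),
      ContDiffOn ℝ 2 (supp K) {0}ᶜ →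
      (∃ γ : ℝ, 0 < γ ∧ C2dist (supp (scale γ K)) (supp (ballB n)) < ε) →
      ∀ α : ℝ, 0 < α → Φ (Φ K) = scale α K → IsBall K := by
  have hn0 : 0 < n := by omega
  obtain ⟨g, k, D, hgen⟩ := exists_kdata hn hreg
  obtain ⟨a₀, hg⟩ := exists_Top_one hn0 g
  obtain ⟨δ, hδ, hrig⟩ := D.exists_rigidity hn (by omega) hi₂ hgen heven hdeg hg
  obtain ⟨ε, hε, hnorm⟩ := exists_normalization hn0 hδ
  refine ⟨ε, hε, fun K hK ⟨γ, hγ, hd⟩ α hα hfix => ?_⟩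
  have hball : supp (ballB n) = fun x => ‖x‖ := funext supp_ballB
  have hsγ : supp (scale γ K) = fun x => γ * supp K x := funext (supp_scale hγ.le K)
  have hKC := isC2H_supp hK
  rw [hball, hsγ] at hd
  obtain ⟨c, hc, f, hf, hfδ, hf0, hD⟩ := hnorm _ (hKC.const_mul γ) hd
  have ht : 0 < c * γ := mul_pos hc hγ
  have hst : supp (scale (c * γ) K) = fun x => c * (γ * supp K x) := by
    funext x
    rw [supp_scale ht.le, mul_assoc]
  have hfz := hrig (scale (c * γ) K) (by rw [hst]; exact (hKC.const_mul γ).const_mul c) f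
    (fun u => by rw [hst]; exact hf u) hfδ (by rw [hst]; exact hD) hf0
    (((c * γ) ^ i) ^ i * α * (c * γ)⁻¹) (by positivity) (by
      rw [hdeg _ _ ht.le, hdeg _ _ (by positivity), hfix, scale_scale, scale_scale,
        inv_mul_cancel_right₀ ht.ne'])
  refine isBall_of_scale_eq ht (body_ext fun u hu => ?_)
  have h := hf ⟨u, by simpa using hu⟩
  rw [hfz] at h
  rw [hst, hball]
  exact (sub_eq_zero.1 h.symm).trans hu.symm

end MinkIter
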